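/- Let (B, 𝔪, k) be a commutative Noetherian local ring and M a finitely generated B-module which is maximal Cohen–Macaulay over B and has finite CI-dimension; set M^∨ = Hom_B(M, B). Fix minimal free resolutions of M and of M^∨ over B, with i-th Betti numbers β_i(M) and β_i(M^∨). Then for every natural number n, limsup_{i→∞} β_i(M)/iⁿ = limsup_{i→∞} β_i(M^∨)/iⁿ as elements of [0, ∞]; in particular the complexities and the Betti degrees of M and M^∨ coincide. -/

import Mathlib

open IsLocalRing Filter TensorProduct

/-- `β : ℕ → ℕ` is the sequence of ranks of a free resolution
`⋯ → R^{β 1} → R^{β 0} → M → 0` of `M` over `R`. -/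
def IsFreeResolutionBetti (R : Type) [CommRing R] (M : Type) [AddCommGroup M]
    [Module R M] (β : ℕ → ℕ) : Prop :=
  ∃ (d : ∀ i : ℕ, (Fin (β (i + 1)) → R) →ₗ[R] (Fin (β i) → R))
    (ε : (Fin (β 0) → R) →ₗ[R] M),
      Function.Surjective ε ∧
      LinearMap.ker ε = LinearMap.range (d 0) ∧
      (∀ i, LinearMap.ker (d i) = LinearMap.range (d (i + 1)))

/-- `β : ℕ → ℕ` is the sequence of Betti numbers of a *minimal* free resolution of `M`
over the local ring `B`, i.e. a free resolution with `d(F_{i+1}) ⊆ 𝔪·F_i`. -/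
def IsMinimalFreeResolutionBetti (B : Type) [CommRing B] [IsLocalRing B] (M : Type)
    [AddCommGroup M] [Module B M] (β : ℕ → ℕ) : Prop :=
  ∃ (d : ∀ i : ℕ, (Fin (β (i + 1)) → B) →ₗ[B] (Fin (β i) → B))
    (ε : (Fin (β 0) → B) →ₗ[B] M),
      Function.Surjective ε ∧
      LinearMap.ker ε = LinearMap.range (d 0) ∧
      (∀ i, LinearMap.ker (d i) = LinearMap.range (d (i + 1))) ∧
      (∀ i, LinearMap.range (d i) ≤
        (maximalIdeal B) • (⊤ : Submodule B (Fin (β i) → B)))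

/-- A witness to the finiteness of the CI-dimension of a module `M` over a local ring `B`:
a diagram `A → B′ ← B` of Noetherian local rings in which `B → B′` is flat local,
`A → B′` is surjective with kernel generated by an `A`-regular sequence contained in the
maximal ideal of `A`, and `B′ ⊗_B M` admits a finite free resolution over `A`. -/
structure FiniteCIDimWitness (B : Type) [CommRing B] [IsLocalRing B]
    (M : Type) [AddCommGroup M] [Module B M] : Type 1 where
  A : Type
  B' : Type
  [instA : CommRing A]
  [instB' : CommRing B']
  [instLocalA : IsLocalRing A]
  [instLocalB' : IsLocalRing B']
  [instNoethA : IsNoetherianRing A]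
  [instNoethB' : IsNoetherianRing B']
  [instAlg : Algebra B B']
  flat : Module.Flat B B'
  localHom : IsLocalHom (algebraMap B B')
  π : A →+* B'
  surj : Function.Surjective π
  c : ℕ
  f : Fin c → A
  fmem : ∀ i, f i ∈ maximalIdeal A
  freg : RingTheory.Sequence.IsRegular A (List.ofFn f)
  kerπ : RingHom.ker π = Ideal.span (Set.range f)
  [instModA : Module A (B' ⊗[B] M)]
  compat : ∀ (a : A) (x : B' ⊗[B] M), a • x = π a • x
  finres : ∃ βA : ℕ → ℕ, IsFreeResolutionBetti A (B' ⊗[B] M) βA ∧ ∃ n, ∀ i, n < i → βA i = 0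

open CategoryTheory in
/-- `M` has projective dimension at most `n` over `R`. -/
abbrev ProjDimLE (R : Type) [CommRing R] (M : Type) [AddCommGroup M] [Module R M] (n : ℕ) : Prop :=
  HasProjectiveDimensionLE (ModuleCat.of R M) n

section ProjDim

open CategoryTheory

variable {R : Type} [CommRing R]

lemma projDimLE_zero_iff {M : Type} [AddCommGroup M] [Module R M] :
    ProjDimLE R M 0 ↔ Module.Projective R M := by
  rw [IsProjective.iff_projective]
  exact (projective_iff_hasProjectiveDimensionLE_zero _).symm

lemma ProjDimLE.mono {M : Type} [AddCommGroup M] [Module R M] {m n : ℕ} (h : ProjDimLE R M m)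
    (hmn : m ≤ n) : ProjDimLE R M n :=
  hasProjectiveDimensionLT_of_ge _ (m + 1) (n + 1) (by omega)

lemma ProjDimLE.of_linearEquiv {M N : Type} [AddCommGroup M] [Module R M] [AddCommGroup N]
    [Module R N] {n : ℕ} (h : ProjDimLE R M n) (e : M ≃ₗ[R] N) : ProjDimLE R N n :=
  ModuleCat.hasProjectiveDimensionLE_of_linearEquiv (M := ModuleCat.of R M)
    (N := ModuleCat.of R N) e n

lemma projDimLE_succ_iff {K P M : Type} [AddCommGroup M] [Module R M] [AddCommGroup P] [Module R P]
    [AddCommGroup K] [Module R K] [Module.Projective R P] (i : K →ₗ[R] P) (p : P →ₗ[R] M)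
    (hi : Function.Injective i) (hp : Function.Surjective p) (h : Function.Exact i p) (n : ℕ) :
    ProjDimLE R M (n + 1) ↔ ProjDimLE R K n := by
  have hS : (ShortComplex.mk (ModuleCat.ofHom i) (ModuleCat.ofHom p)
      (by ext x; exact h.apply_apply_eq_zero x)).ShortExact :=
    { exact := (ShortComplex.ShortExact.moduleCat_exact_iff_function_exact _).mpr h
      mono_f := (ModuleCat.mono_iff_injective _).mpr hi
      epi_g := (ModuleCat.epi_iff_surjective _).mpr hp }
  exact hS.hasProjectiveDimensionLT_X₃_iff n
    ((IsProjective.iff_projective (R := R) P).mp inferInstance)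

end ProjDim

lemma exists_minimal_cover (R : Type) [CommRing R] [IsLocalRing R] (M : Type) [AddCommGroup M]
    [Module R M] [Module.Finite R M] :
    ∃ (r : ℕ) (φ : (Fin r → R) →ₗ[R] M), Function.Surjective φ ∧
      ∀ v, φ v = 0 → ∀ i, v i ∈ maximalIdeal R := by
  let b := Module.finBasis (ResidueField R) (ResidueField R ⊗[R] M)
  have hs : ∀ i, ∃ m : M, (1 : ResidueField R) ⊗ₜ[R] m = b i := fun i => by
    have : Function.Surjective (TensorProduct.mk R (ResidueField R) M 1) :=
      TensorProduct.mk_surjective _ _ _ residue_surjective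
    exact this (b i)
  choose m hm using hs
  refine ⟨_, Fintype.linearCombination R m, ?_, ?_⟩
  · rw [← LinearMap.range_eq_top, Fintype.range_linearCombination]
    exact span_eq_top_of_tmul_eq_basis m b hm
  · intro v hv i
    rw [← residue_eq_zero_iff]
    have h2 : ∑ i, residue R (v i) • b i = 0 := by
      have := congrArg (TensorProduct.mk R (ResidueField R) M 1) hv
      rw [Fintype.linearCombination_apply, map_sum, map_zero] at this
      rw [← this]
      refine Finset.sum_congr rfl fun j _ => ?_
      rw [← hm j, map_smul]
      simp only [TensorProduct.mk_apply]
      exact (algebraMap_smul (ResidueField R) (v j) _)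
    exact Fintype.linearIndependent_iff.mp b.linearIndependent _ h2 i

lemma free_of_projDimLE_of_socle (R : Type) [CommRing R] [IsLocalRing R] [IsNoetherianRing R]
    (s : R) (hs0 : s ≠ 0) (hs : ∀ r ∈ maximalIdeal R, s * r = 0) (n : ℕ) :
    ∀ (M : Type) [AddCommGroup M] [Module R M] [Module.Finite R M], ProjDimLE R M n →
      Module.Free R M := by
  induction n with
  | zero =>
    intro M _ _ _ h
    have := projDimLE_zero_iff.mp h
    exact Module.free_of_flat_of_isLocalRing
  | succ n ih =>
    intro M _ _ _ h
    obtain ⟨r, φ, hφ, hmin⟩ := exists_minimal_cover R M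
    have hK : ProjDimLE R (LinearMap.ker φ) n :=
      (projDimLE_succ_iff (LinearMap.ker φ).subtype φ (Submodule.subtype_injective _) hφ
        (LinearMap.exact_subtype_ker_map φ) n).mp h
    have := ih _ hK
    have hbot : LinearMap.ker φ = ⊥ := by
      rw [← Submodule.subsingleton_iff_eq_bot]
      by_contra hne
      rw [not_subsingleton_iff_nontrivial] at hne
      let b := Module.Free.chooseBasis R (LinearMap.ker φ)
      obtain ⟨i⟩ := b.index_nonempty
      have h0 : s • b i = 0 := by
        ext j
        exact hs _ (hmin _ (b i).2 j)
      have h1 := congrArg (fun x => b.repr x i) h0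
      simp at h1
      exact hs0 h1
    exact Module.Free.of_equiv (LinearEquiv.ofBijective φ ⟨LinearMap.ker_eq_bot.mp hbot, hφ⟩)

lemma projDimLE_quotSMulTop_iff (R : Type) [CommRing R] [IsLocalRing R] [IsNoetherianRing R]
    (y : R) (hy : IsSMulRegular R y) (hym : y ∈ maximalIdeal R) (n : ℕ) :
    ∀ (K : Type) [AddCommGroup K] [Module R K] [Module.Finite R K], IsSMulRegular K y →
      (ProjDimLE R K n ↔ ProjDimLE (R ⧸ Ideal.span {y}) (QuotSMulTop y K) n) := by
  have hnt : Nontrivial (R ⧸ Ideal.span {y}) :=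
    Ideal.Quotient.nontrivial_iff.mpr (fun h => (maximalIdeal.isMaximal R).ne_top
      (top_le_iff.mp (h ▸ (Ideal.span_singleton_le_iff_mem _).mpr hym)))
  have hloc : IsLocalRing (R ⧸ Ideal.span {y}) :=
    IsLocalRing.of_surjective' (Ideal.Quotient.mk _) Ideal.Quotient.mk_surjective
  induction n with
  | zero =>
    intro K _ _ _ hK
    have hfin : Module.Finite (R ⧸ Ideal.span {y}) (QuotSMulTop y K) :=
      Module.Finite.of_restrictScalars_finite R _ _
    have : Module.FinitePresentation R K := Module.finitePresentation_of_finite R K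
    have := Module.free_quotSMulTop_iff_free (R := R) (M := K) (x := y)
      (by rw [jacobson_eq_maximalIdeal ⊥ bot_ne_top]; exact hym) hK
    rw [projDimLE_zero_iff, projDimLE_zero_iff]
    constructor
    · intro h
      have h1 : Module.Free R K := Module.free_of_flat_of_isLocalRing
      have := this.mpr h1
      infer_instance
    · intro h
      have h1 : Module.Free (R ⧸ Ideal.span {y}) (QuotSMulTop y K) :=
        Module.free_of_flat_of_isLocalRing
      have := this.mp h1
      infer_instance
  | succ n ih =>
    intro K _ _ _ hK
    obtain ⟨r, φ, hφ, hmin⟩ := exists_minimal_cover R K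
    have hreg : IsSMulRegular (Fin r → R) y := fun a b h => by
      ext i; exact hy (congrFun h i)
    have hreg' : IsSMulRegular (LinearMap.ker φ) y := hreg.submodule _ _
    have hex := LinearMap.exact_subtype_ker_map φ
    rw [projDimLE_succ_iff (LinearMap.ker φ).subtype φ (Submodule.subtype_injective _) hφ hex n,
      ih _ hreg']
    have e1 := QuotSMulTop.map_first_exact_on_four_term_exact_of_isSMulRegular_last
      (r := y) (f₁ := (0 : PUnit →ₗ[R] LinearMap.ker φ)) (f₂ := (LinearMap.ker φ).subtype) (f₃ := φ)
      (by rw [LinearMap.exact_zero_iff_injective]; exact Submodule.subtype_injective _) hex hK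
    have e2 := QuotSMulTop.map_exact y hex hφ
    have e3 := QuotSMulTop.map_surjective y hφ
    symm
    let i' : QuotSMulTop y (LinearMap.ker φ) →ₗ[R ⧸ Ideal.span {y}] QuotSMulTop y (Fin r → R) :=
      (QuotSMulTop.map y (LinearMap.ker φ).subtype).extendScalarsOfSurjective
        (Ideal.Quotient.mk_surjective)
    let p' : QuotSMulTop y (Fin r → R) →ₗ[R ⧸ Ideal.span {y}] QuotSMulTop y K :=
      (QuotSMulTop.map y φ).extendScalarsOfSurjective
        (Ideal.Quotient.mk_surjective)
    refine projDimLE_succ_iff i' p' ?_ e3 e2 n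
    have : Function.Injective (QuotSMulTop.map y (LinearMap.ker φ).subtype) := by
      rw [map_zero] at e1
      exact (LinearMap.exact_zero_iff_injective _ _).mp e1
    exact this

lemma WithBot.le_natCast_of_add_le {a : WithBot ℕ∞} {n k : ℕ} (h : a + k ≤ (n + k : ℕ)) :
    a ≤ n := by
  induction a with
  | bot => exact bot_le
  | coe x =>
    have h' : x + (k : ℕ∞) ≤ ((n + k : ℕ) : ℕ∞) := by exact_mod_cast h
    push_cast at h'
    have := (ENat.add_le_add_iff_right (ENat.natCast_ne_top k)).mp h'
    exact_mod_cast this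

lemma exists_isSMulRegular_or_socle (R : Type) [CommRing R] [IsLocalRing R] [IsNoetherianRing R] :
    (∃ y ∈ maximalIdeal R, IsSMulRegular R y) ∨
      ∃ s : R, s ≠ 0 ∧ ∀ r ∈ maximalIdeal R, s * r = 0 := by
  by_cases hsub : Subsingleton (ResidueField R →ₗ[R] R)
  · obtain ⟨y, hy, hreg⟩ := IsSMulRegular.subsingleton_linearMap_iff.mp hsub
    refine Or.inl ⟨y, ?_, hreg⟩
    rw [← Ideal.annihilator_quotient (I := maximalIdeal R)]
    exact hy
  · obtain ⟨g, hg⟩ : ∃ g : ResidueField R →ₗ[R] R, g ≠ 0 := by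
      by_contra! h
      exact hsub ⟨fun a b => (h a).trans (h b).symm⟩
    refine Or.inr ⟨g 1, fun h => hg ?_, fun r hr => ?_⟩
    · ext x
      obtain ⟨r, rfl⟩ := residue_surjective x
      have : residue R r = r • (1 : ResidueField R) := by simp [Algebra.smul_def]
      rw [this, map_smul, h]; simp
    · have : r • (1 : ResidueField R) = 0 := by
        rw [Algebra.smul_def]; simpa using hr
      rw [mul_comm, ← smul_eq_mul, ← map_smul, this, map_zero]

/-- Over a Noetherian local ring finite projective dimensions are at most the Krull dimension. -/
lemma projDimLE_of_ringKrullDim_le (n : ℕ) :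
    ∀ (R : Type) [CommRing R] [IsLocalRing R] [IsNoetherianRing R], ringKrullDim R ≤ n →
    ∀ (M : Type) [AddCommGroup M] [Module R M] [Module.Finite R M] (m : ℕ), ProjDimLE R M m →
      ProjDimLE R M n := by
  induction n with
  | zero =>
    intro R _ _ _ hd M _ _ _ m hM
    obtain ⟨y, hym, hreg⟩ | ⟨s, hs0, hs⟩ := exists_isSMulRegular_or_socle R
    · have h1 := ringKrullDim_quotient_span_singleton_succ_eq_ringKrullDim hreg hym
      exfalso
      have hnt : Nontrivial (R ⧸ Ideal.span {y}) :=
        Ideal.Quotient.nontrivial_iff.mpr (fun h => (maximalIdeal.isMaximal R).ne_top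
          (top_le_iff.mp (h ▸ (Ideal.span_singleton_le_iff_mem _).mpr hym)))
      have h2 := ringKrullDim_nonneg_of_nontrivial (R := R ⧸ Ideal.span {y})
      rw [← h1] at hd
      have : (0 : WithBot ℕ∞) + 1 ≤ ringKrullDim (R ⧸ Ideal.span {y}) + 1 := by gcongr
      have := this.trans hd
      norm_num at this
    · have := free_of_projDimLE_of_socle R s hs0 hs m M hM
      exact projDimLE_zero_iff.mpr inferInstance
  | succ n ih =>
    intro R _ _ _ hd M _ _ _ m hM
    obtain ⟨y, hym, hreg⟩ | ⟨s, hs0, hs⟩ := exists_isSMulRegular_or_socle R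
    · have h1 := ringKrullDim_quotient_span_singleton_succ_eq_ringKrullDim hreg hym
      have hnt : Nontrivial (R ⧸ Ideal.span {y}) :=
        Ideal.Quotient.nontrivial_iff.mpr (fun h => (maximalIdeal.isMaximal R).ne_top
          (top_le_iff.mp (h ▸ (Ideal.span_singleton_le_iff_mem _).mpr hym)))
      have hloc : IsLocalRing (R ⧸ Ideal.span {y}) :=
        IsLocalRing.of_surjective' (Ideal.Quotient.mk _) Ideal.Quotient.mk_surjective
      have hd' : ringKrullDim (R ⧸ Ideal.span {y}) ≤ n := by
        rw [← h1] at hd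
        exact WithBot.le_natCast_of_add_le (k := 1) (by exact_mod_cast hd)
      obtain ⟨r, φ, hφ, hmin⟩ := exists_minimal_cover R M
      have hregr : IsSMulRegular (Fin r → R) y := fun a b h => by
        ext i; exact hreg (congrFun h i)
      have hreg' : IsSMulRegular (LinearMap.ker φ) y := hregr.submodule _ _
      have hex := LinearMap.exact_subtype_ker_map φ
      rw [projDimLE_succ_iff (LinearMap.ker φ).subtype φ (Submodule.subtype_injective _) hφ hex n]
      have hm1 : ProjDimLE R (LinearMap.ker φ) m := by
        rw [← projDimLE_succ_iff (LinearMap.ker φ).subtype φ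
          (Submodule.subtype_injective _) hφ hex m]
        exact hM.mono (by omega)
      rw [projDimLE_quotSMulTop_iff R y hreg hym _ _ hreg'] at hm1 ⊢
      have hfin : Module.Finite (R ⧸ Ideal.span {y}) (QuotSMulTop y (LinearMap.ker φ)) :=
        Module.Finite.of_restrictScalars_finite R _ _
      exact ih _ hd' _ m hm1
    · have := free_of_projDimLE_of_socle R s hs0 hs m M hM
      exact (projDimLE_zero_iff.mpr inferInstance : ProjDimLE R M 0).mono (by omega)

/-- A module of finite projective dimension over `A` and depth at least `dim B` over the quotient
`B` of `A` by `c` elements has projective dimension at most `c`. -/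
lemma projDimLE_of_regular_sequence {A B M : Type} [CommRing A] [IsLocalRing A]
    [IsNoetherianRing A] [CommRing B] [IsLocalRing B] [Algebra A B] [AddCommGroup M]
    [Module A M] [Module B M] [IsScalarTower A B M] [Module.Finite B M]
    (hsurj : Function.Surjective (algebraMap A B)) {c : ℕ} (f : Fin c → A)
    (hf : ∀ i, f i ∈ maximalIdeal A)
    (hker : RingHom.ker (algebraMap A B) = Ideal.span (Set.range f)) (rs : List B)
    (hrs : ∀ x ∈ rs, x ∈ maximalIdeal B) (hreg : RingTheory.Sequence.IsRegular M rs)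
    (hdim : ringKrullDim B ≤ rs.length) {m : ℕ} (hM : ProjDimLE A M m) : ProjDimLE A M c := by
  have hfin : Module.Finite A M := by
    have : Module.Finite A B := Module.Finite.of_surjective (Algebra.linearMap A B) hsurj
    exact Module.Finite.trans B M
  have hdimA : ringKrullDim A ≤ (rs.length + c : ℕ) := by
    classical
    have h1 := ringKrullDim_le_ringKrullDim_quotient_add_card (R := A) (Finset.univ.image f)
      (by intro x hx; rw [ringJacobson_eq_maximalIdeal]; simp at hx; obtain ⟨i, rfl⟩ := hx; exact hf i)
    have h2 : ringKrullDim (A ⧸ Ideal.span ((Finset.univ.image f : Finset A) : Set A))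
        = ringKrullDim B := by
      refine ringKrullDim_eq_of_ringEquiv ((Ideal.quotEquivOfEq ?_).trans
        (RingHom.quotientKerEquivOfSurjective hsurj))
      rw [hker]; simp
    rw [h2] at h1
    refine h1.trans ?_
    push_cast
    gcongr
    exact_mod_cast (Finset.card_image_le.trans (by simp))
  choose g hg using hsurj
  let rs' := rs.map g
  have hmap : rs'.map (algebraMap A B) = rs := by
    simp only [rs', List.map_map]
    exact List.map_id'' hg rs
  have hreg' : RingTheory.Sequence.IsWeaklyRegular M rs' := by
    rw [← RingTheory.Sequence.isWeaklyRegular_map_algebraMap_iff B, hmap]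
    exact hreg.toIsWeaklyRegular
  have hloc : IsLocalHom (algebraMap A B) :=
    IsLocalHom.of_surjective _ (fun b => ⟨g b, hg b⟩)
  have hmem : ∀ r ∈ rs', r ∈ maximalIdeal A := by
    intro r hr
    obtain ⟨x, hx, rfl⟩ := List.mem_map.mp hr
    have := hrs x hx
    rw [mem_maximalIdeal, mem_nonunits_iff] at this ⊢
    intro hu
    exact this (hg x ▸ hu.map (algebraMap A B))
  have hnt : Nontrivial M := hreg.nontrivial
  have h := ModuleCat.projectiveDimension_quotient_eq_add_length_of_isWeaklyRegular
    (ModuleCat.of A M) rs' hreg' hmem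
  have hlen : rs'.length = rs.length := by simp [rs']
  let N := M ⧸ Ideal.ofList rs' • (⊤ : Submodule A M)
  have hN : ProjDimLE A N (m + rs.length) := by
    rw [ProjDimLE, ← CategoryTheory.projectiveDimension_le_iff]
    rw [h, hlen]
    push_cast
    gcongr
    exact (CategoryTheory.projectiveDimension_le_iff _ _).mpr hM
  have hN' := projDimLE_of_ringKrullDim_le _ A hdimA N _ hN
  rw [ProjDimLE, ← CategoryTheory.projectiveDimension_le_iff] at hN' ⊢
  rw [h, hlen] at hN'
  rw [add_comm rs.length c] at hN'
  exact WithBot.le_natCast_of_add_le hN'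

/-- A finite graded free resolution `⋯ → A^ι → M` of the `A`-module `M`, written as one matrix `d`
on the free module with basis `ι`, the basis element `b` having homological degree `deg b`;
`e b` is the image of `b` in `M`. -/
structure IsGradedRes {A M ι : Type} [CommRing A] [AddCommGroup M] [Module A M] [Fintype ι]
    (deg : ι → ℕ) (d : Matrix ι ι A) (e : ι → M) : Prop where
  deg_eq : ∀ a b, d a b ≠ 0 → deg b = deg a + 1
  sq : d * d = 0
  surj : ∀ m, ∃ v, Fintype.linearCombination A e v = m
  aug_eq_zero : ∀ b, deg b ≠ 0 → e b = 0
  aug_d : ∀ v, Fintype.linearCombination A e (d.mulVec v) = 0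
  exact : ∀ v, d.mulVec v = 0 → Fintype.linearCombination A e v = 0 → ∃ u, d.mulVec u = v

lemma exists_isGradedRes (A : Type) [CommRing A] [IsLocalRing A] [IsNoetherianRing A] (n : ℕ) :
    ∀ (M : Type) [AddCommGroup M] [Module A M] [Module.Finite A M], ProjDimLE A M n →
    ∃ (ι : Type) (_ : Fintype ι) (deg : ι → ℕ) (d : Matrix ι ι A) (e : ι → M),
      (∀ b, deg b ≤ n) ∧ IsGradedRes deg d e := by
  induction n with
  | zero =>
    intro M _ _ _ h
    have := projDimLE_zero_iff.mp h
    have : Module.Free A M := Module.free_of_flat_of_isLocalRing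
    let b := Module.finBasis A M
    have hb : ∀ v, Fintype.linearCombination A b v = b.equivFun.symm v := fun v => by
      simp [Fintype.linearCombination_apply, Module.Basis.equivFun_symm_apply]
    refine ⟨Fin (Module.finrank A M), inferInstance, fun _ => 0, 0, b, fun _ => le_rfl, ?_, ?_, ?_,
      ?_, ?_, ?_⟩
    · simp
    · simp
    · intro m
      exact ⟨b.equivFun m, by rw [hb]; simp⟩
    · simp
    · simp
    · intro v _ hv
      rw [hb] at hv
      exact ⟨0, by rw [(LinearEquiv.map_eq_zero_iff _).mp hv]; simp⟩
  | succ n ih =>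
    intro M _ _ _ h
    obtain ⟨r, φ, hφ, hmin⟩ := exists_minimal_cover A M
    have hK : ProjDimLE A (LinearMap.ker φ) n :=
      (projDimLE_succ_iff (LinearMap.ker φ).subtype φ (Submodule.subtype_injective _) hφ
        (LinearMap.exact_subtype_ker_map φ) n).mp h
    obtain ⟨ι, hι, deg, d, e, hdeg, hres⟩ := ih _ hK
    let g : Matrix (Fin r) ι A := fun i b => if deg b = 0 then (e b : Fin r → A) i else 0
    have hg : ∀ v, g.mulVec v = (Fintype.linearCombination A e v : Fin r → A) := by
      intro v
      ext i
      simp only [Matrix.mulVec, dotProduct, g, Fintype.linearCombination_apply]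
      rw [Submodule.coe_sum, Finset.sum_apply]
      refine Finset.sum_congr rfl fun b _ => ?_
      by_cases hb : deg b = 0
      · simp [hb, mul_comm]
      · simp [hb, hres.aug_eq_zero b hb]
    have hgd : g * d = 0 := by
      classical
      ext i b
      have := congrFun (hg (d.mulVec (Pi.single b 1))) i
      rw [hres.aug_d, Matrix.mulVec_mulVec] at this
      simpa using this
    have hlc : ∀ v : Fin r ⊕ ι → A, Fintype.linearCombination A
        (Sum.elim (fun i => φ (Pi.single i 1)) (fun _ => (0 : M))) v
        = φ (fun i => v (Sum.inl i)) := by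
      intro v
      simp only [Fintype.linearCombination_apply, Fintype.sum_sum_type, Sum.elim_inl, Sum.elim_inr,
        smul_zero, Finset.sum_const_zero, add_zero]
      rw [LinearMap.pi_apply_eq_sum_univ φ]
      refine Finset.sum_congr rfl fun i _ => ?_
      congr 2
      ext j
      simp [Pi.single_apply, eq_comm]
    have hmv : ∀ v : Fin r ⊕ ι → A, (Matrix.fromBlocks 0 g 0 d).mulVec v
        = Sum.elim (g.mulVec (v ∘ Sum.inr)) (d.mulVec (v ∘ Sum.inr)) := by
      intro v
      rw [Matrix.fromBlocks_mulVec]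
      simp
    refine ⟨Fin r ⊕ ι, inferInstance, Sum.elim (fun _ => 0) (fun b => deg b + 1),
      Matrix.fromBlocks 0 g 0 d, Sum.elim (fun i => φ (Pi.single i 1)) (fun _ => 0),
      ?_, ?_, ?_, ?_, ?_, ?_, ?_⟩
    · rintro (i | b)
      · simp
      · simpa using hdeg b
    · rintro (a | a) (b | b) hab
      · simp at hab
      · by_contra hb
        exact hab (if_neg (by simpa using hb))
      · simp at hab
      · simpa using hres.deg_eq a b (by simpa using hab)
    · rw [Matrix.fromBlocks_multiply]
      simp [hgd, hres.sq]
    · intro m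
      obtain ⟨v, rfl⟩ := hφ m
      exact ⟨Sum.elim v 0, by rw [hlc]; rfl⟩
    · rintro (i | b) hb
      · simp at hb
      · rfl
    · intro v
      rw [hmv, hlc]
      simp only [Sum.elim_inl]
      rw [hg]
      exact (Fintype.linearCombination A e (v ∘ Sum.inr)).2
    · intro v hv hv'
      rw [hlc] at hv'
      rw [hmv] at hv
      obtain ⟨w, hw⟩ := hres.surj ⟨_, hv'⟩
      have h1 : Fintype.linearCombination A e (v ∘ Sum.inr) = 0 := by
        apply Subtype.ext
        rw [← hg]
        ext i
        exact congrFun hv (Sum.inl i)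
      have h2 : d.mulVec (v ∘ Sum.inr) = 0 := by
        ext i
        exact congrFun hv (Sum.inr i)
      obtain ⟨u, hu⟩ := hres.exact _ h2 h1
      let w0 : ι → A := fun b => if deg b = 0 then w b else 0
      have hdw0 : d.mulVec w0 = 0 := by
        ext a
        simp only [Matrix.mulVec, dotProduct, Pi.zero_apply]
        refine Finset.sum_eq_zero fun b _ => ?_
        by_cases hab : d a b = 0
        · simp [hab]
        · have := hres.deg_eq a b hab
          simp [w0, this]
      have hgw0 : g.mulVec w0 = g.mulVec w := by
        ext i
        simp only [Matrix.mulVec, dotProduct]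
        refine Finset.sum_congr rfl fun b _ => ?_
        by_cases hb : deg b = 0 <;> simp [g, w0, hb]
      let u1 : ι → A := fun b => if deg b = 0 then 0 else u b
      have hdu1 : d.mulVec u1 = v ∘ Sum.inr := by
        rw [← hu]
        ext a
        simp only [Matrix.mulVec, dotProduct]
        refine Finset.sum_congr rfl fun b _ => ?_
        by_cases hab : d a b = 0
        · simp [hab]
        · have := hres.deg_eq a b hab
          simp [u1, this]
      have hgu1 : g.mulVec u1 = 0 := by
        ext i
        simp only [Matrix.mulVec, dotProduct, Pi.zero_apply]
        refine Finset.sum_eq_zero fun b _ => ?_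
        by_cases hb : deg b = 0 <;> simp [g, u1, hb]
      refine ⟨Sum.elim 0 (w0 + u1), ?_⟩
      rw [hmv]
      have : (Sum.elim 0 (w0 + u1) : Fin r ⊕ ι → A) ∘ Sum.inr = w0 + u1 := rfl
      rw [this, Matrix.mulVec_add, Matrix.mulVec_add, hgu1, hdu1, hgw0, hdw0, hg, hw]
      ext (i | b) <;> simp

section Homotopy

variable {A M ι : Type} [CommRing A] [AddCommGroup M] [Module A M] [Fintype ι]
  {deg : ι → ℕ} {d : Matrix ι ι A} {e : ι → M}

lemma IsGradedRes.exists_homogeneous (h : IsGradedRes deg d e) {n : ℕ} {v : ι → A}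
    (hv : ∀ a, v a ≠ 0 → deg a = n) (hd : d.mulVec v = 0)
    (he : Fintype.linearCombination A e v = 0) :
    ∃ u : ι → A, (∀ a, u a ≠ 0 → deg a = n + 1) ∧ d.mulVec u = v := by
  classical
  obtain ⟨u, hu⟩ := h.exact v hd he
  refine ⟨fun a => if deg a = n + 1 then u a else 0, fun a ha => (ite_ne_right_iff.mp ha).1, ?_⟩
  ext a
  by_cases ha : deg a = n
  · rw [← hu]
    simp only [Matrix.mulVec, dotProduct]
    refine Finset.sum_congr rfl fun b _ => ?_
    by_cases hab : d a b = 0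
    · simp [hab]
    · simp [h.deg_eq a b hab, ha]
  · have : v a = 0 := by by_contra h0; exact ha (hv a h0)
    rw [this]
    simp only [Matrix.mulVec, dotProduct]
    refine Finset.sum_eq_zero fun b _ => ?_
    by_cases hab : d a b = 0
    · simp [hab]
    · simp [h.deg_eq a b hab, ha]

lemma IsGradedRes.aug_eq_zero_of_pos (h : IsGradedRes deg d e) {v : ι → A}
    (hv : ∀ a, v a ≠ 0 → deg a ≠ 0) : Fintype.linearCombination A e v = 0 := by
  rw [Fintype.linearCombination_apply]
  refine Finset.sum_eq_zero fun b _ => ?_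
  by_cases hb : v b = 0
  · simp [hb]
  · rw [h.aug_eq_zero b (hv b hb), smul_zero]

/-- A chain endomorphism of degree `2 s` of a graded resolution that vanishes on the resolved
module is null-homotopic. -/
lemma IsGradedRes.exists_homotopy (h : IsGradedRes deg d e) (s : ℕ) (R : Matrix ι ι A)
    (hR : ∀ a b, R a b ≠ 0 → deg a = deg b + 2 * s) (hcomm : d * R = R * d)
    (haug : ∀ v, Fintype.linearCombination A e (R.mulVec v) = 0) :
    ∃ T : Matrix ι ι A, (∀ a b, T a b ≠ 0 → deg a = deg b + 2 * s + 1) ∧ d * T + T * d = R := by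
  classical
  have key : ∀ n : ℕ, ∃ T : Matrix ι ι A, (∀ a b, T a b ≠ 0 → deg a = deg b + 2 * s + 1) ∧
      ∀ b, deg b < n → ∀ a, (d * T + T * d) a b = R a b := by
    intro n
    induction n with
    | zero => exact ⟨0, by simp, by simp⟩
    | succ n ih =>
      obtain ⟨T, hT, hTR⟩ := ih
      have hcol : ∀ b, deg b = n → ∃ u : ι → A, (∀ a, u a ≠ 0 → deg a = n + 2 * s + 1) ∧
          d.mulVec u = fun a => (R - T * d) a b := by
        intro b hb
        have hTd : ∀ a, (T * d) a b ≠ 0 → deg a = n + 2 * s := by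
          intro a ha
          obtain ⟨x, -, hx⟩ := Finset.exists_ne_zero_of_sum_ne_zero ha
          have h1 := hT a x (left_ne_zero_of_mul hx)
          have h2 := h.deg_eq x b (right_ne_zero_of_mul hx)
          omega
        apply h.exists_homogeneous
        · intro a ha
          by_cases h1 : R a b = 0
          · apply hTd
            intro h2
            apply ha
            simp [h1, h2]
          · rw [← hb]; exact hR a b h1
        · ext a
          have h1 : d.mulVec (fun a => (R - T * d) a b) a = (d * (R - T * d)) a b := rfl
          rw [h1, mul_sub, hcomm, ← mul_assoc]
          have h2 : (d * T * d) a b = ((R - T * d) * d) a b := by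
            rw [Matrix.mul_apply, Matrix.mul_apply]
            refine Finset.sum_congr rfl fun x _ => ?_
            by_cases hx : d x b = 0
            · simp [hx]
            · have h3 := h.deg_eq x b hx
              have h4 := hTR x (by omega) a
              rw [Matrix.add_apply] at h4
              rw [Matrix.sub_apply, ← h4]
              ring
          rw [Matrix.sub_apply, h2, sub_mul, mul_assoc, h.sq]
          simp
        · have h1 : (fun a => (R - T * d) a b) = R.mulVec (Pi.single b 1) -
              T.mulVec (d.mulVec (Pi.single b 1)) := by
            rw [Matrix.mulVec_mulVec]
            ext a
            simp
          rw [h1, map_sub, haug, zero_sub, neg_eq_zero]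
          apply h.aug_eq_zero_of_pos
          intro a ha
          obtain ⟨x, -, hx⟩ := Finset.exists_ne_zero_of_sum_ne_zero ha
          have := hT a x (left_ne_zero_of_mul hx)
          omega
      choose! u hu hu' using hcol
      let T' : Matrix ι ι A := fun a b => if deg b = n then u b a else T a b
      refine ⟨T', ?_, ?_⟩
      · intro a b hab
        by_cases hb : deg b = n
        · simp only [T', hb, if_true] at hab
          rw [hu b hb a hab, hb]
        · simp only [T', hb, if_false] at hab
          exact hT a b hab
      · intro b hb a
        have h1 : (T' * d) a b
            = (T * d) a b := by
          rw [Matrix.mul_apply, Matrix.mul_apply]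
          refine Finset.sum_congr rfl fun x _ => ?_
          by_cases hx : d x b = 0
          · simp [hx]
          · have h3 := h.deg_eq x b hx
            simp only [T', if_neg (show ¬ deg x = n by omega)]
        rw [Matrix.add_apply, h1]
        by_cases hbn : deg b = n
        · have h2 : (d * T') a b
              = d.mulVec (u b) a := by
            rw [Matrix.mul_apply]
            simp only [T', hbn, if_true, Matrix.mulVec, dotProduct]
          rw [h2, hu' b hbn]
          simp
        · have h2 : (d * T') a b
              = (d * T) a b := by
            rw [Matrix.mul_apply, Matrix.mul_apply]
            simp only [T', hbn, if_false]
          rw [h2, ← Matrix.add_apply]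
          exact hTR b (by omega) a
  obtain ⟨N, hN⟩ : ∃ N, ∀ b, deg b < N :=
    ⟨(∑ b, deg b) + 1, fun b => Nat.lt_succ_of_le
      (Finset.single_le_sum (fun _ _ => Nat.zero_le _) (Finset.mem_univ b))⟩
  obtain ⟨T, hT, hTR⟩ := key N
  exact ⟨T, hT, by ext a b; exact hTR b (hN b) a⟩

end Homotopy

/-- The polynomial `∑ f_j x_j`. -/
noncomputable def curvature {A : Type} [CommRing A] {c : ℕ} (f : Fin c → A) :
    MvPolynomial (Fin c) A :=
  ∑ j, MvPolynomial.C (f j) * MvPolynomial.X j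

/-- A graded free resolution of `M` together with a system of higher homotopies for `f`, encoded as
a polynomial matrix `D` that squares to `∑ f_j x_j` and has constant term the differential. -/
structure IsCurvedRes {A M ι : Type} [CommRing A] [AddCommGroup M] [Module A M] [Fintype ι]
    [DecidableEq ι] {c : ℕ} (f : Fin c → A) (deg : ι → ℕ)
    (D : Matrix ι ι (MvPolynomial (Fin c) A)) (e : ι → M) : Prop where
  supp : ∀ a b m, (D a b).coeff m ≠ 0 → deg a + 1 = deg b + 2 * m.degree
  sq : D * D = curvature f • (1 : Matrix ι ι (MvPolynomial (Fin c) A))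
  res : IsGradedRes deg (D.map (MvPolynomial.coeff 0)) e

section Curved

open MvPolynomial

variable {A M ι : Type} [CommRing A] [AddCommGroup M] [Module A M] [Fintype ι]
  {c : ℕ} {f : Fin c → A} {deg : ι → ℕ} {e : ι → M}

lemma coeffMat_mul (E F : Matrix ι ι (MvPolynomial (Fin c) A)) (m : Fin c →₀ ℕ) :
    (E * F).map (coeff m) =
      ∑ p ∈ Finset.HasAntidiagonal.antidiagonal m, E.map (coeff p.1) * F.map (coeff p.2) := by
  ext a b
  simp only [Matrix.map_apply, Matrix.mul_apply, coeff_sum, coeff_mul, Matrix.sum_apply]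
  rw [Finset.sum_comm]

lemma coeff_curvature_smul (h : ∀ j (x : M), f j • x = 0) (m : Fin c →₀ ℕ) (x : M) :
    coeff m (curvature f) • x = 0 := by
  rw [curvature, coeff_sum, Finset.sum_smul]
  refine Finset.sum_eq_zero fun j _ => ?_
  rw [coeff_C_mul, mul_comm, mul_smul, h, smul_zero]

lemma degree_of_coeff_curvature_ne_zero {m : Fin c →₀ ℕ} (h : coeff m (curvature f) ≠ 0) :
    m.degree = 1 := by
  classical
  rw [curvature, coeff_sum] at h
  obtain ⟨j, -, hj⟩ := Finset.exists_ne_zero_of_sum_ne_zero h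
  rw [coeff_C_mul, coeff_X] at hj
  have : Finsupp.single j 1 = m := by
    by_contra h0
    simp [h0] at hj
  rw [← this]
  simp

lemma aug_coeffMat_mulVec {D : Matrix ι ι (MvPolynomial (Fin c) A)}
    (hsupp : ∀ a b m, (D a b).coeff m ≠ 0 → deg a + 1 = deg b + 2 * m.degree)
    (h : IsGradedRes deg (D.map (coeff 0)) e) (m : Fin c →₀ ℕ) (v : ι → A) :
    Fintype.linearCombination A e ((D.map (coeff m)).mulVec v) = 0 := by
  by_cases hm : m = 0
  · subst hm; exact h.aug_d v
  · apply h.aug_eq_zero_of_pos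
    intro a ha
    obtain ⟨x, -, hx⟩ := Finset.exists_ne_zero_of_sum_ne_zero ha
    have h1 := hsupp a x m (left_ne_zero_of_mul hx)
    have h2 : m.degree ≠ 0 := by rwa [Ne, Finsupp.degree_eq_zero_iff]
    omega

lemma degree_of_coeff_mul_self_ne_zero {D : Matrix ι ι (MvPolynomial (Fin c) A)}
    (hsupp : ∀ a b m, (D a b).coeff m ≠ 0 → deg a + 1 = deg b + 2 * m.degree) {a b : ι}
    {m : Fin c →₀ ℕ} (h : coeff m ((D * D) a b) ≠ 0) : deg a + 2 = deg b + 2 * m.degree := by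
  rw [Matrix.mul_apply, coeff_sum] at h
  obtain ⟨x, -, hx⟩ := Finset.exists_ne_zero_of_sum_ne_zero h
  rw [coeff_mul] at hx
  obtain ⟨p, hp, hx⟩ := Finset.exists_ne_zero_of_sum_ne_zero hx
  have h1 := hsupp _ _ _ (left_ne_zero_of_mul hx)
  have h2 := hsupp _ _ _ (right_ne_zero_of_mul hx)
  rw [← Finset.HasAntidiagonal.mem_antidiagonal.mp hp, map_add]
  omega

lemma coeff_curvature_smul_one {ι : Type} [DecidableEq ι] (m : Fin c →₀ ℕ) :
    (curvature f • (1 : Matrix ι ι (MvPolynomial (Fin c) A))).map (coeff m) =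
      coeff m (curvature f) • (1 : Matrix ι ι A) := by
  ext a b
  by_cases hab : a = b <;> simp [hab]

lemma exists_curved_step [DecidableEq ι] (hf : ∀ j (x : M), f j • x = 0) {d : Matrix ι ι A}
    (hres : IsGradedRes deg d e) (s : ℕ) :
    ∃ E : Matrix ι ι (MvPolynomial (Fin c) A),
      (∀ a b m, (E a b).coeff m ≠ 0 → deg a + 1 = deg b + 2 * m.degree) ∧
      E.map (coeff 0) = d ∧ ∀ m : Fin c →₀ ℕ, m.degree ≤ s →
        (E * E - curvature f • (1 : Matrix ι ι (MvPolynomial (Fin c) A))).map (coeff m) = 0 := by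
  induction s with
  | zero =>
    refine ⟨d.map C, ?_, ?_, ?_⟩
    · intro a b m hm
      rw [Matrix.map_apply, coeff_C] at hm
      have h0 : 0 = m := by by_contra h; simp [h] at hm
      subst h0
      simp only [if_true] at hm
      rw [hres.deg_eq a b hm]; simp
    · ext a b; simp
    · intro m hm
      have h0 : m = 0 := (Finsupp.degree_eq_zero_iff m).mp (by omega)
      subst h0
      rw [← Matrix.map_mul, hres.sq]
      ext a b
      have : coeff 0 (curvature f) = 0 := by
        by_contra h
        simpa using degree_of_coeff_curvature_ne_zero h
      by_cases hab : a = b <;> simp [this, hab]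
  | succ s ih =>
    obtain ⟨E, hE, hE0, hEs⟩ := ih
    set W := E * E - curvature f • (1 : Matrix ι ι (MvPolynomial (Fin c) A)) with hW
    have hWE : W * E = E * W := by
      rw [hW, sub_mul, mul_sub, mul_assoc]; simp
    have hT : ∀ m : Fin c →₀ ℕ, m.degree = s + 1 → ∃ T : Matrix ι ι A,
        (∀ a b, T a b ≠ 0 → deg a = deg b + 2 * s + 1) ∧ d * T + T * d = - W.map (coeff m) := by
      intro m hm
      apply hres.exists_homotopy
      · intro a b hab
        by_cases h1 : coeff m ((E * E) a b) = 0
        · have h2 : coeff m (curvature f • (1 : Matrix ι ι (MvPolynomial (Fin c) A)) a b) ≠ 0 := by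
            intro h2
            apply hab
            simp only [Matrix.neg_apply, Matrix.map_apply, hW, Matrix.sub_apply, coeff_sub, h1,
              Matrix.smul_apply, h2]
            simp
          by_cases hab' : a = b
          · subst hab'
            rw [Matrix.one_apply_eq, smul_eq_mul, mul_one] at h2
            have := degree_of_coeff_curvature_ne_zero h2
            omega
          · simp [hab'] at h2
        · have := degree_of_coeff_mul_self_ne_zero hE h1
          omega
      · have h1 := congrArg (fun X => X.map (coeff m)) hWE
        simp only [coeffMat_mul] at h1
        rw [Finset.sum_eq_single (m, 0), Finset.sum_eq_single (0, m)] at h1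
        · simp only [hE0] at h1
          rw [mul_neg, neg_mul, h1]
        · rintro ⟨p, q⟩ hp hne
          have hp' := Finset.HasAntidiagonal.mem_antidiagonal.mp hp
          simp only at hp'
          rw [hEs q, mul_zero]
          have h3 : p.degree ≠ 0 := by
            intro h3
            have : p = 0 := (Finsupp.degree_eq_zero_iff p).mp h3
            subst this
            exact hne (by rw [← hp', zero_add])
          have := congrArg Finsupp.degree hp'
          rw [map_add] at this
          omega
        · simp
        · rintro ⟨p, q⟩ hp hne
          have hp' := Finset.HasAntidiagonal.mem_antidiagonal.mp hp
          simp only at hp'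
          rw [hEs p, zero_mul]
          have h3 : q.degree ≠ 0 := by
            intro h3
            have : q = 0 := (Finsupp.degree_eq_zero_iff q).mp h3
            subst this
            exact hne (by rw [← hp', add_zero])
          have := congrArg Finsupp.degree hp'
          rw [map_add] at this
          omega
        · simp
      · intro v
        rw [Matrix.neg_mulVec, map_neg, neg_eq_zero, hW]
        have h1 : (E * E - curvature f • (1 : Matrix ι ι (MvPolynomial (Fin c) A))).map (coeff m)
            = (∑ p ∈ Finset.HasAntidiagonal.antidiagonal m, E.map (coeff p.1) * E.map (coeff p.2))
              - coeff m (curvature f) • 1 := by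
          rw [← coeffMat_mul, ← coeff_curvature_smul_one]
          ext a b
          simp
        rw [h1, Matrix.sub_mulVec, map_sub, Matrix.smul_mulVec, map_smul,
          coeff_curvature_smul hf, sub_zero, Matrix.sum_mulVec, map_sum]
        refine Finset.sum_eq_zero fun p _ => ?_
        rw [← Matrix.mulVec_mulVec]
        exact aug_coeffMat_mulVec hE (hE0 ▸ hres) _ _
    choose! T hTdeg hTeq using hT
    let T' : Matrix ι ι (MvPolynomial (Fin c) A) := Matrix.of fun a b =>
      ∑ m ∈ (Finset.univ : Finset (Fin c)).finsuppAntidiag (s + 1), monomial m (T m a b)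
    have hmem : ∀ m : Fin c →₀ ℕ, m ∈ (Finset.univ : Finset (Fin c)).finsuppAntidiag (s + 1) ↔
        m.degree = s + 1 := by
      intro m
      simp [Finset.mem_finsuppAntidiag, Finsupp.degree_eq_sum]
    have hT' : ∀ m, T'.map (coeff m) = if m.degree = s + 1 then T m else 0 := by
      intro m
      ext a b
      simp only [Matrix.map_apply, T', Matrix.of_apply, coeff_sum, coeff_monomial]
      rw [Finset.sum_ite_eq']
      simp only [hmem]
      split_ifs <;> simp
    have hadd : ∀ m, (E + T').map (coeff m) = E.map (coeff m) + T'.map (coeff m) := fun m => by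
      ext a b; simp
    refine ⟨E + T', ?_, ?_, ?_⟩
    · intro a b m hm
      have h1 : coeff m ((E + T') a b) = coeff m (E a b) + T'.map (coeff m) a b := by simp
      rw [h1, hT'] at hm
      by_cases h2 : coeff m (E a b) = 0
      · rw [h2, zero_add] at hm
        by_cases h3 : m.degree = s + 1
        · rw [if_pos h3] at hm
          have := hTdeg m h3 a b hm
          omega
        · simp [h3] at hm
      · exact hE a b m h2
    · rw [hadd, hT', hE0]; simp
    · intro m hm
      have hexp : ((E + T') * (E + T') -
          curvature f • (1 : Matrix ι ι (MvPolynomial (Fin c) A))).map (coeff m)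
          = W.map (coeff m) + (E * T').map (coeff m) + (T' * E).map (coeff m)
            + (T' * T').map (coeff m) := by
        have : (E + T') * (E + T') - curvature f • (1 : Matrix ι ι (MvPolynomial (Fin c) A))
            = W + E * T' + T' * E + T' * T' := by
          rw [hW]; noncomm_ring
        rw [this]
        ext a b; simp
      have h1 : (E * T').map (coeff m) = if m.degree = s + 1 then d * T m else 0 := by
        rw [coeffMat_mul, Finset.sum_eq_single (0, m)]
        · simp only [hE0, hT']; split_ifs <;> simp
        · rintro ⟨p, q⟩ hp hne
          have hp' := Finset.HasAntidiagonal.mem_antidiagonal.mp hp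
          simp only at hp'
          have h3 : p.degree ≠ 0 := by
            intro h3
            have : p = 0 := (Finsupp.degree_eq_zero_iff p).mp h3
            subst this
            exact hne (by rw [← hp', zero_add])
          have := congrArg Finsupp.degree hp'
          rw [map_add] at this
          simp only [hT']
          rw [if_neg (by omega), mul_zero]
        · simp
      have h2 : (T' * E).map (coeff m) = if m.degree = s + 1 then T m * d else 0 := by
        rw [coeffMat_mul, Finset.sum_eq_single (m, 0)]
        · simp only [hE0, hT']; split_ifs <;> simp
        · rintro ⟨p, q⟩ hp hne
          have hp' := Finset.HasAntidiagonal.mem_antidiagonal.mp hp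
          simp only at hp'
          have h3 : q.degree ≠ 0 := by
            intro h3
            have : q = 0 := (Finsupp.degree_eq_zero_iff q).mp h3
            subst this
            exact hne (by rw [← hp', add_zero])
          have := congrArg Finsupp.degree hp'
          rw [map_add] at this
          simp only [hT']
          rw [if_neg (by omega), zero_mul]
        · simp
      have h3 : (T' * T').map (coeff m) = 0 := by
        rw [coeffMat_mul]
        refine Finset.sum_eq_zero ?_
        rintro ⟨p, q⟩ hp
        have hp' := congrArg Finsupp.degree (Finset.HasAntidiagonal.mem_antidiagonal.mp hp)
        simp only [map_add] at hp'
        simp only [hT']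
        by_cases h4 : p.degree = s + 1
        · rw [if_neg (c := q.degree = s + 1) (by omega), mul_zero]
        · rw [if_neg h4, zero_mul]
      rw [hexp, h1, h2, h3, add_zero]
      by_cases h4 : m.degree = s + 1
      · rw [if_pos h4, if_pos h4, add_assoc, hTeq m h4, add_neg_cancel]
      · rw [if_neg h4, if_neg h4, add_zero, add_zero]
        exact hEs m (by omega)

/-- A finite graded free resolution of a module killed by `f` carries a system of higher
homotopies for `f`. -/
lemma exists_isCurvedRes [DecidableEq ι] (hf : ∀ j (x : M), f j • x = 0) {d : Matrix ι ι A}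
    (hres : IsGradedRes deg d e) :
    ∃ D : Matrix ι ι (MvPolynomial (Fin c) A), IsCurvedRes f deg D e := by
  obtain ⟨E, hE, hE0, hEs⟩ := exists_curved_step hf hres ((∑ b, deg b) + 1)
  refine ⟨E, hE, ?_, hE0 ▸ hres⟩
  have key : ∀ m, (E * E - curvature f • (1 : Matrix ι ι (MvPolynomial (Fin c) A))).map (coeff m)
      = 0 := by
    intro m
    by_cases hm : m.degree ≤ (∑ b, deg b) + 1
    · exact hEs m hm
    · ext a b
      have h0 : coeff m (curvature f) = 0 := by
        by_contra h
        have := degree_of_coeff_curvature_ne_zero h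
        omega
      have h1 : coeff m ((E * E) a b) = 0 := by
        by_contra h
        have := degree_of_coeff_mul_self_ne_zero hE h
        have h2 := Finset.single_le_sum (f := deg) (fun _ _ => Nat.zero_le _) (Finset.mem_univ a)
        omega
      by_cases hab : a = b
      · subst hab; simp [h0, h1]
      · simp [h1, hab]
  rw [← sub_eq_zero]
  ext a b m
  exact congrFun (congrFun (key m) a) b

end Curved

section Shamash

set_option linter.unusedSectionVars false

open MvPolynomial

variable {A M ι : Type} [CommRing A] [AddCommGroup M] [Module A M] [Fintype ι] [DecidableEq ι]
  {c : ℕ}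

/-- The monomial basis vectors of the free module `A[x]^ι`. -/
noncomputable def monVec (A : Type) [CommRing A] {ι : Type} [DecidableEq ι] {c : ℕ} (b : ι)
    (m : Fin c →₀ ℕ) : ι → MvPolynomial (Fin c) A :=
  Pi.single b (monomial m 1)

lemma exists_functional (g : ι → (Fin c →₀ ℕ) → A) :
    ∃ u : (ι → MvPolynomial (Fin c) A) →ₗ[A] A, ∀ b m, u (monVec A b m) = g b m := by
  let B := Pi.basis (fun _ : ι => basisMonomials (Fin c) A)
  refine ⟨B.constr A fun p => g p.1 p.2, fun b m => ?_⟩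
  have : monVec A b m = B ⟨b, m⟩ := by
    rw [Pi.basis_apply, coe_basisMonomials]; rfl
  rw [this, Module.Basis.constr_basis]

lemma functional_mem {I : Ideal A} {u : (ι → MvPolynomial (Fin c) A) →ₗ[A] A}
    (h : ∀ b m, u (monVec A b m) ∈ I) (v : ι → MvPolynomial (Fin c) A) : u v ∈ I := by
  let B := Pi.basis (fun _ : ι => basisMonomials (Fin c) A)
  have hv : v ∈ Submodule.span A (Set.range B) := by rw [B.span_eq]; trivial
  have : Submodule.span A (Set.range B) ≤ Submodule.comap u I := by
    rw [Submodule.span_le]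
    rintro _ ⟨⟨b, m⟩, rfl⟩
    have : monVec A b m = B ⟨b, m⟩ := by
      rw [Pi.basis_apply, coe_basisMonomials]; rfl
    rw [← this]
    exact h b m
  exact this hv

lemma functional_single (u : (ι → MvPolynomial (Fin c) A) →ₗ[A] A) (b : ι)
    (p : MvPolynomial (Fin c) A) (s : Finset (Fin c →₀ ℕ)) (hs : p.support ⊆ s) :
    u (Pi.single b p) = ∑ m ∈ s, coeff m p * u (monVec A b m) := by
  have h : p = ∑ m ∈ s, coeff m p • monomial m (1 : A) := by
    conv_lhs => rw [p.as_sum]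
    rw [Finset.sum_subset hs]
    · simp [smul_monomial]
    · intro m _ hm
      rw [notMem_support_iff.mp hm, map_zero]
  conv_lhs => rw [h]
  have h2 : (Pi.single b (∑ m ∈ s, coeff m p • monomial m (1 : A)) :
      ι → MvPolynomial (Fin c) A) = ∑ m ∈ s, coeff m p • monVec A b m := by
    have := map_sum (LinearMap.single A (fun _ : ι => MvPolynomial (Fin c) A) b)
      (fun m => coeff m p • monomial m (1 : A)) s
    simp only [map_smul] at this
    exact this
  rw [h2, map_sum]
  simp

lemma vecMul_monVec (D : Matrix ι ι (MvPolynomial (Fin c) A)) (b : ι) (m : Fin c →₀ ℕ) :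
    Matrix.vecMul (monVec A b m) D = ∑ b', Pi.single b' (D b b' * monomial m 1) := by
  ext1 b'
  rw [monVec, Matrix.single_vecMul]
  simp [Finset.sum_apply, Pi.single_apply, mul_comm]

lemma functional_vecMul_monVec (u : (ι → MvPolynomial (Fin c) A) →ₗ[A] A)
    (D : Matrix ι ι (MvPolynomial (Fin c) A)) (b : ι) (m : Fin c →₀ ℕ) :
    u (Matrix.vecMul (monVec A b m) D) = ∑ b', u (Pi.single b' (D b b' * monomial m 1)) := by
  rw [vecMul_monVec, map_sum]

/-- Precomposition with right multiplication by the matrix `D`. -/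
noncomputable def bd (D : Matrix ι ι (MvPolynomial (Fin c) A)) :
    ((ι → MvPolynomial (Fin c) A) →ₗ[A] A) →ₗ[A] ((ι → MvPolynomial (Fin c) A) →ₗ[A] A) :=
  LinearMap.lcomp A A ((Matrix.vecMulLinear D).restrictScalars A)

lemma bd_apply (D : Matrix ι ι (MvPolynomial (Fin c) A)) (u) (v : ι → MvPolynomial (Fin c) A) :
    bd D u v = u (Matrix.vecMul v D) := rfl

/-- Precomposition with multiplication by a polynomial. -/
noncomputable def shiftBy (ι : Type) (p : MvPolynomial (Fin c) A) :
    ((ι → MvPolynomial (Fin c) A) →ₗ[A] A) →ₗ[A] ((ι → MvPolynomial (Fin c) A) →ₗ[A] A) :=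
  LinearMap.lcomp A A
    (LinearMap.lsmul (MvPolynomial (Fin c) A) (ι → MvPolynomial (Fin c) A) p |>.restrictScalars A)

lemma shiftBy_apply {ι : Type} (p : MvPolynomial (Fin c) A) (u) (v : ι → MvPolynomial (Fin c) A) :
    shiftBy ι p u v = u (p • v) := rfl

lemma shiftBy_bd (D : Matrix ι ι (MvPolynomial (Fin c) A)) (p : MvPolynomial (Fin c) A) (u) :
    shiftBy ι p (bd D u) = bd D (shiftBy ι p u) := by
  refine LinearMap.ext fun v => ?_
  simp only [shiftBy_apply, bd_apply, Matrix.smul_vecMul]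

lemma X_smul_monVec (b : ι) (j : Fin c) (m : Fin c →₀ ℕ) :
    (X j : MvPolynomial (Fin c) A) • monVec A b m = monVec A b (m + Finsupp.single j 1) := by
  rw [monVec, monVec, ← Pi.single_smul, smul_eq_mul, X, monomial_mul, one_mul, add_comm]

/-- The augmentation `u ↦ ∑ u(1_b) e_b`. -/
noncomputable def augFun {M : Type} [AddCommGroup M] [Module A M] (c : ℕ) (e : ι → M) :
    ((ι → MvPolynomial (Fin c) A) →ₗ[A] A) →ₗ[A] M :=
  ∑ b, (LinearMap.applyₗ (monVec A b 0)).smulRight (e b)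

lemma augFun_apply (e : ι → M) (u) :
    augFun c e u = Fintype.linearCombination A e (fun b => u (monVec A b 0)) := by
  simp [augFun, Fintype.linearCombination_apply, LinearMap.sum_apply]

lemma augFun_bd {deg : ι → ℕ} {e : ι → M} {D : Matrix ι ι (MvPolynomial (Fin c) A)}
    (hsupp : ∀ a b m, (D a b).coeff m ≠ 0 → deg a + 1 = deg b + 2 * m.degree)
    (h : IsGradedRes deg (D.map (coeff 0)) e) (u) : augFun c e (bd D u) = 0 := by
  classical
  let s : Finset (Fin c →₀ ℕ) := Finset.univ.biUnion fun p : ι × ι => (D p.1 p.2).support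
  have : (fun b => bd D u (monVec A b 0)) =
      ∑ m ∈ s, (D.map (coeff m)).mulVec fun b => u (monVec A b m) := by
    ext b
    rw [bd_apply, functional_vecMul_monVec, Finset.sum_apply]
    simp only [Matrix.mulVec, dotProduct, Matrix.map_apply]
    rw [Finset.sum_comm]
    refine Finset.sum_congr rfl fun b' _ => ?_
    rw [functional_single u b' _ s]
    · simp
    · intro m hm
      simp only [monomial_zero', C_1, mul_one] at hm
      exact Finset.mem_biUnion.mpr ⟨(b, b'), Finset.mem_univ _, hm⟩
  rw [augFun_apply, this, map_sum]
  exact Finset.sum_eq_zero fun m _ => aug_coeffMat_mulVec hsupp h m _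

/-- The ideal generated by the first `j` entries of `f`. -/
def initIdeal (f : Fin c → A) (j : ℕ) : Ideal A := Ideal.span (f '' {i | i.val < j})

lemma initIdeal_mono (f : Fin c → A) {i j : ℕ} (h : i ≤ j) : initIdeal f i ≤ initIdeal f j :=
  Ideal.span_mono (Set.image_mono fun _ hx => lt_of_lt_of_le hx h)

lemma mem_initIdeal (f : Fin c → A) {i : Fin c} {j : ℕ} (h : i.val < j) : f i ∈ initIdeal f j :=
  Ideal.subset_span ⟨i, h, rfl⟩

lemma initIdeal_zero (f : Fin c → A) : initIdeal f 0 = ⊥ := by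
  simp [initIdeal]

lemma initIdeal_self (f : Fin c → A) : initIdeal f c = Ideal.span (Set.range f) := by
  rw [initIdeal, ← Set.image_univ]
  congr 2
  ext i; simp

lemma exists_sub_mem_initIdeal (f : Fin c → A) (j : Fin c) {x : A}
    (hx : x ∈ initIdeal f (j.val + 1)) : ∃ y, x - f j * y ∈ initIdeal f j.val := by
  have : f '' {i | i.val < j.val + 1} = insert (f j) (f '' {i | i.val < j.val}) := by
    rw [← Set.image_insert_eq]
    congr 1
    ext i
    simp only [Set.mem_ofPred_eq, Set.mem_insert_iff, Fin.ext_iff]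
    omega
  rw [initIdeal, this, Ideal.mem_span_insert] at hx
  obtain ⟨a, z, hz, rfl⟩ := hx
  exact ⟨a, by rwa [mul_comm a, add_sub_cancel_left]⟩

/-- Regularity of the sequence `f`, stated through the ideals of initial segments. -/
def RegularInit (f : Fin c → A) : Prop :=
  ∀ (i : Fin c) (a : A), f i * a ∈ initIdeal f i.val → a ∈ initIdeal f i.val

lemma bd_bd {f : Fin c → A} {D : Matrix ι ι (MvPolynomial (Fin c) A)}
    (hD : D * D = curvature f • (1 : Matrix ι ι (MvPolynomial (Fin c) A))) (u) :
    bd D (bd D u) = ∑ i, f i • shiftBy ι (X i) u := by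
  refine LinearMap.ext fun v => ?_
  rw [bd_apply, bd_apply, Matrix.vecMul_vecMul, hD, Matrix.vecMul_smul, Matrix.vecMul_one,
    curvature, Finset.sum_smul, map_sum, LinearMap.sum_apply]
  refine Finset.sum_congr rfl fun i _ => ?_
  rw [LinearMap.smul_apply, shiftBy_apply, ← map_smul, ← smul_eq_C_mul, smul_assoc]

/-- Functionals killed by multiplication by `x_i` for `i ≥ j`. -/
def KilledFrom (j : ℕ) (u : (ι → MvPolynomial (Fin c) A) →ₗ[A] A) : Prop :=
  ∀ i : Fin c, j ≤ i.val → shiftBy ι (X i) u = 0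

lemma KilledFrom.apply_monVec {j : ℕ} {u : (ι → MvPolynomial (Fin c) A) →ₗ[A] A}
    (h : KilledFrom j u) (b : ι) {m : Fin c →₀ ℕ} {i : Fin c} (hi : j ≤ i.val) (hm : m i ≠ 0) :
    u (monVec A b m) = 0 := by
  have h1 : m = (m - Finsupp.single i 1) + Finsupp.single i 1 := by
    rw [tsub_add_cancel_of_le]
    rw [Finsupp.single_le_iff]; omega
  rw [h1, ← X_smul_monVec, ← shiftBy_apply, h i hi, LinearMap.zero_apply]

lemma killedFrom_iff {j : ℕ} {u : (ι → MvPolynomial (Fin c) A) →ₗ[A] A} :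
    KilledFrom j u ↔ ∀ b m (i : Fin c), j ≤ i.val → m i ≠ 0 → u (monVec A b m) = 0 := by
  refine ⟨fun h b m i hi hm => h.apply_monVec b hi hm, fun h i hi => ?_⟩
  refine LinearMap.ext fun v => ?_
  rw [LinearMap.zero_apply, ← Ideal.mem_bot]
  refine functional_mem (fun b m => ?_) v
  rw [Ideal.mem_bot, shiftBy_apply, X_smul_monVec]
  exact h b _ i hi (by simp)

lemma KilledFrom.bd {j : ℕ} {u : (ι → MvPolynomial (Fin c) A) →ₗ[A] A}
    (h : KilledFrom j u) (D : Matrix ι ι (MvPolynomial (Fin c) A)) : KilledFrom j (bd D u) := by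
  intro i hi
  rw [shiftBy_bd, h i hi, map_zero]

lemma exists_shiftBy_eq {j : Fin c} {u : (ι → MvPolynomial (Fin c) A) →ₗ[A] A}
    (h : KilledFrom (j.val + 1) u) : ∃ w, KilledFrom (j.val + 1) w ∧ shiftBy ι (X j) w = u := by
  obtain ⟨w, hw⟩ := exists_functional (A := A) (ι := ι) (c := c)
    fun b m => if m j = 0 then 0 else u (monVec A b (m - Finsupp.single j 1))
  refine ⟨w, ?_, ?_⟩
  · rw [killedFrom_iff]
    intro b m i hi hm
    rw [hw]
    split_ifs with h0
    · rfl
    · refine h.apply_monVec b hi ?_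
      have : j ≠ i := by intro h; subst h; omega
      simpa [this] using hm
  · refine LinearMap.ext fun v => ?_
    rw [← sub_eq_zero, ← LinearMap.sub_apply, ← Ideal.mem_bot]
    refine functional_mem (fun b m => ?_) v
    rw [Ideal.mem_bot, LinearMap.sub_apply, shiftBy_apply, X_smul_monVec, hw]
    simp

lemma KilledFrom.apply_eq {u : (ι → MvPolynomial (Fin c) A) →ₗ[A] A} (h : KilledFrom 0 u)
    (v : ι → MvPolynomial (Fin c) A) : u v = ∑ b, coeff 0 (v b) * u (monVec A b 0) := by
  classical
  conv_lhs => rw [← Finset.univ_sum_single v]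
  rw [map_sum]
  refine Finset.sum_congr rfl fun b _ => ?_
  rw [functional_single u b (v b) (insert 0 (v b).support) (Finset.subset_insert _ _)]
  rw [Finset.sum_eq_single 0]
  · intro m _ hm
    obtain ⟨i, hi⟩ := Finsupp.ne_iff.mp hm
    rw [h.apply_monVec b (Nat.zero_le i.val) hi, mul_zero]
  · simp

/-- Exactness of the complex of functionals, modulo an initial segment of the sequence. -/
lemma IsCurvedRes.exact_mod {f : Fin c → A} {deg : ι → ℕ} {e : ι → M}
    {D : Matrix ι ι (MvPolynomial (Fin c) A)} (h : IsCurvedRes f deg D e) (hf : RegularInit f)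
    (j : ℕ) (hj : j ≤ c) :
    ∀ u : (ι → MvPolynomial (Fin c) A) →ₗ[A] A, KilledFrom j u →
      (∀ v, bd D u v ∈ initIdeal f j) → augFun c e u = 0 →
      ∃ w, KilledFrom j w ∧ ∀ v, u v - bd D w v ∈ initIdeal f j := by
  induction j with
  | zero =>
    intro u hu hdu hau
    rw [initIdeal_zero] at *
    have hd : ∀ (w : (ι → MvPolynomial (Fin c) A) →ₗ[A] A), KilledFrom 0 w →
        (fun b => bd D w (monVec A b 0)) =
          (D.map (coeff 0)).mulVec fun b => w (monVec A b 0) := by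
      intro w hw
      ext b
      rw [bd_apply, hw.apply_eq]
      simp [Matrix.mulVec, dotProduct, monVec, Matrix.single_vecMul]
    obtain ⟨w0, hw0⟩ := h.res.exact (fun b => u (monVec A b 0))
      (by rw [← hd u hu]; ext b; exact hdu _) (by rw [← augFun_apply, hau])
    obtain ⟨w, hw⟩ := exists_functional (A := A) (ι := ι) (c := c)
      fun b m => if m = 0 then w0 b else 0
    have hwk : KilledFrom 0 w := by
      rw [killedFrom_iff]
      intro b m i _ hm
      rw [hw, if_neg]
      rintro rfl
      exact hm rfl
    refine ⟨w, hwk, fun v => ?_⟩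
    rw [hu.apply_eq, (hwk.bd D).apply_eq, ← Finset.sum_sub_distrib]
    refine Ideal.sum_mem _ fun b _ => ?_
    rw [← mul_sub]
    refine Ideal.mul_mem_left _ _ ?_
    have h1 := congrFun (hd w hwk) b
    have h2 := congrFun hw0 b
    simp only [hw, if_true] at h1
    rw [Ideal.mem_bot, h1, h2, sub_self]
  | succ j ih =>
    intro z hz hdz haz
    have hjc : j < c := hj
    let jj : Fin c := ⟨j, hjc⟩
    have hI := initIdeal_mono f (Nat.le_succ j)
    choose g hg using fun (b : ι) (m : Fin c →₀ ℕ) =>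
      exists_sub_mem_initIdeal f jj (hdz (monVec A b m))
    classical
    obtain ⟨u₁, hu₁⟩ := exists_functional (A := A) (ι := ι) (c := c)
      fun b m => if ∃ i : Fin c, j + 1 ≤ i.val ∧ m i ≠ 0 then 0 else g b m
    have hu₁k : KilledFrom (j + 1) u₁ := by
      rw [killedFrom_iff]
      intro b m i hi hm
      rw [hu₁, if_pos ⟨i, hi, hm⟩]
    have hdz' : ∀ v, (bd D z - f jj • u₁) v ∈ initIdeal f j := by
      refine functional_mem fun b m => ?_
      rw [LinearMap.sub_apply, LinearMap.smul_apply, hu₁]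
      split_ifs with hc
      · obtain ⟨i, hi, hm⟩ := hc
        rw [(hz.bd D).apply_monVec b hi hm, smul_zero, sub_zero]
        exact Ideal.zero_mem _
      · exact hg b m
    obtain ⟨u', hu'k, hu'⟩ := exists_shiftBy_eq (j := jj) hu₁k
    have hsq : ∀ w : (ι → MvPolynomial (Fin c) A) →ₗ[A] A, KilledFrom (j + 1) w → ∀ v,
        (bd D (bd D w) - f jj • shiftBy ι (X jj) w) v ∈ initIdeal f j := by
      intro w hw v
      rw [bd_bd h.sq, ← Finset.sum_erase_add _ _ (Finset.mem_univ jj), add_sub_cancel_right,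
        LinearMap.sum_apply]
      refine Ideal.sum_mem _ fun i hi => ?_
      have hne : i ≠ jj := Finset.ne_of_mem_erase hi
      rcases lt_or_ge i.val j with hlt | hge
      · exact Ideal.mul_mem_right _ _ (mem_initIdeal f hlt)
      · have : j + 1 ≤ i.val := by
          have : i.val ≠ j := fun h => hne (Fin.ext h)
          omega
        rw [hw i this]
        simp
    set q := z - bd D u' with hq
    have hqk : KilledFrom (j + 1) q := fun i hi => by
      rw [hq, map_sub, hz i hi, (hu'k.bd D) i hi, sub_zero]
    have hdq : ∀ v, bd D q v ∈ initIdeal f j := by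
      intro v
      have h1 := Ideal.sub_mem _ (hdz' v) (hsq u' hu'k v)
      rw [hu'] at h1
      simp only [hq, map_sub, LinearMap.sub_apply] at h1 ⊢
      convert h1 using 1
      ring
    have hxq : ∀ v, shiftBy ι (X jj) q v ∈ initIdeal f j := by
      intro v
      apply hf jj
      have h1 := hdz' (Matrix.vecMul v D)
      have h2 := hsq z hz v
      have h3 := Ideal.sub_mem _ h1 h2
      rw [hq, map_sub, shiftBy_bd, hu']
      simp only [LinearMap.sub_apply, LinearMap.smul_apply, smul_eq_mul, bd_apply] at h3 ⊢
      convert h3 using 1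
      ring
    obtain ⟨q₀, hq₀⟩ := exists_functional (A := A) (ι := ι) (c := c)
      fun b m => if m jj = 0 then q (monVec A b m) else 0
    have hq₀k : KilledFrom j q₀ := by
      rw [killedFrom_iff]
      intro b m i hi hm
      rw [hq₀]
      split_ifs with h0
      · refine hqk.apply_monVec b ?_ hm
        have : i.val ≠ j := by
          rintro rfl
          exact hm h0
        omega
      · rfl
    have hqq : ∀ v, (q - q₀) v ∈ initIdeal f j := by
      refine functional_mem fun b m => ?_
      rw [LinearMap.sub_apply, hq₀]
      split_ifs with h0
      · rw [sub_self]; exact Ideal.zero_mem _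
      · have h1 : m = (m - Finsupp.single jj 1) + Finsupp.single jj 1 := by
          rw [tsub_add_cancel_of_le]
          rw [Finsupp.single_le_iff]; omega
        rw [h1, ← X_smul_monVec, ← shiftBy_apply, sub_zero]
        exact hxq _
    have haq : augFun c e q₀ = 0 := by
      have : augFun c e q₀ = augFun c e q := by
        rw [augFun_apply, augFun_apply]
        congr 1
        ext b
        rw [hq₀]
        simp
      rw [this, hq, map_sub, haz, augFun_bd h.supp h.res, sub_zero]
    obtain ⟨r, hrk, hr⟩ := ih (by omega) q₀ hq₀k (fun v => by
      have h1 := Ideal.sub_mem _ (hdq v) (hqq (Matrix.vecMul v D))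
      convert h1 using 1
      simp only [bd_apply, LinearMap.sub_apply]
      ring) haq
    refine ⟨u' + r, fun i hi => ?_, fun v => hI ?_⟩
    · rw [map_add, hu'k i hi, hrk i (by omega), add_zero]
    · have h1 := Ideal.add_mem _ (hqq v) (hr v)
      convert h1 using 1
      simp only [hq, map_add, LinearMap.add_apply, LinearMap.sub_apply]
      ring

/-- Basis of the degree `n` part of the divided power extension. -/
abbrev ShIdx (deg : ι → ℕ) (c n : ℕ) : Type :=
  {p : ι × (Fin c →₀ ℕ) // deg p.1 + 2 * p.2.degree = n}

instance (deg : ι → ℕ) (c n : ℕ) : Finite (ShIdx deg c n) := by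
  let g : ShIdx deg c n → ι × (Fin c → Fin (n + 1)) := fun p => (p.1.1, fun i => ⟨p.1.2 i, by
    have h1 := p.2
    have h2 : p.1.2 i ≤ p.1.2.degree := Finsupp.le_degree i p.1.2
    omega⟩)
  refine Finite.of_injective g fun p q h => ?_
  simp only [g, Prod.mk.injEq, funext_iff, Fin.mk.injEq] at h
  exact Subtype.ext (Prod.ext h.1 (Finsupp.ext h.2))

noncomputable instance (deg : ι → ℕ) (c n : ℕ) : Fintype (ShIdx deg c n) := Fintype.ofFinite _

/-- The differential of the divided power extension, base changed to `B`. -/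
noncomputable def shMat (B : Type) [CommRing B] [Algebra A B] (deg : ι → ℕ)
    (D : Matrix ι ι (MvPolynomial (Fin c) A)) (n : ℕ) :
    Matrix (ShIdx deg c n) (ShIdx deg c (n + 1)) B :=
  Matrix.of fun p q => algebraMap A B (coeff q.1.2 (D p.1.1 q.1.1 * monomial p.1.2 1))

lemma bd_monVec {deg : ι → ℕ} {D : Matrix ι ι (MvPolynomial (Fin c) A)}
    (hsupp : ∀ a b m, (D a b).coeff m ≠ 0 → deg a + 1 = deg b + 2 * m.degree) {n : ℕ}
    (p : ShIdx deg c n) (u : (ι → MvPolynomial (Fin c) A) →ₗ[A] A) :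
    bd D u (monVec A p.1.1 p.1.2) = ∑ q : ShIdx deg c (n + 1),
      coeff q.1.2 (D p.1.1 q.1.1 * monomial p.1.2 1) * u (monVec A q.1.1 q.1.2) := by
  classical
  obtain ⟨⟨b, a⟩, hp⟩ := p
  simp only at hp ⊢
  let T : Finset (ι × (Fin c →₀ ℕ)) :=
    (Finset.univ : Finset (ShIdx deg c (n + 1))).image Subtype.val
  let s : Finset (Fin c →₀ ℕ) := T.image Prod.snd ∪
    Finset.univ.biUnion fun b' : ι => (D b b' * monomial a (1 : A)).support
  have hT : T ⊆ Finset.univ ×ˢ s := fun x hx => Finset.mem_product.mpr ⟨Finset.mem_univ _,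
    Finset.mem_union_left _ (Finset.mem_image_of_mem _ hx)⟩
  have hR : ∑ q : ShIdx deg c (n + 1),
      coeff q.1.2 (D b q.1.1 * monomial a 1) * u (monVec A q.1.1 q.1.2) =
      ∑ x ∈ T, coeff x.2 (D b x.1 * monomial a 1) * u (monVec A x.1 x.2) := by
    rw [Finset.sum_image (fun x _ y _ h => Subtype.ext h)]
  rw [hR, Finset.sum_subset hT, bd_apply, functional_vecMul_monVec, Finset.sum_product]
  · refine Finset.sum_congr rfl fun b' _ => functional_single u b' _ s fun m hm => ?_
    exact Finset.mem_union_right _ (Finset.mem_biUnion.mpr ⟨b', Finset.mem_univ _, hm⟩)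
  · rintro ⟨b', m⟩ _ hx
    have : coeff m (D b b' * monomial a (1 : A)) = 0 := by
      by_contra h0
      rw [coeff_mul_monomial'] at h0
      split_ifs at h0 with hle
      · rw [mul_one] at h0
        have h1 := hsupp _ _ _ h0
        have h2 : (m - a).degree + a.degree = m.degree := by
          rw [← map_add, tsub_add_cancel_of_le hle]
        exact hx (Finset.mem_image.mpr ⟨⟨(b', m), by simp only; omega⟩, Finset.mem_univ _, rfl⟩)
      · exact h0 rfl
    simp only [this, zero_mul]

/-- A free resolution of `M` given by matrices with finite index types. -/
structure IsMatrixRes {R M : Type} [CommRing R] [AddCommGroup M] [Module R M] {G : ℕ → Type}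
    [∀ n, Fintype (G n)] (d : ∀ n, Matrix (G n) (G (n + 1)) R) (e : G 0 → M) : Prop where
  surj : ∀ m, ∃ v, Fintype.linearCombination R e v = m
  aug : ∀ v, Fintype.linearCombination R e ((d 0).mulVec v) = 0
  aug_exact : ∀ v, Fintype.linearCombination R e v = 0 → ∃ u, (d 0).mulVec u = v
  sq : ∀ n v, (d n).mulVec ((d (n + 1)).mulVec v) = 0
  exact : ∀ n v, (d n).mulVec v = 0 → ∃ u, (d (n + 1)).mulVec u = v

theorem IsCurvedRes.isMatrixRes {B : Type} [CommRing B] [Algebra A B] [Module B M]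
    [IsScalarTower A B M] {f : Fin c → A} {deg : ι → ℕ} {e : ι → M}
    {D : Matrix ι ι (MvPolynomial (Fin c) A)} (h : IsCurvedRes f deg D e) (hf : RegularInit f)
    (hsurj : Function.Surjective (algebraMap A B))
    (hker : RingHom.ker (algebraMap A B) = Ideal.span (Set.range f)) :
    IsMatrixRes (shMat B deg D) (fun p : ShIdx deg c 0 => e p.1.1) := by
  classical
  have hk : ∀ x, x ∈ initIdeal f c ↔ algebraMap A B x = 0 := by
    intro x
    rw [initIdeal_self, ← hker, RingHom.mem_ker]
  let ev : ∀ n, ((ι → MvPolynomial (Fin c) A) →ₗ[A] A) → ShIdx deg c n → B :=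
    fun n u p => algebraMap A B (u (monVec A p.1.1 p.1.2))
  have hev : ∀ n u, ev n (bd D u) = (shMat B deg D n).mulVec (ev (n + 1) u) := by
    intro n u
    ext p
    simp only [ev, Matrix.mulVec, dotProduct, shMat, Matrix.of_apply]
    rw [bd_monVec h.supp, map_sum]
    simp
  have hlift : ∀ n (x : ShIdx deg c n → B), ∃ u, ev n u = x ∧
      ∀ b m, deg b + 2 * m.degree ≠ n → u (monVec A b m) = 0 := by
    intro n x
    choose g hg using fun p => hsurj (x p)
    obtain ⟨u, hu⟩ := exists_functional (A := A) (ι := ι) (c := c)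
      fun b m => if hbm : deg b + 2 * m.degree = n then g ⟨(b, m), hbm⟩ else 0
    refine ⟨u, ?_, ?_⟩
    · ext ⟨p, hp⟩
      simp only [ev, hu, hp, dif_pos, hg]
    · intro b m hbm
      rw [hu, dif_neg hbm]
  have hev0 : ∀ u, Fintype.linearCombination B (fun p : ShIdx deg c 0 => e p.1.1) (ev 0 u) =
      augFun c e u := by
    intro u
    rw [augFun_apply]
    simp only [Fintype.linearCombination_apply, ev, algebraMap_smul]
    let g : ShIdx deg c 0 → ι := fun p => p.1.1
    have h2 : ∀ p : ShIdx deg c 0, p.1.2 = 0 := fun p =>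
      (Finsupp.degree_eq_zero_iff _).mp (by have := p.2; omega)
    have hinj : Function.Injective g := fun p q hpq =>
      Subtype.ext (Prod.ext hpq ((h2 p).trans (h2 q).symm))
    refine Fintype.sum_of_injective g hinj _ _ (fun b hb => ?_) (fun p => ?_)
    · rw [h.res.aug_eq_zero b, smul_zero]
      intro h0
      exact hb ⟨⟨(b, 0), by simp [h0]⟩, rfl⟩
    · rw [h2 p]
  have hexact : ∀ n u, (∀ b m, deg b + 2 * m.degree ≠ n → u (monVec A b m) = 0) →
      (∀ b m, deg b + 2 * m.degree + 1 = n → algebraMap A B (bd D u (monVec A b m)) = 0) →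
      augFun c e u = 0 → ∃ w, (shMat B deg D n).mulVec w = ev n u := by
    intro n u hu hdu hau
    have hbd : ∀ v, bd D u v ∈ initIdeal f c := by
      refine functional_mem fun b m => ?_
      rw [hk]
      by_cases hbm : deg b + 2 * m.degree + 1 = n
      · exact hdu b m hbm
      · rw [bd_monVec h.supp (⟨(b, m), rfl⟩ : ShIdx deg c (deg b + 2 * m.degree))]
        rw [Finset.sum_eq_zero, map_zero]
        intro q _
        rw [hu, mul_zero]
        rw [q.2]
        exact hbm
    obtain ⟨w, -, hw⟩ := h.exact_mod hf c le_rfl u (fun i hi => by have := i.2; omega) hbd hau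
    refine ⟨ev (n + 1) w, ?_⟩
    rw [← hev]
    ext p
    have := hw (monVec A p.1.1 p.1.2)
    rw [hk, map_sub, sub_eq_zero] at this
    exact this.symm
  refine ⟨fun m => ?_, fun v => ?_, fun v hv => ?_, fun n v => ?_, fun n v hv => ?_⟩
  · obtain ⟨v, hv⟩ := h.res.surj m
    obtain ⟨u, hu⟩ := exists_functional (A := A) (ι := ι) (c := c) fun b _ => v b
    refine ⟨ev 0 u, ?_⟩
    rw [hev0, augFun_apply]
    simp only [hu]
    exact hv
  · obtain ⟨u, rfl, -⟩ := hlift _ v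
    rw [← hev, hev0, augFun_bd h.supp h.res]
  · obtain ⟨u, rfl, hu⟩ := hlift _ v
    rw [hev0] at hv
    exact hexact 0 u hu (by omega) hv
  · obtain ⟨u, rfl, -⟩ := hlift _ v
    rw [← hev, ← hev, bd_bd h.sq]
    ext p
    simp only [ev, LinearMap.sum_apply, Pi.zero_apply]
    rw [← hk]
    exact Ideal.sum_mem _ fun i _ => Ideal.mul_mem_right _ _ (mem_initIdeal f i.2)
  · obtain ⟨u, rfl, hu⟩ := hlift _ v
    rw [← hev] at hv
    refine hexact (n + 1) u hu (fun b m hbm => ?_) ?_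
    · exact congrFun hv ⟨(b, m), by simp only; omega⟩
    · rw [augFun_apply, Fintype.linearCombination_apply]
      refine Finset.sum_eq_zero fun b _ => ?_
      by_cases hb : deg b = n + 1
      · rw [h.res.aug_eq_zero b (by omega), smul_zero]
      · rw [hu b 0 (by simpa using hb), zero_smul]

end Shamash

section Comparison

variable {R M : Type} [CommRing R] [AddCommGroup M] [Module R M] {G G' : ℕ → Type}
    [∀ n, Fintype (G n)] [∀ n, Fintype (G' n)]

lemma exists_matrix_mul_eq {l m n : Type} [Fintype m] (d : Matrix l m R) (X : Matrix l n R)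
    (h : ∀ k, ∃ u, d.mulVec u = fun i => X i k) : ∃ Y : Matrix m n R, d * Y = X := by
  choose u hu using h
  refine ⟨Matrix.of fun i k => u k i, ?_⟩
  ext i k
  rw [Matrix.mul_apply]
  exact congrFun (hu k) i

lemma matrix_col_eq_mulVec_single {m n : Type} [Fintype n] [DecidableEq n] (X : Matrix m n R)
    (k : n) : (fun i => X i k) = X.mulVec (Pi.single k 1) := by
  ext i; simp

lemma IsMatrixRes.mul_eq_zero {d : ∀ n, Matrix (G n) (G (n + 1)) R} {e : G 0 → M}
    (h : IsMatrixRes d e) (n : ℕ) : d n * d (n + 1) = 0 := by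
  classical
  refine Matrix.ext_of_mulVec_single fun i => ?_
  rw [← Matrix.mulVec_mulVec, h.sq, Matrix.zero_mulVec]

lemma exists_seq_of_step {α : ℕ → Type} (P : ∀ n, α n → Prop) (r : ∀ n, α n → α (n + 1) → Prop)
    (a₀ : α 0) (h₀ : P 0 a₀) (step : ∀ n a, P n a → ∃ a', P (n + 1) a' ∧ r n a a') :
    ∃ s : ∀ n, α n, s 0 = a₀ ∧ ∀ n, P n (s n) ∧ r n (s n) (s (n + 1)) := by
  choose g hg using step
  let t : ∀ n, {a : α n // P n a} := fun n =>
    Nat.rec ⟨a₀, h₀⟩ (fun n a => ⟨g n a.1 a.2, (hg n a.1 a.2).1⟩) n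
  exact ⟨fun n => (t n).1, rfl, fun n => ⟨(t n).2, (hg n (t n).1 (t n).2).2⟩⟩

lemma IsMatrixRes.exists_chainMap {d : ∀ n, Matrix (G n) (G (n + 1)) R} {e : G 0 → M}
    {d' : ∀ n, Matrix (G' n) (G' (n + 1)) R} {e' : G' 0 → M}
    (h : IsMatrixRes d e) (h' : IsMatrixRes d' e') :
    ∃ φ : ∀ n, Matrix (G' n) (G n) R,
      (∀ v, Fintype.linearCombination R e' ((φ 0).mulVec v) = Fintype.linearCombination R e v) ∧
      ∀ n, d' n * φ (n + 1) = φ n * d n := by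
  classical
  choose a ha using fun k => h'.surj (e k)
  let φ₀ : Matrix (G' 0) (G 0) R := Matrix.of fun i k => a k i
  have hφ₀ : ∀ v, Fintype.linearCombination R e' (φ₀.mulVec v) =
      Fintype.linearCombination R e v := by
    intro v
    have : φ₀.mulVec v = ∑ k, v k • a k := by
      ext i
      simp [Matrix.mulVec, dotProduct, φ₀, mul_comm]
    rw [this, map_sum, Fintype.linearCombination_apply (f := v)]
    simp only [map_smul, ha]
  obtain ⟨φ, h0, hφ⟩ := exists_seq_of_step (α := fun n => Matrix (G' n) (G n) R)
    (fun n φ => ∀ v, ∃ u, (d' n).mulVec u = φ.mulVec ((d n).mulVec v))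
    (fun n φ φ' => d' n * φ' = φ * d n) φ₀
    (fun v => h'.aug_exact _ (by rw [hφ₀, h.aug])) (fun n φ hφ => by
      obtain ⟨Y, hY⟩ := exists_matrix_mul_eq (d' n) (φ * d n) (fun k => by
        rw [matrix_col_eq_mulVec_single, ← Matrix.mulVec_mulVec]
        exact hφ _)
      refine ⟨Y, fun v => h'.exact n _ ?_, hY⟩
      rw [Matrix.mulVec_mulVec, hY, ← Matrix.mulVec_mulVec, h.sq, Matrix.mulVec_zero])
  exact ⟨φ, by rw [h0]; exact hφ₀, fun n => (hφ n).2⟩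

lemma IsMatrixRes.exists_homotopy {d : ∀ n, Matrix (G n) (G (n + 1)) R} {e : G 0 → M}
    {d' : ∀ n, Matrix (G' n) (G' (n + 1)) R} {e' : G' 0 → M}
    (h : IsMatrixRes d e) (h' : IsMatrixRes d' e') (φ : ∀ n, Matrix (G' n) (G n) R)
    (h0 : ∀ v, Fintype.linearCombination R e' ((φ 0).mulVec v) = 0)
    (hφ : ∀ n, d' n * φ (n + 1) = φ n * d n) :
    ∃ s : ∀ n, Matrix (G' (n + 1)) (G n) R,
      ∀ n, φ (n + 1) = d' (n + 1) * s (n + 1) + s n * d n := by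
  classical
  obtain ⟨s₀, hs₀⟩ := exists_matrix_mul_eq (d' 0) (φ 0) (fun k => by
    rw [matrix_col_eq_mulVec_single]
    exact h'.aug_exact _ (h0 _))
  obtain ⟨s, -, hs⟩ := exists_seq_of_step (α := fun n => Matrix (G' (n + 1)) (G n) R)
    (fun n s => d' n * (φ (n + 1) - s * d n) = 0)
    (fun n s s' => φ (n + 1) = d' (n + 1) * s' + s * d n) s₀
    (by rw [Matrix.mul_sub, ← Matrix.mul_assoc, hs₀, hφ, sub_self]) (fun n s hs => by
      obtain ⟨Y, hY⟩ := exists_matrix_mul_eq (d' (n + 1)) (φ (n + 1) - s * d n) (fun k => by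
        rw [matrix_col_eq_mulVec_single]
        refine h'.exact n _ ?_
        rw [Matrix.mulVec_mulVec, hs, Matrix.zero_mulVec])
      refine ⟨Y, ?_, by rw [hY, sub_add_cancel]⟩
      rw [Matrix.mul_sub, ← Matrix.mul_assoc, hY, hφ, Matrix.sub_mul, Matrix.mul_assoc s,
        h.mul_eq_zero, Matrix.mul_zero, sub_zero,
        sub_self])
  exact ⟨s, fun n => (hs n).2⟩

end Comparison

theorem IsMatrixRes.betti_eq {R M : Type} [CommRing R] [IsLocalRing R] [AddCommGroup M]
    [Module R M] {G F : ℕ → Type} [∀ n, Fintype (G n)] [∀ n, Fintype (F n)]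
    {d : ∀ n, Matrix (G n) (G (n + 1)) R} {e : G 0 → M}
    {d' : ∀ n, Matrix (F n) (F (n + 1)) R} {e' : F 0 → M}
    (h : IsMatrixRes d e) (h' : IsMatrixRes d' e')
    (hmin : ∀ n i j, d' n i j ∈ maximalIdeal R) (n : ℕ) :
    Fintype.card (F (n + 1)) + ((d n).map (residue R)).rank + ((d (n + 1)).map (residue R)).rank =
      Fintype.card (G (n + 1)) := by
  classical
  obtain ⟨φ, hφ0, hφ⟩ := h.exists_chainMap h'
  obtain ⟨ψ, hψ0, hψ⟩ := h'.exists_chainMap h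
  obtain ⟨s, hs⟩ := h.exists_homotopy h (fun n => 1 - ψ n * φ n)
    (fun v => by
      rw [Matrix.sub_mulVec, map_sub, ← Matrix.mulVec_mulVec, hψ0, hφ0, Matrix.one_mulVec,
        sub_self])
    (fun n => by
      rw [Matrix.mul_sub, Matrix.sub_mul, Matrix.mul_one, Matrix.one_mul,
        ← Matrix.mul_assoc, hψ, Matrix.mul_assoc, hφ, Matrix.mul_assoc])
  obtain ⟨t, ht⟩ := h'.exists_homotopy h' (fun n => 1 - φ n * ψ n)
    (fun v => by
      rw [Matrix.sub_mulVec, map_sub, ← Matrix.mulVec_mulVec, hφ0, hψ0, Matrix.one_mulVec,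
        sub_self])
    (fun n => by
      rw [Matrix.mul_sub, Matrix.sub_mul, Matrix.mul_one, Matrix.one_mul,
        ← Matrix.mul_assoc, hφ, Matrix.mul_assoc, hψ, Matrix.mul_assoc])
  have hd' : ∀ n, (d' n).map (residue R) = 0 := by
    intro n
    ext i j
    simpa [residue_eq_zero_iff] using hmin n i j
  let k := ResidueField R
  let δ := fun n => (d n).map (residue R)
  let φ' := (φ (n + 1)).map (residue R)
  let ψ' := (ψ (n + 1)).map (residue R)
  have h1 : φ' * ψ' = 1 := by
    have := congrArg (fun X => X.map (residue R)) (ht n)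
    simp only [Matrix.map_sub _ (map_sub (residue R)), Matrix.map_add _ (map_add (residue R)),
      Matrix.map_mul, hd', Matrix.zero_mul, Matrix.mul_zero, add_zero] at this
    rw [Matrix.map_one _ (map_zero _) (map_one _), sub_eq_zero] at this
    exact this.symm
  have h2 : 1 - ψ' * φ' = δ (n + 1) * (s (n + 1)).map (residue R) +
      (s n).map (residue R) * δ n := by
    have := congrArg (fun X => X.map (residue R)) (hs n)
    simp only [Matrix.map_sub _ (map_sub (residue R)), Matrix.map_add _ (map_add (residue R)),
      Matrix.map_mul] at this
    rw [Matrix.map_one _ (map_zero _) (map_one _)] at this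
    exact this
  have h3 : δ n * ψ' = 0 := by
    have := congrArg (fun X => X.map (residue R)) (hψ n)
    simp only [Matrix.map_mul, hd', Matrix.mul_zero] at this
    exact this
  have h4 : φ' * δ (n + 1) = 0 := by
    have := congrArg (fun X => X.map (residue R)) (hφ (n + 1))
    simp only [Matrix.map_mul, hd', Matrix.zero_mul] at this
    exact this.symm
  have h5 : δ n * δ (n + 1) = 0 := by
    have := congrArg (fun X => X.map (residue R)) (h.mul_eq_zero n)
    simp only [Matrix.map_mul] at this
    rw [Matrix.map_zero _ (map_zero _)] at this
    exact this
  let Z := LinearMap.ker (δ n).mulVecLin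
  let g : Z →ₗ[k] (F (n + 1) → k) := φ'.mulVecLin.domRestrict Z
  have hg : Function.Surjective g := by
    intro y
    refine ⟨⟨ψ'.mulVec y, ?_⟩, ?_⟩
    · rw [LinearMap.mem_ker, Matrix.mulVecLin_apply, Matrix.mulVec_mulVec, h3, Matrix.zero_mulVec]
    · simp only [g, LinearMap.domRestrict_apply, Matrix.mulVecLin_apply]
      rw [Matrix.mulVec_mulVec, h1, Matrix.one_mulVec]
  have hker : (LinearMap.ker g).map Z.subtype = LinearMap.range (δ (n + 1)).mulVecLin := by
    ext z
    simp only [Submodule.mem_map, LinearMap.mem_ker, LinearMap.mem_range, Submodule.subtype_apply]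
    constructor
    · rintro ⟨⟨z, hz⟩, hgz, rfl⟩
      have hgz' : φ'.mulVec z = 0 := hgz
      have hz' : (δ n).mulVec z = 0 := hz
      refine ⟨((s (n + 1)).map (residue R)).mulVec z, ?_⟩
      have := congrArg (fun X => X.mulVec z) h2
      simp only [Matrix.sub_mulVec, Matrix.add_mulVec, ← Matrix.mulVec_mulVec, hgz', hz',
        Matrix.mulVec_zero, sub_zero, add_zero, Matrix.one_mulVec] at this
      exact this.symm
    · rintro ⟨y, rfl⟩
      refine ⟨⟨(δ (n + 1)).mulVec y, ?_⟩, ?_, rfl⟩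
      · rw [LinearMap.mem_ker, Matrix.mulVecLin_apply, Matrix.mulVec_mulVec, h5, Matrix.zero_mulVec]
      · change φ'.mulVec ((δ (n + 1)).mulVec y) = 0
        rw [Matrix.mulVec_mulVec, h4, Matrix.zero_mulVec]
  have e1 := LinearMap.finrank_range_add_finrank_ker g
  have e2 := LinearMap.finrank_range_add_finrank_ker (δ n).mulVecLin
  have e3 : Module.finrank k (LinearMap.ker g) = (δ (n + 1)).rank := by
    rw [Matrix.rank, ← hker]
    exact (LinearEquiv.finrank_eq (Submodule.equivMapOfInjective _ Z.injective_subtype _))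
  rw [LinearMap.range_eq_top.mpr hg, finrank_top, e3, Module.finrank_fintype_fun_eq_card] at e1
  rw [Module.finrank_fintype_fun_eq_card] at e2
  change _ + (δ n).rank + (δ (n + 1)).rank = _
  rw [← e2, ← e1, Matrix.rank]
  ring

/-- `β` is the sequence of ranks in a free resolution with matrices having entries in the maximal
ideal. -/
def IsMinRes (R M : Type) [CommRing R] [IsLocalRing R] [AddCommGroup M] [Module R M]
    (β : ℕ → ℕ) : Prop :=
  ∃ (d : ∀ n, Matrix (Fin (β n)) (Fin (β (n + 1))) R) (e : Fin (β 0) → M),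
    IsMatrixRes d e ∧ ∀ n i j, d n i j ∈ maximalIdeal R

lemma isMatrixRes_of_linearMaps {R M : Type} [CommRing R] [AddCommGroup M]
    [Module R M] {β : ℕ → ℕ} (d : ∀ i : ℕ, (Fin (β (i + 1)) → R) →ₗ[R] (Fin (β i) → R))
    (ε : (Fin (β 0) → R) →ₗ[R] M) (hε : Function.Surjective ε)
    (h0 : LinearMap.ker ε = LinearMap.range (d 0))
    (h : ∀ i, LinearMap.ker (d i) = LinearMap.range (d (i + 1))) :
    IsMatrixRes (G := fun n => Fin (β n)) (fun n => LinearMap.toMatrix' (d n))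
      (fun i => ε (Pi.single i 1)) := by
  have hlc : ∀ v, Fintype.linearCombination R (fun i => ε (Pi.single i 1)) v = ε v := by
    intro v
    rw [Fintype.linearCombination_apply]
    simp only [← map_smul, ← map_sum]
    congr 1
    ext i
    simp [Finset.sum_apply, Pi.single_apply]
  refine ⟨fun m => ?_, fun v => ?_, fun v hv => ?_, fun n v => ?_, fun n v hv => ?_⟩
  · obtain ⟨v, rfl⟩ := hε m
    exact ⟨v, hlc v⟩
  · rw [hlc, LinearMap.toMatrix'_mulVec, ← LinearMap.mem_ker, h0]
    exact ⟨v, rfl⟩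
  · rw [hlc, ← LinearMap.mem_ker, h0] at hv
    obtain ⟨u, rfl⟩ := hv
    exact ⟨u, LinearMap.toMatrix'_mulVec _ _⟩
  · rw [LinearMap.toMatrix'_mulVec, LinearMap.toMatrix'_mulVec, ← LinearMap.mem_ker, h]
    exact ⟨v, rfl⟩
  · rw [LinearMap.toMatrix'_mulVec, ← LinearMap.mem_ker, h] at hv
    obtain ⟨u, rfl⟩ := hv
    exact ⟨u, LinearMap.toMatrix'_mulVec _ _⟩

lemma coord_mem_of_mem_smul_top {R : Type} [CommRing R] {I : Ideal R} {n : ℕ} {v : Fin n → R}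
    (hv : v ∈ I • (⊤ : Submodule R (Fin n → R))) (i : Fin n) : v i ∈ I := by
  have : I • (⊤ : Submodule R (Fin n → R)) ≤ Submodule.comap (LinearMap.proj i) I := by
    rw [Submodule.smul_le]
    intro r hr x _
    exact Ideal.mul_mem_right _ _ hr
  exact this hv

lemma IsMatrixRes.projDimLE {R : Type} [CommRing R] (N : ℕ) :
    ∀ {M : Type} [AddCommGroup M] [Module R M] {G : ℕ → Type} [∀ n, Fintype (G n)]
      {d : ∀ n, Matrix (G n) (G (n + 1)) R} {e : G 0 → M}, IsMatrixRes d e → IsEmpty (G N) →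
      ProjDimLE R M N := by
  classical
  induction N with
  | zero =>
    intro M _ _ G _ d e h hG
    rw [projDimLE_zero_iff]
    have : Subsingleton M := ⟨fun x y => by
      obtain ⟨v, rfl⟩ := h.surj x
      obtain ⟨w, rfl⟩ := h.surj y
      congr 1
      exact Subsingleton.elim _ _⟩
    infer_instance
  | succ N ih =>
    intro M _ _ G _ d e h hG
    let K := LinearMap.ker (Fintype.linearCombination R e)
    let e' : G 1 → K := fun j => ⟨fun i => d 0 i j, by
      rw [LinearMap.mem_ker, matrix_col_eq_mulVec_single]
      exact h.aug _⟩
    have hlc : ∀ v, (Fintype.linearCombination R e' v).1 = (d 0).mulVec v := by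
      intro v
      rw [Fintype.linearCombination_apply, Submodule.coe_sum]
      ext i
      simp [e', Matrix.mulVec, dotProduct, mul_comm, Finset.sum_apply]
    rw [projDimLE_succ_iff K.subtype (Fintype.linearCombination R e) K.injective_subtype h.surj
      (LinearMap.exact_subtype_ker_map _)]
    refine ih (G := fun n => G (n + 1)) (d := fun n => d (n + 1)) (e := e') ?_ hG
    refine ⟨fun m => ?_, fun v => ?_, fun v hv => ?_, fun n v => ?_, fun n v hv => ?_⟩
    · obtain ⟨u, hu⟩ := h.aug_exact m.1 m.2
      exact ⟨u, Subtype.ext ((hlc u).trans hu)⟩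
    · exact Subtype.ext ((hlc _).trans (h.sq 0 v))
    · exact h.exact 0 v (by rw [← hlc, hv]; rfl)
    · exact h.sq (n + 1) v
    · exact h.exact (n + 1) v hv

lemma exists_isMinRes (R M : Type) [CommRing R] [IsLocalRing R] [IsNoetherianRing R]
    [AddCommGroup M] [Module R M] [Module.Finite R M] : ∃ β, IsMinRes R M β := by
  obtain ⟨r, φ, hφ, hφm⟩ := exists_minimal_cover R M
  obtain ⟨s, hs0, hs⟩ := exists_seq_of_step (α := fun _ => Σ r : ℕ, Submodule R (Fin r → R))
    (fun _ a => ∀ v ∈ a.2, ∀ i, v i ∈ maximalIdeal R)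
    (fun _ a a' => ∃ d : (Fin a'.1 → R) →ₗ[R] (Fin a.1 → R), LinearMap.range d = a.2 ∧
      LinearMap.ker d = a'.2)
    ⟨r, LinearMap.ker φ⟩ (fun v hv => hφm v hv) (fun _ a ha => by
      obtain ⟨r', ψ, hψ, hψm⟩ := exists_minimal_cover R a.2
      refine ⟨⟨r', LinearMap.ker ψ⟩, fun v hv => hψm v hv, a.2.subtype ∘ₗ ψ, ?_, ?_⟩
      · rw [LinearMap.range_comp, LinearMap.range_eq_top.mpr hψ, Submodule.map_top,
          Submodule.range_subtype]
      · rw [LinearMap.ker_comp, Submodule.ker_subtype]; rfl)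
  choose hm d hd using hs
  have : ∃ ε : (Fin (s 0).1 → R) →ₗ[R] M, Function.Surjective ε ∧ LinearMap.ker ε = (s 0).2 := by
    rw [hs0]
    exact ⟨φ, hφ, rfl⟩
  obtain ⟨ε, hε, hεk⟩ := this
  refine ⟨fun n => (s n).1, _, _, isMatrixRes_of_linearMaps (β := fun n => (s n).1) d ε hε
    (hεk.trans (hd 0).1.symm) (fun i => (hd i).2.trans (hd (i + 1)).1.symm), fun n i j => ?_⟩
  refine hm n _ ?_ i
  rw [← (hd n).1]
  exact ⟨Pi.single j 1, by ext i; simp⟩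

section Dual

set_option linter.unusedSectionVars false

open MvPolynomial Matrix

variable {A M ι : Type} [CommRing A] [AddCommGroup M] [Module A M] [Fintype ι] [DecidableEq ι]
  {c : ℕ} {f : Fin c → A} {deg : ι → ℕ} {D : Matrix ι ι (MvPolynomial (Fin c) A)} {e : ι → M}

lemma IsCurvedRes.homotopy (h : IsCurvedRes f deg D e) (j : Fin c) :
    D.map (coeff 0) * D.map (coeff (Finsupp.single j 1)) +
      D.map (coeff (Finsupp.single j 1)) * D.map (coeff 0) = f j • (1 : Matrix ι ι A) := by
  have h1 := congrArg (fun X => X.map (coeff (Finsupp.single j 1))) h.sq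
  simp only [coeffMat_mul, coeff_curvature_smul_one] at h1
  rw [Finsupp.antidiagonal_single] at h1
  have h2 : coeff (Finsupp.single j 1) (curvature f) = f j := by
    rw [curvature, coeff_sum, Finset.sum_eq_single j]
    · simp
    · intro i _ hi
      rw [coeff_C_mul, coeff_X, if_neg, mul_zero]
      rw [Finsupp.single_left_inj one_ne_zero]
      exact hi
    · simp
  rw [h2] at h1
  rw [← h1]
  simp [Finset.Nat.antidiagonal_succ]

/-- Row vectors with entries in an ideal. -/
def vecIn (ι : Type) (I : Ideal A) : Submodule A (ι → A) := Submodule.pi Set.univ fun _ => I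

lemma mem_vecIn {ι : Type} {I : Ideal A} {v : ι → A} : v ∈ vecIn ι I ↔ ∀ i, v i ∈ I := by
  simp [vecIn, Submodule.mem_pi]

lemma vecIn_mono {ι : Type} {I J : Ideal A} (h : I ≤ J) : vecIn ι I ≤ vecIn ι J := fun _ hv =>
  mem_vecIn.mpr fun i => h (mem_vecIn.mp hv i)

lemma vecMul_mem_vecIn {I : Ideal A} {v : ι → A} (hv : v ∈ vecIn ι I) (X : Matrix ι ι A) :
    v ᵥ* X ∈ vecIn ι I :=
  mem_vecIn.mpr fun _ => Ideal.sum_mem _ fun i _ => Ideal.mul_mem_right _ _ (mem_vecIn.mp hv i)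

lemma smul_mem_vecIn {I : Ideal A} {a : A} (ha : a ∈ I) (v : ι → A) : a • v ∈ vecIn ι I :=
  mem_vecIn.mpr fun i => Ideal.mul_mem_right (v i) _ ha

lemma exists_sub_mem_vecIn (f : Fin c → A) (j : Fin c) {v : ι → A}
    (hv : v ∈ vecIn ι (initIdeal f (j.val + 1))) :
    ∃ y, v - f j • y ∈ vecIn ι (initIdeal f j.val) := by
  choose y hy using fun i => exists_sub_mem_initIdeal f j (mem_vecIn.mp hv i)
  exact ⟨y, mem_vecIn.mpr hy⟩

lemma RegularInit.vec (hf : RegularInit f) (j : Fin c) {v : ι → A}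
    (hv : f j • v ∈ vecIn ι (initIdeal f j.val)) : v ∈ vecIn ι (initIdeal f j.val) :=
  mem_vecIn.mpr fun i => hf j _ (mem_vecIn.mp hv i)

/-- The matrix of first order homotopies. -/
noncomputable def hmat (D : Matrix ι ι (MvPolynomial (Fin c) A)) (j : Fin c) : Matrix ι ι A :=
  D.map (coeff (Finsupp.single j 1))

/-- The constant term of the matrix `D`. -/
noncomputable def cmat (D : Matrix ι ι (MvPolynomial (Fin c) A)) : Matrix ι ι A :=
  D.map (coeff 0)

lemma IsCurvedRes.vecMul_hmat_cmat (h : IsCurvedRes f deg D e) (j : Fin c) (φ : ι → A) :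
    (φ ᵥ* hmat D j) ᵥ* cmat D = f j • φ - (φ ᵥ* cmat D) ᵥ* hmat D j := by
  rw [vecMul_vecMul, vecMul_vecMul, eq_sub_iff_add_eq, ← vecMul_add, add_comm]
  have := h.homotopy j
  rw [hmat, cmat, this, vecMul_smul, vecMul_one]

lemma IsCurvedRes.vecMul_cmat_cmat (h : IsCurvedRes f deg D e) (φ : ι → A) :
    (φ ᵥ* cmat D) ᵥ* cmat D = 0 := by
  have := h.res.sq
  rw [vecMul_vecMul, cmat, this, vecMul_zero]

lemma IsCurvedRes.vecMul_cmat_hmat (h : IsCurvedRes f deg D e) (j : Fin c) (φ : ι → A) :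
    (φ ᵥ* cmat D) ᵥ* hmat D j = f j • φ - (φ ᵥ* hmat D j) ᵥ* cmat D := by
  rw [h.vecMul_hmat_cmat]; abel

lemma IsCurvedRes.cocycle_hmat (h : IsCurvedRes f deg D e) (j : Fin c) {φ : ι → A}
    (hφ : φ ᵥ* cmat D ∈ vecIn ι (initIdeal f j.val)) :
    (φ ᵥ* hmat D j) ᵥ* cmat D ∈ vecIn ι (initIdeal f (j.val + 1)) := by
  rw [h.vecMul_hmat_cmat]
  exact Submodule.sub_mem _ (smul_mem_vecIn (mem_initIdeal f (Nat.lt_succ_self _)) _)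
    (vecIn_mono (initIdeal_mono f (Nat.le_succ _)) (vecMul_mem_vecIn hφ _))

lemma IsCurvedRes.coboundary_of_hmat (h : IsCurvedRes f deg D e) (hf : RegularInit f) (j : Fin c)
    {φ η : ι → A} (hφ : φ ᵥ* cmat D ∈ vecIn ι (initIdeal f j.val))
    (hη : φ ᵥ* hmat D j - η ᵥ* cmat D ∈ vecIn ι (initIdeal f (j.val + 1))) :
    ∃ θ, φ - θ ᵥ* cmat D ∈ vecIn ι (initIdeal f j.val) := by
  obtain ⟨θ, hθ⟩ := exists_sub_mem_vecIn f j hη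
  refine ⟨θ, hf.vec j ?_⟩
  have h1 := vecMul_mem_vecIn hθ (cmat D)
  rw [sub_vecMul, sub_vecMul, h.vecMul_hmat_cmat, h.vecMul_cmat_cmat, smul_vecMul] at h1
  have h2 := vecMul_mem_vecIn hφ (hmat D j)
  convert Submodule.add_mem _ h1 h2 using 1
  rw [smul_sub]
  abel

lemma IsCurvedRes.vecMul_hmat_ne_zero (h : IsCurvedRes f deg D e) (j : Fin c) {φ : ι → A} {b : ι}
    (hb : (φ ᵥ* hmat D j) b ≠ 0) : ∃ a, φ a ≠ 0 ∧ deg a = deg b + 1 := by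
  obtain ⟨a, -, ha⟩ := Finset.exists_ne_zero_of_sum_ne_zero hb
  refine ⟨a, left_ne_zero_of_mul ha, ?_⟩
  have := h.supp a b _ (right_ne_zero_of_mul ha)
  simp only [Finsupp.degree_single] at this
  omega

lemma IsCurvedRes.vecMul_cmat_ne_zero (h : IsCurvedRes f deg D e) {φ : ι → A} {b : ι}
    (hb : (φ ᵥ* cmat D) b ≠ 0) : ∃ a, φ a ≠ 0 ∧ deg b = deg a + 1 := by
  obtain ⟨a, -, ha⟩ := Finset.exists_ne_zero_of_sum_ne_zero hb
  refine ⟨a, left_ne_zero_of_mul ha, ?_⟩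
  have := h.supp a b _ (right_ne_zero_of_mul ha)
  simpa using this.symm

lemma IsCurvedRes.coboundary_of_low_degree (h : IsCurvedRes f deg D e) (hf : RegularInit f)
    (k : ℕ) : ∀ (j : ℕ) (_ : j + k = c) (φ : ι → A), (∀ a, φ a ≠ 0 → deg a < k) →
      φ ᵥ* cmat D ∈ vecIn ι (initIdeal f j) →
      ∃ θ, φ - θ ᵥ* cmat D ∈ vecIn ι (initIdeal f j) := by
  induction k with
  | zero =>
    intro j _ φ hφ _
    have : φ = 0 := by
      ext a
      by_contra h0
      exact absurd (hφ a h0) (by omega)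
    exact ⟨0, by simp [this]⟩
  | succ k ih =>
    intro j hj φ hφ hc
    let jj : Fin c := ⟨j, by omega⟩
    obtain ⟨η, hη⟩ := ih (j + 1) (by omega) (φ ᵥ* hmat D jj) (fun b hb => by
      obtain ⟨a, ha, hab⟩ := h.vecMul_hmat_ne_zero jj hb
      have := hφ a ha
      omega) (h.cocycle_hmat jj hc)
    exact h.coboundary_of_hmat hf jj hc hη

/-- The product of the first `j` homotopies. -/
noncomputable def umat (D : Matrix ι ι (MvPolynomial (Fin c) A)) (j : ℕ) : Matrix ι ι A :=
  Nat.rec 1 (fun j U => if hj : j < c then U * hmat D ⟨j, hj⟩ else U) j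

lemma umat_succ (D : Matrix ι ι (MvPolynomial (Fin c) A)) (j : Fin c) :
    umat D (j.val + 1) = umat D j.val * hmat D j := by
  change (if hj : j.val < c then umat D j.val * hmat D ⟨j.val, hj⟩ else umat D j.val) = _
  rw [dif_pos j.2]

lemma IsCurvedRes.umat_ne_zero (h : IsCurvedRes f deg D e) (j : ℕ) (hj : j ≤ c) :
    ∀ {a b : ι}, umat D j a b ≠ 0 → deg a = deg b + j := by
  induction j with
  | zero =>
    intro a b hab
    have : a = b := by
      by_contra h0
      exact hab (Matrix.one_apply_ne h0)
    rw [this]; rfl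
  | succ j ih =>
    intro a b hab
    rw [umat_succ D ⟨j, hj⟩] at hab
    obtain ⟨x, hx, hxb⟩ := h.vecMul_hmat_ne_zero ⟨j, hj⟩ (φ := umat D j a) (b := b) hab
    have := ih (by omega) hx
    omega

lemma IsCurvedRes.cocycle_umat (h : IsCurvedRes f deg D e) (j : ℕ) (hj : j ≤ c) {φ : ι → A}
    (hφ : φ ᵥ* cmat D = 0) : (φ ᵥ* umat D j) ᵥ* cmat D ∈ vecIn ι (initIdeal f j) := by
  induction j with
  | zero =>
    have : umat D 0 = 1 := rfl
    rw [this, vecMul_one, hφ]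
    exact Submodule.zero_mem _
  | succ j ih =>
    rw [umat_succ D ⟨j, hj⟩, ← vecMul_vecMul]
    exact h.cocycle_hmat ⟨j, hj⟩ (ih (by omega))

lemma IsCurvedRes.vecMul_cmat_umat (h : IsCurvedRes f deg D e) (j : ℕ) (hj : j ≤ c) (φ : ι → A) :
    ∃ η, (φ ᵥ* cmat D) ᵥ* umat D j - η ᵥ* cmat D ∈ vecIn ι (initIdeal f j) := by
  induction j with
  | zero =>
    have : umat D 0 = 1 := rfl
    exact ⟨φ, by rw [this, vecMul_one, sub_self]; exact Submodule.zero_mem _⟩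
  | succ j ih =>
    obtain ⟨η, hη⟩ := ih (by omega)
    let jj : Fin c := ⟨j, hj⟩
    refine ⟨- (η ᵥ* hmat D jj), ?_⟩
    have h1 := vecIn_mono (initIdeal_mono f (Nat.le_succ j)) (vecMul_mem_vecIn hη (hmat D jj))
    rw [sub_vecMul, h.vecMul_cmat_hmat] at h1
    have h2 := smul_mem_vecIn (mem_initIdeal f (Nat.lt_succ_self jj.val)) η
    rw [umat_succ D jj, ← vecMul_vecMul, neg_vecMul]
    convert Submodule.add_mem _ h1 h2 using 1
    abel

lemma IsCurvedRes.coboundary_of_umat (h : IsCurvedRes f deg D e) (hf : RegularInit f) (j : ℕ)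
    (hj : j ≤ c) {φ : ι → A} (hφ : φ ᵥ* cmat D = 0) :
    ∀ η, φ ᵥ* umat D j - η ᵥ* cmat D ∈ vecIn ι (initIdeal f j) → ∃ θ, θ ᵥ* cmat D = φ := by
  induction j with
  | zero =>
    intro η hη
    have : umat D 0 = 1 := rfl
    rw [this, vecMul_one, initIdeal_zero] at hη
    refine ⟨η, ?_⟩
    ext i
    exact (sub_eq_zero.mp (mem_vecIn.mp hη i)).symm
  | succ j ih =>
    intro η hη
    rw [umat_succ D ⟨j, hj⟩, ← vecMul_vecMul] at hη
    obtain ⟨θ, hθ⟩ := h.coboundary_of_hmat hf ⟨j, hj⟩ (h.cocycle_umat j (by omega) hφ) hη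
    exact ih (by omega) θ hθ

lemma IsCurvedRes.exists_umat (h : IsCurvedRes f deg D e) (hf : RegularInit f) (j : ℕ)
    (hj : j ≤ c) : ∀ θ : ι → A, (∀ a, θ a ≠ 0 → deg a + j ≤ c) →
      θ ᵥ* cmat D ∈ vecIn ι (initIdeal f j) →
      ∃ φ η, θ - φ ᵥ* umat D j - η ᵥ* cmat D ∈ vecIn ι (initIdeal f j) := by
  induction j with
  | zero =>
    intro θ _ _
    have : umat D 0 = 1 := rfl
    exact ⟨θ, 0, by rw [this, vecMul_one, sub_self, zero_vecMul, sub_zero]; exact Submodule.zero_mem _⟩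
  | succ j ih =>
    intro θ hθ hc
    let jj : Fin c := ⟨j, hj⟩
    have hI : vecIn ι (initIdeal f j) ≤ vecIn ι (initIdeal f (j + 1)) :=
      vecIn_mono (initIdeal_mono f (Nat.le_succ j))
    obtain ⟨φ', hφ'⟩ := exists_sub_mem_vecIn f jj hc
    classical
    let φ : ι → A := fun a => if deg a + j ≤ c then φ' a else 0
    have hφ : θ ᵥ* cmat D - f jj • φ ∈ vecIn ι (initIdeal f j) := by
      refine mem_vecIn.mpr fun a => ?_
      by_cases ha : deg a + j ≤ c
      · have := mem_vecIn.mp hφ' a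
        simpa [φ, ha] using this
      · have : (θ ᵥ* cmat D) a = 0 := by
          by_contra h0
          obtain ⟨b, hb, hab⟩ := h.vecMul_cmat_ne_zero h0
          have := hθ b hb
          omega
        simp [φ, ha, this]
    have hφs : ∀ a, φ a ≠ 0 → deg a + j ≤ c := by
      intro a ha
      by_contra h0
      exact ha (if_neg h0)
    have hφc : φ ᵥ* cmat D ∈ vecIn ι (initIdeal f j) := by
      apply hf.vec jj
      have := vecMul_mem_vecIn hφ (cmat D)
      rw [sub_vecMul, h.vecMul_cmat_cmat, zero_sub, smul_vecMul] at this
      exact (Submodule.neg_mem_iff _).mp this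
    obtain ⟨η, hη⟩ := h.coboundary_of_low_degree hf (c - j) j (by omega)
      (θ - φ ᵥ* hmat D jj) (fun a ha => by
        by_cases h0 : θ a = 0
        · have : (φ ᵥ* hmat D jj) a ≠ 0 := by
            intro h1
            apply ha
            rw [Pi.sub_apply, h0, h1, sub_zero]
          obtain ⟨b, hb, hab⟩ := h.vecMul_hmat_ne_zero jj this
          have := hφs b hb
          omega
        · have := hθ a h0
          omega) (by
        rw [sub_vecMul, h.vecMul_hmat_cmat]
        convert Submodule.add_mem _ hφ (vecMul_mem_vecIn hφc (hmat D jj)) using 1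
        abel)
    obtain ⟨ψ, η', hψ⟩ := ih (by omega) φ hφs hφc
    refine ⟨ψ, η - η' ᵥ* hmat D jj, ?_⟩
    have h1 := hI (vecMul_mem_vecIn hψ (hmat D jj))
    rw [sub_vecMul, sub_vecMul, h.vecMul_cmat_hmat] at h1
    have h2 := smul_mem_vecIn (mem_initIdeal f (Nat.lt_succ_self jj.val)) η'
    rw [umat_succ D jj, ← vecMul_vecMul, sub_vecMul]
    convert Submodule.add_mem _ (Submodule.add_mem _ h1 h2) (hI hη) using 1
    abel

lemma IsGradedRes.exists_functional {B : Type} [CommRing B] [Algebra A B] [Module B M]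
    [IsScalarTower A B M] (hsurj : Function.Surjective (algebraMap A B)) {d : Matrix ι ι A}
    (h : IsGradedRes deg d e) (t : ι → A) (ht : ∀ a, deg a ≠ 0 → algebraMap A B (t a) = 0)
    (htd : ∀ a, algebraMap A B ((t ᵥ* d) a) = 0) :
    ∃ g : M →ₗ[B] B, ∀ a, g (e a) = algebraMap A B (t a) := by
  classical
  let T : (ι → A) →ₗ[A] B := Fintype.linearCombination A fun a => algebraMap A B (t a)
  have hT : ∀ v, T v = algebraMap A B (t ⬝ᵥ v) := by
    intro v
    simp [T, Fintype.linearCombination_apply, dotProduct, Algebra.smul_def, mul_comm]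
  let p := Fintype.linearCombination A e
  have hp : Function.Surjective p := h.surj
  have hker : LinearMap.ker p ≤ LinearMap.ker T := by
    intro v hv
    let v₀ : ι → A := fun b => if deg b = 0 then v b else 0
    have h1 : p v₀ = p v := by
      simp only [p, Fintype.linearCombination_apply]
      refine Finset.sum_congr rfl fun b _ => ?_
      by_cases hb : deg b = 0
      · simp [v₀, hb]
      · rw [h.aug_eq_zero b hb, smul_zero, smul_zero]
    have h2 : d *ᵥ v₀ = 0 := by
      ext a
      refine Finset.sum_eq_zero fun b _ => ?_
      by_cases hd : d a b = 0
      · simp [hd]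
      · have := h.deg_eq a b hd
        simp [v₀, this]
    obtain ⟨u, hu⟩ := h.exact v₀ h2 (h1.trans hv)
    have h3 : T v = T v₀ := by
      simp only [T, Fintype.linearCombination_apply]
      refine Finset.sum_congr rfl fun b _ => ?_
      by_cases hb : deg b = 0
      · simp [v₀, hb]
      · rw [ht b hb, smul_zero, smul_zero]
    rw [LinearMap.mem_ker, h3, hT, ← hu, dotProduct_mulVec, dotProduct, map_sum]
    exact Finset.sum_eq_zero fun a _ => by rw [map_mul, htd, zero_mul]
  let E := LinearMap.quotKerEquivOfSurjective p hp
  let g : M →ₗ[A] B := ((LinearMap.ker p).liftQ T hker) ∘ₗ E.symm.toLinearMap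
  have hg : ∀ v, g (p v) = T v := by
    intro v
    have : E.symm (p v) = Submodule.Quotient.mk v := by
      rw [LinearEquiv.symm_apply_eq]; rfl
    simp only [g, LinearMap.comp_apply, LinearEquiv.coe_coe, this]
    exact Submodule.liftQ_apply _ _ _
  refine ⟨{ g with map_smul' := fun b m => ?_ }, fun a => ?_⟩
  · obtain ⟨a, rfl⟩ := hsurj b
    simp only [RingHom.id_apply, algebraMap_smul]
    exact g.map_smul a m
  · have : p (Pi.single a 1) = e a := by simp [p]
    change g (e a) = _
    rw [← this, hg, hT]
    simp

theorem IsCurvedRes.exists_dual {B : Type} [CommRing B] [Algebra A B] [Module B M]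
    [IsScalarTower A B M] (h : IsCurvedRes f deg D e) (hf : RegularInit f)
    (hsurj : Function.Surjective (algebraMap A B))
    (hker : RingHom.ker (algebraMap A B) = Ideal.span (Set.range f)) (hdeg : ∀ b, deg b ≤ c) :
    ∃ e' : ι → Module.Dual B M, IsCurvedRes f (fun b => c - deg b) Dᵀ e' := by
  classical
  have hk : ∀ x, x ∈ initIdeal f c ↔ algebraMap A B x = 0 := by
    intro x
    rw [initIdeal_self, ← hker, RingHom.mem_ker]
  have hU : ∀ {a b : ι}, umat D c a b ≠ 0 → deg a = c ∧ deg b = 0 := fun {a b} hab => by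
    have h1 := h.umat_ne_zero c le_rfl hab
    have h2 := hdeg a
    omega
  have hrow : ∀ φ : ι → A, (∀ a, φ a ≠ 0 → deg a = c) → φ ᵥ* cmat D = 0 := by
    intro φ hφ
    ext b
    by_contra h0
    obtain ⟨a, ha, hab⟩ := h.vecMul_cmat_ne_zero h0
    have h1 := hφ a ha
    have h2 := hdeg b
    omega
  have hex : ∀ b, ∃ g : M →ₗ[B] B, ∀ a, g (e a) = algebraMap A B (umat D c b a) := by
    intro b
    by_cases hb : deg b = c
    · refine h.res.exists_functional hsurj (umat D c b) (fun a ha => ?_) (fun a => ?_)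
      · have : umat D c b a = 0 := by
          by_contra h0
          exact ha (hU h0).2
        rw [this, map_zero]
      · have h1 := h.cocycle_umat c le_rfl (φ := Pi.single b 1) (hrow _ fun a ha => by
          by_cases hab : a = b
          · rw [hab, hb]
          · simp [hab] at ha)
        rw [single_one_vecMul] at h1
        exact (hk _).mp (mem_vecIn.mp h1 a)
    · refine ⟨0, fun a => ?_⟩
      have : umat D c b a = 0 := by
        by_contra h0
        exact hb (hU h0).1
      rw [this, map_zero, LinearMap.zero_apply]
  choose e' he' using hex
  have hlc : ∀ (φ : ι → A) a, Fintype.linearCombination A e' φ (e a) =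
      algebraMap A B ((φ ᵥ* umat D c) a) := by
    intro φ a
    rw [Fintype.linearCombination_apply, LinearMap.sum_apply, vecMul, dotProduct, map_sum]
    refine Finset.sum_congr rfl fun b _ => ?_
    rw [LinearMap.smul_apply, he', map_mul, Algebra.smul_def]
  have hext : ∀ g g' : Module.Dual B M, (∀ a, deg a = 0 → g (e a) = g' (e a)) → g = g' := by
    intro g g' hgg
    refine LinearMap.ext fun m => ?_
    obtain ⟨v, rfl⟩ := h.res.surj m
    rw [Fintype.linearCombination_apply, map_sum, map_sum]
    refine Finset.sum_congr rfl fun a _ => ?_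
    rw [← algebraMap_smul B (v a) (e a), map_smul, map_smul]
    by_cases ha : deg a = 0
    · rw [hgg a ha]
    · rw [h.res.aug_eq_zero a ha, map_zero, map_zero]
  have hcob : ∀ (η : ι → A) a, deg a = 0 → (η ᵥ* cmat D) a = 0 := by
    intro η a ha
    by_contra h0
    obtain ⟨b, -, hab⟩ := h.vecMul_cmat_ne_zero h0
    omega
  have hmap : Dᵀ.map (coeff 0) = (cmat D)ᵀ := rfl
  refine ⟨e', fun a b m hm => ?_, ?_, ?_⟩
  · have h1 := h.supp b a m hm
    have h2 := hdeg a
    have h3 := hdeg b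
    omega
  · rw [← transpose_mul, h.sq, transpose_smul, transpose_one]
  rw [hmap]
  refine ⟨fun a b hab => ?_, ?_, fun g => ?_, fun b hb => ?_, fun v => ?_, fun v hv hv' => ?_⟩
  · have h1 := h.res.deg_eq b a hab
    have h2 := hdeg a
    have h3 := hdeg b
    omega
  · rw [← transpose_mul]
    have := h.res.sq
    rw [cmat, this, transpose_zero]
  · choose t ht using fun a => hsurj (g (e a))
    let θ : ι → A := fun a => if deg a = 0 then t a else 0
    have hθ : ∀ a, algebraMap A B (θ a) = g (e a) := by
      intro a
      by_cases ha : deg a = 0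
      · simp [θ, ha, ht]
      · simp [θ, ha, h.res.aug_eq_zero a ha]
    have hθc : θ ᵥ* cmat D ∈ vecIn ι (initIdeal f c) := by
      refine mem_vecIn.mpr fun b => ?_
      rw [hk, vecMul, dotProduct, map_sum]
      have h1 := h.res.aug_d (Pi.single b 1)
      have h2 := congrArg g h1
      rw [map_zero, Fintype.linearCombination_apply, map_sum] at h2
      rw [← h2]
      refine Finset.sum_congr rfl fun a _ => ?_
      rw [← algebraMap_smul B _ (e a), map_smul, map_mul, hθ, smul_eq_mul, mul_comm]
      simp [cmat]
    obtain ⟨φ, η, hφ⟩ := h.exists_umat hf c le_rfl θ (fun a ha => by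
      have : deg a = 0 := by
        by_contra h0
        exact ha (if_neg h0)
      omega) hθc
    refine ⟨φ, hext _ _ fun a ha => ?_⟩
    have h1 := (hk _).mp (mem_vecIn.mp hφ a)
    rw [Pi.sub_apply, Pi.sub_apply, hcob η a ha, sub_zero, map_sub, sub_eq_zero, hθ] at h1
    rw [hlc, h1]
  · refine hext _ _ fun a _ => ?_
    rw [he']
    have : umat D c b a = 0 := by
      by_contra h0
      have := (hU h0).1
      omega
    rw [this, map_zero, LinearMap.zero_apply]
  · rw [mulVec_transpose]
    refine hext _ _ fun a ha => ?_
    obtain ⟨η, hη⟩ := h.vecMul_cmat_umat c le_rfl v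
    have h1 := (hk _).mp (mem_vecIn.mp hη a)
    rw [Pi.sub_apply, hcob η a ha, sub_zero] at h1
    rw [hlc, h1, LinearMap.zero_apply]
  · rw [mulVec_transpose] at hv
    obtain ⟨θ, hθ⟩ := h.coboundary_of_umat hf c le_rfl hv 0 (mem_vecIn.mpr fun a => by
      rw [zero_vecMul, sub_zero, hk, ← hlc, hv', LinearMap.zero_apply])
    exact ⟨θ, by rw [mulVec_transpose, hθ]⟩

end Dual

section RankBounds

set_option linter.unusedSectionVars false

open MvPolynomial

variable {k ι : Type} [Field k] [Fintype ι] {c : ℕ} {deg : ι → ℕ}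

/-- The rows of `E` indexed by `J` are linearly independent. -/
def RowsIndep {P : Type} [CommRing P] (E : Matrix ι ι P) (J : Finset ι) : Prop :=
  ∀ v : ι → P, (∀ b ∉ J, v b = 0) → Matrix.vecMul v E = 0 → v = 0

/-- The columns of `E` indexed by `J` determine the vanishing of a combination of rows. -/
def ColsGen {P : Type} [CommRing P] (E : Matrix ι ι P) (J : Finset ι) : Prop :=
  ∀ v : ι → P, (∀ b ∈ J, Matrix.vecMul v E b = 0) → Matrix.vecMul v E = 0

lemma exists_rowsIndep_colsGen {P : Type} [CommRing P] [IsDomain P] (E : Matrix ι ι P) :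
    ∃ J : Finset ι, RowsIndep E J ∧ ColsGen E.transpose J := by
  classical
  obtain ⟨J, hJ⟩ := (Set.toFinite {J : Finset ι | RowsIndep E J}).exists_maximal
    ⟨∅, fun v hv _ => funext fun b => hv b (Finset.notMem_empty b)⟩
  refine ⟨J, hJ.prop, fun w hw => funext fun i => ?_⟩
  by_cases hi : i ∈ J
  · exact hw i hi
  have hnot : ¬ RowsIndep E (insert i J) := fun h =>
    hi (hJ.le_of_ge h (Finset.subset_insert i J) (Finset.mem_insert_self i J))
  simp only [RowsIndep, not_forall] at hnot
  obtain ⟨v, hv, hvE, hv0⟩ := hnot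
  have hvi : v i ≠ 0 := fun h => hv0 (hJ.prop v (fun b hb => by
    by_cases hbi : b = i
    · rw [hbi, h]
    · exact hv b (by simp [hbi, hb])) hvE)
  have h1 : dotProduct v (Matrix.vecMul w E.transpose) = 0 := by
    rw [Matrix.vecMul_transpose, Matrix.dotProduct_mulVec, hvE, zero_dotProduct]
  rw [dotProduct, Finset.sum_eq_single i] at h1
  · exact (mul_eq_zero.mp h1).resolve_left hvi
  · intro b _ hb
    by_cases hbJ : b ∈ J
    · rw [hw b hbJ, mul_zero]
    · rw [hv b (by simp [hb, hbJ]), zero_mul]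
  · simp

/-- Extension by zero from a subset of the coordinates. -/
noncomputable def extendZero {P : Type} [CommRing P] (J : Finset ι) (v : J → P) : ι → P :=
  Function.extend Subtype.val v 0

lemma extendZero_apply {P : Type} [CommRing P] (J : Finset ι) (v : J → P) (b : J) :
    extendZero J v b = v b := Subtype.val_injective.extend_apply _ _ _

lemma extendZero_of_notMem {P : Type} [CommRing P] (J : Finset ι) (v : J → P) {b : ι}
    (hb : b ∉ J) : extendZero J v b = 0 :=
  Function.extend_apply' _ _ _ (by rintro ⟨a, rfl⟩; exact hb a.2)

lemma vecMul_submatrix {P : Type} [CommRing P] (E : Matrix ι ι P) (J J' : Finset ι)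
    (v : J → P) (b : J') :
    Matrix.vecMul v (E.submatrix Subtype.val Subtype.val) b =
      Matrix.vecMul (extendZero J v) E b := by
  classical
  simp only [Matrix.vecMul, dotProduct, Matrix.submatrix_apply]
  rw [← Finset.sum_subset (Finset.subset_univ J)
    (fun x _ hx => by rw [extendZero_of_notMem J v hx, zero_mul]), ← Finset.sum_coe_sort J]
  exact Finset.sum_congr rfl fun x _ => by rw [extendZero_apply]

lemma RowsIndep.submatrix {P : Type} [CommRing P] {E : Matrix ι ι P} {J J' : Finset ι}
    (h : RowsIndep E J) (h' : ColsGen E J') (v : J → P)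
    (hv : Matrix.vecMul v (E.submatrix (Subtype.val : J → ι) (Subtype.val : J' → ι)) = 0) :
    v = 0 := by
  have h1 : extendZero J v = 0 := h _ (fun b hb => extendZero_of_notMem J v hb) (h' _ fun b hb => by
    have := congrFun hv ⟨b, hb⟩
    rwa [vecMul_submatrix] at this)
  funext b
  rw [← extendZero_apply J v b, h1]
  rfl

lemma RowsIndep.card_le {P : Type} [CommRing P] [Nontrivial P] {E : Matrix ι ι P}
    {J J' : Finset ι} (h : RowsIndep E J) (h' : ColsGen E J') : J.card ≤ J'.card := by
  have := LinearMap.finrank_le_finrank_of_injective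
    (f := (E.submatrix (Subtype.val : J → ι) (Subtype.val : J' → ι)).vecMulLinear)
    ((injective_iff_map_eq_zero _).mpr fun v hv => h.submatrix h' v hv)
  simpa using this

lemma exists_rank_sets {P : Type} [CommRing P] [IsDomain P] (E : Matrix ι ι P) :
    ∃ J J' : Finset ι, J.card = J'.card ∧ RowsIndep E J ∧ ColsGen E J' ∧
      RowsIndep E.transpose J' ∧ ColsGen E.transpose J := by
  obtain ⟨J, h1, h2⟩ := exists_rowsIndep_colsGen E
  obtain ⟨J', h3, h4⟩ := exists_rowsIndep_colsGen E.transpose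
  rw [Matrix.transpose_transpose] at h4
  exact ⟨J, J', le_antisymm (h1.card_le h4) (h3.card_le h2), h1, h4, h3, h2⟩

/-- The polynomial vector with the given coefficients. -/
noncomputable def polyVec (deg : ι → ℕ) {c n : ℕ} (w : ShIdx deg c n → k) (b : ι) :
    MvPolynomial (Fin c) k :=
  open Classical in ∑ p : ShIdx deg c n, if p.1.1 = b then monomial p.1.2 (w p) else 0

lemma coeff_polyVec {n : ℕ} (w : ShIdx deg c n → k) (p : ShIdx deg c n) :
    coeff p.1.2 (polyVec deg w p.1.1) = w p := by
  classical
  rw [polyVec, coeff_sum, Finset.sum_eq_single p]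
  · simp
  · intro q _ hq
    split_ifs with h
    · rw [coeff_monomial, if_neg]
      intro h2
      exact hq (Subtype.ext (Prod.ext h h2))
    · simp
  · simp

lemma coeff_vecMul_polyVec {n : ℕ} (E : Matrix ι ι (MvPolynomial (Fin c) k))
    (w : ShIdx deg c n → k) (b : ι) (m : Fin c →₀ ℕ) :
    coeff m (Matrix.vecMul (polyVec deg w) E b) =
      ∑ p : ShIdx deg c n, w p * coeff m (E p.1.1 b * monomial p.1.2 1) := by
  classical
  simp only [Matrix.vecMul, dotProduct, polyVec, Finset.sum_mul, coeff_sum]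
  rw [Finset.sum_comm]
  refine Finset.sum_congr rfl fun p _ => ?_
  rw [Finset.sum_eq_single p.1.1]
  · rw [if_pos rfl, ← mul_one (w p), ← C_mul_monomial, mul_assoc, coeff_C_mul, mul_comm (monomial _ _),
      mul_one]
  · intro b' _ hb'
    rw [if_neg (Ne.symm hb'), zero_mul, coeff_zero]
  · simp

lemma coeff_vecMul_polyVec_eq {n : ℕ} (E : Matrix ι ι (MvPolynomial (Fin c) k))
    (w : ShIdx deg c n → k) (q : ShIdx deg c (n + 1)) :
    coeff q.1.2 (Matrix.vecMul (polyVec deg w) E q.1.1) =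
      Matrix.vecMul w (shMat k deg E n) q := by
  rw [coeff_vecMul_polyVec]
  rfl

lemma coeff_vecMul_polyVec_eq_zero {n : ℕ} {E : Matrix ι ι (MvPolynomial (Fin c) k)}
    (hE : ∀ a b m, (E a b).coeff m ≠ 0 → deg a + 1 = deg b + 2 * m.degree)
    (w : ShIdx deg c n → k) {b : ι} {m : Fin c →₀ ℕ} (h : deg b + 2 * m.degree ≠ n + 1) :
    coeff m (Matrix.vecMul (polyVec deg w) E b) = 0 := by
  rw [coeff_vecMul_polyVec]
  refine Finset.sum_eq_zero fun p _ => ?_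
  rw [coeff_mul_monomial']
  split_ifs with hle
  · by_contra hne
    have h1 := hE p.1.1 b (m - p.1.2) (fun h0 => hne (by rw [h0]; simp))
    have h2 : m.degree = (m - p.1.2).degree + p.1.2.degree := by
      rw [← map_add, tsub_add_cancel_of_le hle]
    have h3 := p.2
    omega
  · simp

/-- The number of basis elements in degree `n` lying over `J`. -/
noncomputable def shCount (deg : ι → ℕ) (c : ℕ) (J : Finset ι) (n : ℕ) : ℕ :=
  Nat.card {p : ShIdx deg c n // p.1.1 ∈ J}

lemma RowsIndep.shCount_le_rank {n : ℕ} {E : Matrix ι ι (MvPolynomial (Fin c) k)}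
    (hE : ∀ a b m, (E a b).coeff m ≠ 0 → deg a + 1 = deg b + 2 * m.degree) {J : Finset ι}
    (hJ : RowsIndep E J) : shCount deg c J n ≤ (shMat k deg E n).rank := by
  classical
  let S := {p : ShIdx deg c n // p.1.1 ∈ J}
  have hli : LinearIndependent k (fun p : S => (shMat k deg E n).row p.1) := by
    rw [Fintype.linearIndependent_iff]
    intro g hg
    let w : ShIdx deg c n → k := Function.extend Subtype.val g 0
    have hw : ∀ p : S, w p.1 = g p := fun p => Subtype.val_injective.extend_apply _ _ _
    have hw0 : ∀ p : ShIdx deg c n, p.1.1 ∉ J → w p = 0 := fun p hp =>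
      Function.extend_apply' _ _ _ (by rintro ⟨a, rfl⟩; exact hp a.2)
    have h1 : Matrix.vecMul w (shMat k deg E n) = 0 := by
      rw [← hg]
      funext q
      simp only [Matrix.vecMul, dotProduct, Finset.sum_apply, Pi.smul_apply, smul_eq_mul]
      rw [← Finset.sum_subset (Finset.subset_univ (Finset.univ.filter fun p : ShIdx deg c n => p.1.1 ∈ J))
        (fun x _ hx => by rw [hw0 x (by simpa using hx), zero_mul])]
      rw [Finset.sum_subtype (p := fun p : ShIdx deg c n => p.1.1 ∈ J) _ (by simp)]
      exact Finset.sum_congr rfl fun x _ => by rw [hw x]; rfl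
    have h2 : Matrix.vecMul (polyVec deg w) E = 0 := by
      funext b
      ext m
      by_cases h : deg b + 2 * m.degree = n + 1
      · rw [coeff_vecMul_polyVec_eq E w ⟨(b, m), h⟩, h1]; simp
      · rw [coeff_vecMul_polyVec_eq_zero hE w h]; simp
    have h3 := hJ (polyVec deg w) (fun b hb => Finset.sum_eq_zero fun p _ => by
      split_ifs with h
      · rw [hw0 p (h ▸ hb), monomial_zero]
      · rfl) h2
    intro p
    rw [← hw, ← coeff_polyVec w p.1, h3]
    simp
  have h4 := LinearIndependent.rank_matrix (M := (shMat k deg E n).submatrix (Subtype.val : S → _) id) hli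
  rw [shCount, Nat.card_eq_fintype_card]
  change Fintype.card S ≤ _
  rw [← h4, ← Matrix.rank_transpose, ← Matrix.rank_transpose (shMat k deg E n)]
  rw [Matrix.rank_eq_finrank_span_cols, Matrix.rank_eq_finrank_span_cols]
  refine Submodule.finrank_mono (Submodule.span_mono ?_)
  rintro _ ⟨p, rfl⟩
  exact ⟨p.1, rfl⟩

lemma ColsGen.rank_le_shCount {n : ℕ} {E : Matrix ι ι (MvPolynomial (Fin c) k)}
    (hE : ∀ a b m, (E a b).coeff m ≠ 0 → deg a + 1 = deg b + 2 * m.degree) {J : Finset ι}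
    (hJ : ColsGen E J) : (shMat k deg E n).rank ≤ shCount deg c J (n + 1) := by
  classical
  let S := {q : ShIdx deg c (n + 1) // q.1.1 ∈ J}
  rw [← Matrix.rank_transpose, Matrix.rank, shCount, Nat.card_eq_fintype_card]
  let res : (ShIdx deg c (n + 1) → k) →ₗ[k] (S → k) := LinearMap.funLeft k k Subtype.val
  have := LinearMap.finrank_le_finrank_of_injective
    (f := res.comp (LinearMap.range (shMat k deg E n).transpose.mulVecLin).subtype) (by
      rw [injective_iff_map_eq_zero]
      rintro ⟨_, w, rfl⟩ hw
      ext1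
      change (shMat k deg E n).transpose.mulVec w = 0
      have h0 : ∀ q : S, Matrix.vecMul w (shMat k deg E n) q.1 = 0 := fun q => by
        have := congrFun hw q
        rw [← Matrix.mulVec_transpose]
        exact this
      rw [Matrix.mulVec_transpose]
      have h1 := hJ (polyVec deg w) (fun b hb => by
        ext m
        by_cases h : deg b + 2 * m.degree = n + 1
        · rw [coeff_vecMul_polyVec_eq E w ⟨(b, m), h⟩, h0 ⟨⟨(b, m), h⟩, hb⟩]; simp
        · rw [coeff_vecMul_polyVec_eq_zero hE w h]; simp)
      funext q
      rw [← coeff_vecMul_polyVec_eq, h1]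
      simp)
  rw [Module.finrank_fintype_fun_eq_card] at this
  exact this

end RankBounds

section Reduction

open MvPolynomial

/-- Reduction of a polynomial matrix over `A` to the residue field of the local `A`-algebra `B`. -/
noncomputable def redMat {A ι : Type} [CommRing A] {c : ℕ} (B : Type) [CommRing B] [IsLocalRing B]
    [Algebra A B] (D : Matrix ι ι (MvPolynomial (Fin c) A)) :
    Matrix ι ι (MvPolynomial (Fin c) (ResidueField B)) :=
  D.map (MvPolynomial.map ((residue B).comp (algebraMap A B)))

variable {A B M ι : Type} [CommRing A] [CommRing B] [IsLocalRing B] [Algebra A B] [AddCommGroup M]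
  [Module A M] [Module B M] [IsScalarTower A B M] [Fintype ι] [DecidableEq ι]
  {c : ℕ} {f : Fin c → A} {deg : ι → ℕ} {D : Matrix ι ι (MvPolynomial (Fin c) A)} {e : ι → M}

lemma shMat_map_residue {A B ι : Type} [CommRing A] [CommRing B] [IsLocalRing B] [Algebra A B]
    [Fintype ι] {c : ℕ}
    (deg : ι → ℕ) (D : Matrix ι ι (MvPolynomial (Fin c) A)) (n : ℕ) :
    (shMat B deg D n).map (residue B) = shMat (ResidueField B) deg (redMat B D) n := by
  ext p q
  simp only [shMat, redMat, Matrix.map_apply, Matrix.of_apply, coeff_mul_monomial', coeff_map]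
  split_ifs <;> simp

lemma IsCurvedRes.redMat_supp (h : IsCurvedRes f deg D e) (B : Type) [CommRing B] [IsLocalRing B]
    [Algebra A B] (a b : ι) (m : Fin c →₀ ℕ)
    (hm : (redMat B D a b).coeff m ≠ 0) : deg a + 1 = deg b + 2 * m.degree := by
  refine h.supp a b m fun h0 => hm ?_
  simp [redMat, coeff_map, h0]

theorem IsCurvedRes.betti_add_rank (h : IsCurvedRes f deg D e) (hf : RegularInit f)
    (hsurj : Function.Surjective (algebraMap A B))
    (hker : RingHom.ker (algebraMap A B) = Ideal.span (Set.range f)) {β : ℕ → ℕ}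
    (hβ : IsMinRes B M β) (n : ℕ) :
    β (n + 1) + (shMat (ResidueField B) deg (redMat B D) n).rank +
      (shMat (ResidueField B) deg (redMat B D) (n + 1)).rank =
      shCount deg c Finset.univ (n + 1) := by
  obtain ⟨d, e', hd, hmin⟩ := hβ
  have := (h.isMatrixRes hf hsurj hker).betti_eq hd hmin n
  rw [shMat_map_residue, shMat_map_residue, Fintype.card_fin] at this
  rw [this, shCount, ← Nat.card_eq_fintype_card]
  exact Nat.card_congr (Equiv.subtypeUnivEquiv (by simp)).symm

end Reduction

section Counting

variable {ι : Type} [Fintype ι]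

/-- The number of monomials of degree `s` in `c` variables. -/
lemma card_degree_eq (c s : ℕ) :
    Nat.card {a : Fin (c + 1) →₀ ℕ // a.degree = s} = (s + c).choose c := by
  have h := Finset.card_finsuppAntidiag_nat_eq_choose (s := (Finset.univ : Finset (Fin (c + 1)))) (n := s)
  have h2 : ∀ a : Fin (c + 1) →₀ ℕ, a ∈ Finset.finsuppAntidiag Finset.univ s ↔ a.degree = s := by
    intro a
    rw [Finset.mem_finsuppAntidiag, Finsupp.degree_eq_sum]
    simp
  rw [← Nat.card_congr (Equiv.subtypeEquivRight h2)]
  rw [Nat.card_eq_fintype_card, Fintype.card_coe, h, add_comm s c]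
  simpa using (Nat.choose_symm_add (a := c) (b := s)).symm

lemma card_degree_shift (c d n : ℕ) :
    Nat.card {a : Fin (c + 1) →₀ ℕ // d + 2 * a.degree = n} =
      if d ≤ n ∧ n % 2 = d % 2 then ((n - d) / 2 + c).choose c else 0 := by
  split_ifs with h
  · rw [← card_degree_eq]
    exact Nat.card_congr (Equiv.subtypeEquivRight fun a => by omega)
  · have : IsEmpty {a : Fin (c + 1) →₀ ℕ // d + 2 * a.degree = n} :=
      ⟨fun a => h (by have := a.2; omega)⟩
    exact Nat.card_of_isEmpty

lemma shCount_eq_sum (deg : ι → ℕ) (c : ℕ) (J : Finset ι) (n : ℕ) :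
    shCount deg c J n = ∑ b ∈ J, Nat.card {a : Fin c →₀ ℕ // deg b + 2 * a.degree = n} := by
  classical
  let g : {p : ShIdx deg c n // p.1.1 ∈ J} ≃
      Σ b : J, {a : Fin c →₀ ℕ // deg b + 2 * a.degree = n} :=
    { toFun := fun p => ⟨⟨p.1.1.1, p.2⟩, ⟨p.1.1.2, p.1.2⟩⟩
      invFun := fun x => ⟨⟨(x.1.1, x.2.1), x.2.2⟩, x.1.2⟩
      left_inv := fun _ => rfl
      right_inv := fun _ => rfl }
  have hfin : ∀ b : J, Finite {a : Fin c →₀ ℕ // deg b + 2 * a.degree = n} := fun b =>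
    Finite.of_injective (fun a => (⟨(b.1, a.1), a.2⟩ : ShIdx deg c n)) fun x y h => by
      simpa [Subtype.ext_iff] using h
  rw [shCount, Nat.card_congr g, Nat.card_sigma, Finset.sum_coe_sort J
    (fun b => Nat.card {a : Fin c →₀ ℕ // deg b + 2 * a.degree = n})]

lemma tendsto_choose_div_pow (c C : ℕ) (g : ℕ → ℕ) (h1 : ∀ᶠ s in atTop, g s ≤ s + C)
    (h2 : ∀ᶠ s in atTop, s ≤ g s + C) :
    Tendsto (fun s => ((g s).choose c : ℝ) / (s : ℝ) ^ c) atTop (nhds (1 / c.factorial)) := by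
  have hg : Tendsto g atTop atTop := by
    refine tendsto_atTop_mono' atTop (f₁ := fun s => s - C) ?_ (tendsto_sub_atTop_nat C)
    filter_upwards [h2] with s hs
    omega
  have hratio : Tendsto (fun s => (g s : ℝ) / s) atTop (nhds 1) := by
    have hC : Tendsto (fun s : ℕ => (C : ℝ) / s) atTop (nhds 0) :=
      tendsto_const_div_atTop_nhds_zero_nat (C : ℝ)
    have hl : Tendsto (fun s : ℕ => 1 - (C : ℝ) / s) atTop (nhds 1) := by
      simpa using tendsto_const_nhds.sub hC
    have hu : Tendsto (fun s : ℕ => 1 + (C : ℝ) / s) atTop (nhds 1) := by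
      simpa using tendsto_const_nhds.add hC
    refine tendsto_of_tendsto_of_tendsto_of_le_of_le' hl hu ?_ ?_
    · filter_upwards [h2, eventually_gt_atTop 0] with s hs hs0
      have : (0 : ℝ) < s := by exact_mod_cast hs0
      have hs' : (s : ℝ) ≤ g s + C := by exact_mod_cast hs
      rw [← sub_nonneg]
      have : (g s : ℝ) / s - (1 - C / s) = (g s + C - s) / s := by field_simp; ring
      rw [this]
      apply div_nonneg <;> linarith
    · filter_upwards [h1, eventually_gt_atTop 0] with s hs hs0
      have : (0 : ℝ) < s := by exact_mod_cast hs0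
      have hs' : (g s : ℝ) ≤ s + C := by exact_mod_cast hs
      rw [← sub_nonneg]
      have : 1 + (C : ℝ) / s - g s / s = (s + C - g s) / s := by field_simp
      rw [this]
      apply div_nonneg <;> linarith
  have hch : Tendsto (fun m : ℕ => (m.choose c : ℝ) / (m : ℝ) ^ c) atTop
      (nhds (1 / c.factorial)) := by
    have h := (Asymptotics.isEquivalent_iff_tendsto_one (by
      filter_upwards [eventually_gt_atTop 0] with m hm
      have : (0 : ℝ) < m := by exact_mod_cast hm
      positivity)).mp (isEquivalent_choose c)
    have h' := h.mul_const (1 / (c.factorial : ℝ))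
    rw [one_mul] at h'
    refine h'.congr' ?_
    filter_upwards [eventually_gt_atTop 0] with m hm
    have : (0 : ℝ) < m := by exact_mod_cast hm
    have : (0 : ℝ) < c.factorial := by exact_mod_cast c.factorial_pos
    simp only [Pi.div_apply]
    field_simp
  have h3 := (hch.comp hg).mul (hratio.pow c)
  rw [one_pow, mul_one] at h3
  refine h3.congr' ?_
  filter_upwards [hg.eventually_gt_atTop 0, eventually_gt_atTop 0] with s hs hs0
  have : (0 : ℝ) < g s := by exact_mod_cast hs
  have : (0 : ℝ) < s := by exact_mod_cast hs0
  simp only [Function.comp]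
  rw [div_pow]
  field_simp

lemma tendsto_shCount (deg : ι → ℕ) (c : ℕ) (J : Finset ι) (ε : ℕ) :
    Tendsto (fun s : ℕ => (shCount deg (c + 1) J (2 * s + ε) : ℝ) / (s : ℝ) ^ c) atTop
      (nhds ((J.filter fun b => deg b % 2 = ε % 2).card / c.factorial)) := by
  have h : ∀ b, Tendsto (fun s : ℕ =>
      (Nat.card {a : Fin (c + 1) →₀ ℕ // deg b + 2 * a.degree = 2 * s + ε} : ℝ) / (s : ℝ) ^ c) atTop
      (nhds (if deg b % 2 = ε % 2 then 1 / c.factorial else 0)) := by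
    intro b
    split_ifs with hb
    · refine (tendsto_choose_div_pow c (deg b + c + ε) (fun s => (2 * s + ε - deg b) / 2 + c)
        (Eventually.of_forall fun s => ?_) ?_).congr' ?_
      · omega
      · filter_upwards with s
        omega
      · filter_upwards [eventually_ge_atTop (deg b)] with s hs
        rw [card_degree_shift, if_pos (by omega)]
    · refine tendsto_const_nhds.congr fun s => ?_
      rw [card_degree_shift, if_neg (by omega)]
      simp
  have h2 := tendsto_finsetSum J fun b _ => h b
  rw [← Finset.sum_filter, Finset.sum_const, nsmul_eq_mul, mul_one_div] at h2
  refine h2.congr fun s => ?_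
  rw [shCount_eq_sum, Nat.cast_sum, Finset.sum_div]

lemma tendsto_ennreal_div_pow {c : ℕ} {β : ℕ → ℕ} {l : ℝ} {ε : ℕ} (hε : 0 < ε)
    (h : Tendsto (fun s : ℕ => (β (2 * s + ε) : ℝ) / (s : ℝ) ^ c) atTop (nhds l)) :
    Tendsto (fun s : ℕ => (β (2 * s + ε) : ENNReal) / ((2 * s + ε : ℕ) : ENNReal) ^ c) atTop
      (nhds (ENNReal.ofReal (l / 2 ^ c))) := by
  have hr : Tendsto (fun s : ℕ => ((2 * s + ε : ℕ) : ℝ) / s) atTop (nhds 2) := by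
    have hC : Tendsto (fun s : ℕ => 2 + (ε : ℝ) / s) atTop (nhds 2) := by
      simpa using tendsto_const_nhds.add (tendsto_const_div_atTop_nhds_zero_nat (ε : ℝ))
    refine hC.congr' ?_
    filter_upwards [eventually_gt_atTop 0] with s hs0
    have : (0 : ℝ) < s := by exact_mod_cast hs0
    push_cast
    field_simp
  have h2 := ENNReal.tendsto_ofReal (h.div (hr.pow c) (by positivity))
  refine h2.congr' ?_
  filter_upwards [eventually_gt_atTop 0] with s hs0
  have hs : (0 : ℝ) < s := by exact_mod_cast hs0
  have hpos : (0 : ℝ) < ((2 * s + ε : ℕ) : ℝ) := by exact_mod_cast (by omega : 0 < 2 * s + ε)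
  have : (β (2 * s + ε) : ℝ) / (s : ℝ) ^ c / (((2 * s + ε : ℕ) : ℝ) / s) ^ c =
      (β (2 * s + ε) : ℝ) / ((2 * s + ε : ℕ) : ℝ) ^ c := by
    rw [div_pow]
    field_simp
  simp only [Pi.div_apply]
  rw [this, ENNReal.ofReal_div_of_pos (by positivity), ENNReal.ofReal_pow hpos.le,
    ENNReal.ofReal_natCast, ENNReal.ofReal_natCast]

lemma limsup_odd_even (u : ℕ → ENNReal) :
    limsup u atTop = max (limsup (fun s => u (2 * s + 1)) atTop)
      (limsup (fun s => u (2 * s + 2)) atTop) := by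
  have h : (atTop : Filter ℕ) = map (fun s => 2 * s + 1) atTop ⊔ map (fun s => 2 * s + 2) atTop := by
    refine le_antisymm ?_ (sup_le ?_ ?_)
    · intro S hS
      simp only [mem_sup, mem_map, mem_atTop_sets, Set.mem_preimage] at hS ⊢
      obtain ⟨⟨a, ha⟩, b, hb⟩ := hS
      refine ⟨2 * (a + b) + 2, fun n hn => ?_⟩
      obtain h | h := Nat.even_or_odd' n |>.choose_spec
      · have := hb (n / 2 - 1) (by omega)
        rwa [show 2 * (n / 2 - 1) + 2 = n by omega] at this
      · have := ha (n / 2) (by omega)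
        rwa [show 2 * (n / 2) + 1 = n by omega] at this
    · exact tendsto_atTop_mono (fun s => by simp only [id]; omega) tendsto_id
    · exact tendsto_atTop_mono (fun s => by simp only [id]; omega) tendsto_id
  conv_lhs => rw [h]
  rw [limsup_sup_filter]
  rfl

/-- The limit superior of a sequence growing like `n ^ c`, with possibly different leading
coefficients along odd and even indices. -/
lemma limsup_div_pow {c : ℕ} {β : ℕ → ℕ} {l₁ l₂ : ℝ}
    (h1 : Tendsto (fun s : ℕ => (β (2 * s + 1) : ℝ) / (s : ℝ) ^ c) atTop (nhds l₁))
    (h2 : Tendsto (fun s : ℕ => (β (2 * s + 2) : ℝ) / (s : ℝ) ^ c) atTop (nhds l₂))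
    (hpos : 0 < l₁ ∨ 0 < l₂) (N : ℕ) :
    limsup (fun i : ℕ => (β i : ENNReal) / (i : ENNReal) ^ N) atTop =
      if N < c then ⊤ else if N = c then
        max (ENNReal.ofReal (l₁ / 2 ^ c)) (ENNReal.ofReal (l₂ / 2 ^ c)) else 0 := by
  rw [limsup_odd_even]
  have h1' := tendsto_ennreal_div_pow one_pos h1
  have h2' := tendsto_ennreal_div_pow two_pos h2
  have hidx : ∀ ε : ℕ, Tendsto (fun s : ℕ => ((2 * s + ε : ℕ) : ENNReal)) atTop (nhds ⊤) := fun ε =>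
    ENNReal.tendsto_nat_nhds_top.comp (tendsto_atTop_mono (fun s => by simp only [id]; omega) tendsto_id)
  have hne : ∀ s ε : ℕ, 0 < ε → ((2 * s + ε : ℕ) : ENNReal) ≠ 0 := fun s ε h => by
    exact_mod_cast (by omega : 2 * s + ε ≠ 0)
  split_ifs with hN hN'
  · obtain ⟨t, rfl⟩ := Nat.exists_eq_add_of_lt hN
    have key : ∀ (ε : ℕ) (l : ℝ), 0 < ε → 0 < l →
        Tendsto (fun s : ℕ => (β (2 * s + ε) : ENNReal) / ((2 * s + ε : ℕ) : ENNReal) ^ (N + t + 1))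
          atTop (nhds (ENNReal.ofReal (l / 2 ^ (N + t + 1)))) →
        limsup (fun s : ℕ => (β (2 * s + ε) : ENNReal) / ((2 * s + ε : ℕ) : ENNReal) ^ N) atTop
          = ⊤ := by
      intro ε l hε hl h
      have h3 := ENNReal.Tendsto.mul h (Or.inl (ENNReal.ofReal_pos.mpr (by positivity)).ne')
        (ENNReal.Tendsto.pow (n := t + 1) (hidx ε)) (Or.inr ENNReal.ofReal_ne_top)
      rw [ENNReal.top_pow (by omega), ENNReal.mul_top (ENNReal.ofReal_pos.mpr (by positivity)).ne'] at h3
      refine (h3.congr fun s => ?_).limsup_eq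
      rw [add_assoc, pow_add, ENNReal.div_eq_inv_mul, ENNReal.div_eq_inv_mul, ENNReal.mul_inv
        (Or.inr (ENNReal.pow_ne_top (ENNReal.natCast_ne_top _)))
        (Or.inr (pow_ne_zero _ (hne s ε hε))), mul_assoc, mul_assoc, mul_comm (β _ : ENNReal),
        ← mul_assoc ((_ ^ (t + 1))⁻¹), ENNReal.inv_mul_cancel (pow_ne_zero _ (hne s ε hε))
        (ENNReal.pow_ne_top (ENNReal.natCast_ne_top _)), one_mul]
    rcases hpos with h | h
    · rw [key 1 l₁ one_pos h h1', max_eq_left le_top]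
    · rw [key 2 l₂ two_pos h h2', max_eq_right le_top]
  · subst hN'
    rw [h1'.limsup_eq, h2'.limsup_eq]
  · obtain ⟨t, rfl⟩ := Nat.exists_eq_add_of_lt (by omega : c < N)
    have key : ∀ (ε : ℕ) (l : ℝ), 0 < ε →
        Tendsto (fun s : ℕ => (β (2 * s + ε) : ENNReal) / ((2 * s + ε : ℕ) : ENNReal) ^ c)
          atTop (nhds (ENNReal.ofReal (l / 2 ^ c))) →
        limsup (fun s : ℕ => (β (2 * s + ε) : ENNReal) / ((2 * s + ε : ℕ) : ENNReal) ^ (c + t + 1))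
          atTop = 0 := by
      intro ε l hε h
      have h4 := tendsto_inv_iff.mpr (ENNReal.Tendsto.pow (n := t + 1) (hidx ε))
      rw [ENNReal.top_pow (by omega), ENNReal.inv_top] at h4
      have h3 := ENNReal.Tendsto.mul h (Or.inr (by simp)) h4 (Or.inr (by simp))
      rw [mul_zero] at h3
      refine (h3.congr fun s => ?_).limsup_eq
      rw [add_assoc c, pow_add _ c, div_eq_mul_inv, div_eq_mul_inv, ENNReal.mul_inv
        (Or.inr (ENNReal.pow_ne_top (ENNReal.natCast_ne_top _)))
        (Or.inr (pow_ne_zero _ (hne s ε hε))), mul_assoc]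
    rw [key 1 l₁ one_pos h1', key 2 l₂ two_pos h2', max_self]

end Counting

section Asymptotics

set_option linter.unusedSectionVars false

variable {A B M ι : Type} [CommRing A] [CommRing B] [IsLocalRing B] [Algebra A B] [AddCommGroup M]
  [Module A M] [Module B M] [IsScalarTower A B M] [Fintype ι] [DecidableEq ι]

lemma card_filter_parity (deg : ι → ℕ) (J : Finset ι) (ε : ℕ) :
    (J.filter fun b => deg b % 2 = ε % 2).card + (J.filter fun b => deg b % 2 = (ε + 1) % 2).card =
      J.card := by
  classical
  rw [← Finset.card_filter_add_card_filter_not (s := J) (fun b => deg b % 2 = ε % 2)]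
  congr 2
  ext b
  simp only [Finset.mem_filter]
  constructor <;> rintro ⟨h, h'⟩ <;> exact ⟨h, by omega⟩

/-- Betti numbers grow like a quasi-polynomial whose leading coefficients are differences between
the numbers of even or odd generators and the rank of the reduced matrix. -/
theorem IsCurvedRes.tendsto_betti {c : ℕ} {f : Fin (c + 1) → A} {deg : ι → ℕ}
    {D : Matrix ι ι (MvPolynomial (Fin (c + 1)) A)} {e : ι → M}
    (h : IsCurvedRes f deg D e) (hf : RegularInit f)
    (hsurj : Function.Surjective (algebraMap A B))
    (hker : RingHom.ker (algebraMap A B) = Ideal.span (Set.range f)) {β : ℕ → ℕ}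
    (hβ : IsMinRes B M β) {J J' : Finset ι} (hcard : J.card = J'.card)
    (hJ : RowsIndep (redMat B D) J) (hJ' : ColsGen (redMat B D) J') (ε : ℕ) :
    Tendsto (fun s : ℕ => (β (2 * s + (ε + 1)) : ℝ) / (s : ℝ) ^ c) atTop
      (nhds (((Finset.univ.filter fun b => deg b % 2 = (ε + 1) % 2).card - J.card : ℝ) /
        c.factorial)) := by
  have hb := h.betti_add_rank hf hsurj hker hβ
  have hlow := fun n => hJ.shCount_le_rank (n := n) (h.redMat_supp B)
  have hupp := fun n => hJ'.rank_le_shCount (n := n) (h.redMat_supp B)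
  have hJt := (tendsto_shCount deg c Finset.univ (ε + 1)).sub
    ((tendsto_shCount deg c J ε).add (tendsto_shCount deg c J (ε + 1)))
  have hJt' := (tendsto_shCount deg c Finset.univ (ε + 1)).sub
    ((tendsto_shCount deg c J' (ε + 1)).add (tendsto_shCount deg c J' (ε + 2)))
  have e1 := card_filter_parity deg J ε
  have e2 := card_filter_parity deg J' (ε + 1)
  rw [← add_div, ← sub_div] at hJt hJt'
  rw [show ((J.filter fun b => deg b % 2 = ε % 2).card : ℝ) +
    (J.filter fun b => deg b % 2 = (ε + 1) % 2).card = J.card by exact_mod_cast e1] at hJt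
  rw [show ((J'.filter fun b => deg b % 2 = (ε + 1) % 2).card : ℝ) +
    (J'.filter fun b => deg b % 2 = (ε + 2) % 2).card = J.card by
      rw [hcard]; exact_mod_cast e2] at hJt'
  refine tendsto_of_tendsto_of_tendsto_of_le_of_le hJt' hJt (fun s => ?_) (fun s => ?_)
  · rw [← add_div, ← sub_div]
    refine div_le_div_of_nonneg_right ?_ (by positivity)
    have h1 := hb (2 * s + ε)
    have h2 := hupp (2 * s + ε)
    have h3 : _ ≤ shCount deg (c + 1) J' (2 * s + ε + 2) := hupp (2 * s + ε + 1)
    have : (shCount deg (c + 1) Finset.univ (2 * s + (ε + 1))) ≤ β (2 * s + (ε + 1)) +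
      (shCount deg (c + 1) J' (2 * s + (ε + 1)) + shCount deg (c + 1) J' (2 * s + (ε + 2))) := by
      simp only [← add_assoc] at *
      omega
    have h4 := (Nat.cast_le (α := ℝ)).mpr this
    push_cast at h4
    linarith
  · rw [← add_div, ← sub_div]
    refine div_le_div_of_nonneg_right ?_ (by positivity)
    have h1 := hb (2 * s + ε)
    have h2 := hlow (2 * s + ε)
    have h3 := hlow (2 * s + ε + 1)
    have : β (2 * s + (ε + 1)) +
      (shCount deg (c + 1) J (2 * s + ε) + shCount deg (c + 1) J (2 * s + (ε + 1))) ≤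
      (shCount deg (c + 1) Finset.univ (2 * s + (ε + 1))) := by
      simp only [← add_assoc] at *
      omega
    have h4 := (Nat.cast_le (α := ℝ)).mpr this
    push_cast at h4
    linarith

/-- If the reduced matrix does not have full rank in both parities, the Betti numbers of a module
and of the module resolved by the transposed matrix have the same limits superior. -/
theorem IsCurvedRes.limsup_eq {M' : Type} [AddCommGroup M'] [Module A M'] [Module B M']
    [IsScalarTower A B M'] {c : ℕ} {f : Fin (c + 1) → A} {deg : ι → ℕ}
    {D : Matrix ι ι (MvPolynomial (Fin (c + 1)) A)} {e : ι → M} {e' : ι → M'}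
    (h : IsCurvedRes f deg D e) (hdeg : ∀ b, deg b ≤ c + 1)
    (h' : IsCurvedRes f (fun b => c + 1 - deg b) D.transpose e') (hf : RegularInit f)
    (hsurj : Function.Surjective (algebraMap A B))
    (hker : RingHom.ker (algebraMap A B) = Ideal.span (Set.range f)) {β β' : ℕ → ℕ}
    (hβ : IsMinRes B M β) (hβ' : IsMinRes B M' β') {J J' : Finset ι} (hcard : J.card = J'.card)
    (hJ : RowsIndep (redMat B D) J) (hJ' : ColsGen (redMat B D) J')
    (hJ2 : RowsIndep (redMat B D).transpose J') (hJ2' : ColsGen (redMat B D).transpose J)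
    (hne : ¬ ∀ ε, (Finset.univ.filter fun b => deg b % 2 = ε % 2).card = J.card) (N : ℕ) :
    limsup (fun i : ℕ => (β i : ENNReal) / (i : ENNReal) ^ N) atTop =
      limsup (fun i : ℕ => (β' i : ENNReal) / (i : ENNReal) ^ N) atTop := by
  have t1 := h.tendsto_betti hf hsurj hker hβ hcard hJ hJ' 0
  have t2 := h.tendsto_betti hf hsurj hker hβ hcard hJ hJ' 1
  have t1' := h'.tendsto_betti hf hsurj hker hβ' hcard.symm hJ2 hJ2' 0
  have t2' := h'.tendsto_betti hf hsurj hker hβ' hcard.symm hJ2 hJ2' 1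
  have hsw : ∀ ε, (Finset.univ.filter fun b => (c + 1 - deg b) % 2 = ε % 2) =
      (Finset.univ.filter fun b => deg b % 2 = (ε + (c + 1)) % 2) := fun ε => by
    ext b
    have := hdeg b
    simp only [Finset.mem_filter, Finset.mem_univ, true_and]
    omega
  have hmod : ∀ ε ε' : ℕ, ε % 2 = ε' % 2 → (Finset.univ.filter fun b => deg b % 2 = ε % 2) =
      (Finset.univ.filter fun b => deg b % 2 = ε' % 2) := fun ε ε' h => by rw [h]
  rw [hsw] at t1' t2'
  have hnn1 := ge_of_tendsto' t1 fun s => by positivity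
  have hnn2 := ge_of_tendsto' t2 fun s => by positivity
  have hpos : 0 < ((Finset.univ.filter fun b => deg b % 2 = (0 + 1) % 2).card - J.card : ℝ) /
        c.factorial ∨ 0 < ((Finset.univ.filter fun b => deg b % 2 = (1 + 1) % 2).card - J.card : ℝ) /
        c.factorial := by
    by_contra! hcon
    have hfac : (0 : ℝ) < c.factorial := by exact_mod_cast c.factorial_pos
    have z1 := le_antisymm hcon.1 hnn1
    have z2 := le_antisymm hcon.2 hnn2
    rw [div_eq_zero_iff, or_iff_left hfac.ne', sub_eq_zero] at z1 z2
    refine hne fun ε => ?_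
    rcases Nat.even_or_odd' ε with ⟨t, rfl | rfl⟩
    · rw [hmod _ (1 + 1) (by omega)]; exact_mod_cast z2
    · rw [hmod _ (0 + 1) (by omega)]; exact_mod_cast z1
  rw [limsup_div_pow t1 t2 hpos]
  rw [← hcard] at t1' t2'
  rcases Nat.even_or_odd' (c + 1) with ⟨t, ht | ht⟩
  · rw [hmod _ (0 + 1) (by omega)] at t1'
    rw [hmod _ (1 + 1) (by omega)] at t2'
    rw [limsup_div_pow t1' t2' hpos]
  · rw [hmod _ (1 + 1) (by omega)] at t1'
    rw [hmod _ (0 + 1) (by omega)] at t2'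
    rw [limsup_div_pow t1' t2' hpos.symm, max_comm]

end Asymptotics

section RegularInit

open RingTheory.Sequence

variable {A : Type} [CommRing A] {c : ℕ}

lemma ofList_take_ofFn (f : Fin c → A) (i : ℕ) :
    Ideal.ofList ((List.ofFn f).take i) = initIdeal f i := by
  rw [Ideal.ofList, initIdeal]
  congr 1
  ext x
  simp only [Set.mem_ofPred_eq, Set.mem_image, List.mem_take_iff_getElem, List.getElem_ofFn]
  constructor
  · rintro ⟨j, hj, rfl⟩
    simp only [List.length_ofFn] at hj
    exact ⟨⟨j, by omega⟩, by simp; omega, rfl⟩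
  · rintro ⟨j, hj, rfl⟩
    exact ⟨j, by simp; omega, rfl⟩

lemma regularInit_iff (f : Fin c → A) : RegularInit f ↔ IsWeaklyRegular A (List.ofFn f) := by
  rw [isWeaklyRegular_iff]
  have h : ∀ i (x : A), IsSMulRegular
      (A ⧸ (Ideal.ofList ((List.ofFn f).take i) • ⊤ : Submodule A A)) x ↔
      ∀ a, x * a ∈ initIdeal f i → a ∈ initIdeal f i := by
    intro i x
    rw [isSMulRegular_quotient_iff_mem_of_smul_mem, ofList_take_ofFn, smul_eq_mul, Ideal.mul_top]
    rfl
  simp only [h, List.getElem_ofFn]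
  constructor
  · intro hf i hi
    exact hf ⟨i, by simpa using hi⟩
  · intro hf i
    exact hf i (by simp)

lemma RegularInit.snoc {f : Fin (c + 1) → A} (h : RegularInit f) {x u : A} (hu : IsUnit u)
    (hx : x - u * f (Fin.last c) ∈ initIdeal f c) :
    RegularInit (Fin.snoc (fun i : Fin c => f i.castSucc) x : Fin (c + 1) → A) := by
  have hI : ∀ j, j ≤ c → initIdeal (Fin.snoc (fun i : Fin c => f i.castSucc) x : Fin (c + 1) → A) j =
      initIdeal f j := by
    intro j hj
    rw [initIdeal, initIdeal]
    congr 1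
    refine Set.image_congr fun i hi => ?_
    obtain ⟨i', rfl⟩ : ∃ i' : Fin c, i = i'.castSucc := ⟨⟨i, by simp at hi; omega⟩, rfl⟩
    simp
  intro i a ha
  rw [hI _ (by omega)] at ha ⊢
  induction i using Fin.lastCases with
  | last =>
    rw [Fin.snoc_last, Fin.val_last] at ha
    refine h _ a ?_
    have h1 : u * (f (Fin.last c) * a) ∈ initIdeal f c := by
      have := Ideal.sub_mem _ ha (Ideal.mul_mem_right a _ hx)
      convert this using 1
      ring
    obtain ⟨v, rfl⟩ := hu
    have := Ideal.mul_mem_left _ (↑v⁻¹) h1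
    rwa [← mul_assoc, Units.inv_mul, one_mul] at this
  | cast i =>
    rw [Fin.snoc_castSucc] at ha
    exact h _ a ha

lemma RegularInit.cons_of_snoc [IsLocalRing A] [IsNoetherianRing A] {g : Fin c → A} {x : A}
    (h : RegularInit (Fin.snoc g x : Fin (c + 1) → A)) (hg : ∀ i, g i ∈ maximalIdeal A)
    (hx : x ∈ maximalIdeal A) : RegularInit (Fin.cons x g : Fin (c + 1) → A) := by
  rw [regularInit_iff] at h ⊢
  refine IsLocalRing.isWeaklyRegular_of_perm_of_subset_maximalIdeal h ?_ ?_
  · rw [List.ofFn_succ', List.ofFn_succ]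
    simp only [Fin.snoc_castSucc, Fin.snoc_last, Fin.cons_zero, Fin.cons_succ]
    rw [List.concat_eq_append]
    exact List.perm_append_comm
  · intro r hr
    rw [List.mem_ofFn] at hr
    obtain ⟨i, rfl⟩ := hr
    induction i using Fin.lastCases with
    | last => simpa using hx
    | cast i => simpa using hg i

lemma RegularInit.quotient_of_cons {g : Fin c → A} {x : A}
    (h : RegularInit (Fin.cons x g : Fin (c + 1) → A)) :
    RegularInit (fun i => Ideal.Quotient.mk (Ideal.span {x}) (g i)) := by
  have hI : ∀ j a, Ideal.Quotient.mk (Ideal.span {x}) a ∈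
      initIdeal (fun i => Ideal.Quotient.mk (Ideal.span {x}) (g i)) j ↔
      a ∈ initIdeal (Fin.cons x g : Fin (c + 1) → A) (j + 1) := by
    intro j a
    have h1 : initIdeal (Fin.cons x g : Fin (c + 1) → A) (j + 1) =
        initIdeal g j ⊔ RingHom.ker (Ideal.Quotient.mk (Ideal.span {x})) := by
      rw [Ideal.mk_ker, initIdeal, initIdeal, ← Ideal.span_union]
      congr 1
      ext y
      simp only [Set.mem_image, Set.mem_ofPred_eq, Set.mem_union, Set.mem_singleton_iff,
        Fin.exists_fin_succ, Fin.cons_zero, Fin.cons_succ, Fin.val_zero, Fin.val_succ,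
        add_lt_add_iff_right]
      constructor
      · rintro (⟨-, h⟩ | h)
        · exact Or.inr h.symm
        · exact Or.inl h
      · rintro (h | h)
        · exact Or.inr h
        · exact Or.inl ⟨by omega, h.symm⟩
    have h2 : initIdeal (fun i => Ideal.Quotient.mk (Ideal.span {x}) (g i)) j =
        (initIdeal g j).map (Ideal.Quotient.mk (Ideal.span {x})) := by
      rw [initIdeal, initIdeal, Ideal.map_span, Set.image_image]
    rw [h1, h2, ← Ideal.mem_comap, Ideal.comap_map_of_surjective' _ Ideal.Quotient.mk_surjective]
  intro i a ha
  obtain ⟨a, rfl⟩ := Ideal.Quotient.mk_surjective a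
  rw [← map_mul, hI] at ha
  rw [hI]
  exact h i.succ a ha

end RegularInit

section Specialize

set_option linter.unusedSectionVars false

open MvPolynomial

variable {A M ι : Type} [CommRing A] [AddCommGroup M] [Module A M] [Fintype ι] [DecidableEq ι]
  {c : ℕ}

/-- Restriction of polynomials to the line through the origin and `l`. -/
noncomputable def lineMap (l : Fin c → A) : MvPolynomial (Fin c) A →+* MvPolynomial (Fin 1) A :=
  (aeval fun j => C (l j) * X 0 : MvPolynomial (Fin c) A →ₐ[A] MvPolynomial (Fin 1) A).toRingHom

lemma lineMap_C (l : Fin c → A) (a : A) : lineMap l (C a) = C a := by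
  simp [lineMap, algebraMap_eq]

lemma lineMap_X (l : Fin c → A) (j : Fin c) : lineMap l (X j) = C (l j) * X 0 := by
  simp [lineMap]

lemma lineMap_monomial (l : Fin c → A) (m : Fin c →₀ ℕ) (a : A) :
    lineMap l (monomial m a) = monomial (Finsupp.single 0 m.degree) (a * ∏ j, l j ^ m j) := by
  rw [monomial_eq, Finsupp.prod_fintype _ _ (by simp), map_mul, map_prod, lineMap_C]
  simp only [map_pow, lineMap_X, mul_pow, Finset.prod_mul_distrib, Finset.prod_pow_eq_pow_sum]
  rw [← Finsupp.degree_eq_sum, X_pow_eq_monomial]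
  simp only [← C_pow, ← map_prod]
  rw [C_mul_monomial, C_mul_monomial, mul_one]

lemma exists_coeff_of_lineMap (l : Fin c → A) (p : MvPolynomial (Fin c) A) (m : Fin 1 →₀ ℕ)
    (h : coeff m (lineMap l p) ≠ 0) : ∃ m', coeff m' p ≠ 0 ∧ m'.degree = m.degree := by
  rw [p.as_sum, map_sum, coeff_sum] at h
  obtain ⟨m', hm', hne⟩ := Finset.exists_ne_zero_of_sum_ne_zero h
  refine ⟨m', mem_support_iff.mp hm', ?_⟩
  rw [lineMap_monomial, coeff_monomial] at hne
  have : Finsupp.single 0 m'.degree = m := by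
    by_contra h0
    simp [h0] at hne
  rw [← this]
  simp

lemma coeff_zero_lineMap (l : Fin c → A) (p : MvPolynomial (Fin c) A) :
    coeff 0 (lineMap l p) = coeff 0 p := by
  have : (constantCoeff.comp (lineMap l) : MvPolynomial (Fin c) A →+* A) = constantCoeff := by
    refine ringHom_ext (fun a => ?_) (fun j => ?_)
    · simp [lineMap_C]
    · simp [lineMap_X]
  exact congrArg (fun g => g p) this

lemma lineMap_curvature (l f : Fin c → A) :
    lineMap l (curvature f) = curvature (fun _ : Fin 1 => ∑ j, l j * f j) := by
  simp only [curvature, map_sum, map_mul, lineMap_C, lineMap_X, Finset.univ_unique,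
    Finset.sum_singleton, Fin.default_eq_zero, Finset.sum_mul]
  exact Finset.sum_congr rfl fun j _ => by ring

lemma IsCurvedRes.restrictLine {f : Fin c → A} {deg : ι → ℕ}
    {D : Matrix ι ι (MvPolynomial (Fin c) A)} {e : ι → M} (h : IsCurvedRes f deg D e)
    (l : Fin c → A) :
    IsCurvedRes (fun _ : Fin 1 => ∑ j, l j * f j) deg (D.map (lineMap l)) e where
  supp a b m hm := by
    obtain ⟨m', h1, h2⟩ := exists_coeff_of_lineMap l _ m hm
    rw [← h2]
    exact h.supp a b m' h1
  sq := by
    rw [← Matrix.map_mul, h.sq, ← lineMap_curvature]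
    ext1 a b
    by_cases hab : a = b <;> simp [hab]
  res := by
    have : (D.map (lineMap l)).map (coeff 0) = D.map (coeff 0) := by
      ext1 a b
      simp [coeff_zero_lineMap]
    rw [this]
    exact h.res

lemma map_lineMap {k : Type} [CommRing k] (ρ : A →+* k) (l : Fin c → A)
    (p : MvPolynomial (Fin c) A) :
    MvPolynomial.map ρ (lineMap l p) = lineMap (fun j => ρ (l j)) (MvPolynomial.map ρ p) := by
  have : (MvPolynomial.map ρ).comp (lineMap l) =
      (lineMap fun j => ρ (l j)).comp (MvPolynomial.map ρ) := by
    refine ringHom_ext (fun a => ?_) (fun j => ?_)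
    · simp [lineMap_C]
    · simp [lineMap_X]
  exact congrArg (fun g => g p) this

lemma eval_one_lineMap (l : Fin c → A) (p : MvPolynomial (Fin c) A) :
    eval (fun _ => 1) (lineMap l p) = eval l p := by
  have : (eval (fun _ => (1 : A))).comp (lineMap l) = eval l := by
    refine ringHom_ext (fun a => ?_) (fun j => ?_)
    · simp [lineMap_C]
    · simp [lineMap_X]
  exact congrArg (fun g => g p) this

lemma rowsIndep_of_det_ne_zero {P : Type} [CommRing P] [IsDomain P] {E : Matrix ι ι P}
    {J J' : Finset ι} (σ : J ≃ J')
    (h : (E.submatrix (Subtype.val : J → ι) (fun b => (σ b).val)).det ≠ 0) : RowsIndep E J := by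
  intro v hv hE
  have h1 : (fun b : J => v b) = 0 := by
    refine Matrix.eq_zero_of_vecMul_eq_zero h (funext fun b => ?_)
    have h2 := congrFun hE (σ b).val
    simp only [Matrix.vecMul, dotProduct, Matrix.submatrix_apply] at h2 ⊢
    rw [← Finset.sum_subset (Finset.subset_univ J)
      (fun x _ hx => by rw [hv x hx, zero_mul]), ← Finset.sum_coe_sort J] at h2
    exact h2
  funext b
  by_cases hb : b ∈ J
  · exact congrFun h1 ⟨b, hb⟩
  · exact hv b hb

lemma exists_line {k : Type} [Field k] [Infinite k] {E : Matrix ι ι (MvPolynomial (Fin (c + 1)) k)}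
    {J J' : Finset ι} (hcard : J.card = J'.card) (hJ : RowsIndep E J) (hJ' : ColsGen E J') :
    ∃ l : Fin (c + 1) → k, l (Fin.last c) ≠ 0 ∧ RowsIndep (E.map (lineMap l)) J := by
  let σ : J ≃ J' := Finset.equivOfCardEq hcard
  let F := E.submatrix (Subtype.val : J → ι) (fun b => (σ b).val)
  have hdet : F.det ≠ 0 := by
    intro h0
    obtain ⟨v, hv, hvF⟩ := Matrix.exists_vecMul_eq_zero_iff.mpr h0
    refine hv (hJ.submatrix hJ' v (funext fun b => ?_))
    have := congrFun hvF (σ.symm b)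
    simpa [F, Matrix.vecMul, dotProduct] using this
  have hne : F.det * X (Fin.last c) ≠ 0 := mul_ne_zero hdet (X_ne_zero _)
  obtain ⟨l, hl⟩ : ∃ l, eval l (F.det * X (Fin.last c)) ≠ 0 := by
    by_contra! hcon
    exact hne (MvPolynomial.funext fun x => by rw [hcon, map_zero])
  rw [map_mul, eval_X] at hl
  refine ⟨l, right_ne_zero_of_mul hl, rowsIndep_of_det_ne_zero σ fun h0 => left_ne_zero_of_mul hl ?_⟩
  have h1 : lineMap l F.det = 0 := by
    rw [RingHom.map_det, ← h0]
    rfl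
  rw [← eval_one_lineMap, h1, map_zero]

lemma RowsIndep.of_map {P Q : Type} [CommRing P] [CommRing Q] {φ : P →+* Q}
    (hφ : Function.Injective φ) {E : Matrix ι ι P} {J : Finset ι} (h : RowsIndep (E.map φ) J) :
    RowsIndep E J := by
  intro v hv hE
  have h1 := h (fun b => φ (v b)) (fun b hb => by rw [hv b hb, map_zero]) (by
    funext b
    have := congrArg φ (congrFun hE b)
    simpa [Matrix.vecMul, dotProduct] using this)
  funext b
  exact hφ (by rw [congrFun h1 b]; simp)

end Specialize

section Induction

lemma shCount_one {ι : Type} [Fintype ι] (deg : ι → ℕ) (J : Finset ι) {n : ℕ} (hn : ∀ b, deg b ≤ n) :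
    shCount deg 1 J n = (J.filter fun b => deg b % 2 = n % 2).card := by
  rw [shCount_eq_sum, Finset.card_filter]
  refine Finset.sum_congr rfl fun b _ => ?_
  rw [card_degree_shift 0]
  have := hn b
  simp [this, eq_comm]

lemma IsCurvedRes.projDimLE_of_parity {A Q M ι : Type} [CommRing A] [CommRing Q] [IsLocalRing Q]
    [IsNoetherianRing Q] [Algebra A Q] [AddCommGroup M] [Module A M] [Module Q M]
    [IsScalarTower A Q M] [Module.Finite Q M] [Fintype ι] [DecidableEq ι] {g : Fin 1 → A}
    {deg : ι → ℕ} {D : Matrix ι ι (MvPolynomial (Fin 1) A)} {e : ι → M}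
    (h : IsCurvedRes g deg D e) (hg : RegularInit g)
    (hsurj : Function.Surjective (algebraMap A Q))
    (hker : RingHom.ker (algebraMap A Q) = Ideal.span (Set.range g)) {J : Finset ι}
    (hJ : RowsIndep (redMat Q D) J)
    (hpar : ∀ ε, (Finset.univ.filter fun b => deg b % 2 = ε % 2).card = J.card) :
    ∃ m, ProjDimLE Q M m := by
  obtain ⟨β, hβ⟩ := exists_isMinRes Q M
  let n := Finset.univ.sup deg
  have hn : ∀ b, deg b ≤ n := fun b => Finset.le_sup (Finset.mem_univ b)
  have h1 := h.betti_add_rank hg hsurj hker hβ n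
  have h2 := hJ.shCount_le_rank (n := n) (h.redMat_supp Q)
  have h3 := hJ.shCount_le_rank (n := n + 1) (h.redMat_supp Q)
  rw [shCount_one deg J hn] at h2
  have hn' : ∀ b, deg b ≤ n + 1 := fun b => (hn b).trans n.le_succ
  rw [shCount_one deg J hn'] at h3
  rw [shCount_one deg _ hn', hpar] at h1
  have h4 := card_filter_parity deg J n
  have h5 : β (n + 1) = 0 := by omega
  obtain ⟨d, e', hd, -⟩ := hβ
  exact ⟨n + 1, hd.projDimLE (n + 1) (by rw [h5]; infer_instance)⟩

/-- Over an infinite residue field, a module with too few independent relations has finite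
projective dimension over a hypersurface containing the complete intersection. -/
lemma exists_hypersurface {A B M ι : Type} [CommRing A] [IsLocalRing A] [IsNoetherianRing A]
    [CommRing B] [IsLocalRing B] [Algebra A B] [AddCommGroup M] [Module A M] [Module B M]
    [IsScalarTower A B M] [Module.Finite B M] [Infinite (ResidueField B)] [Fintype ι]
    [DecidableEq ι] {c : ℕ} {f : Fin (c + 1) → A} (hfm : ∀ i, f i ∈ maximalIdeal A)
    (hf : RegularInit f) (hsurj : Function.Surjective (algebraMap A B))
    (hker : RingHom.ker (algebraMap A B) = Ideal.span (Set.range f)) {deg : ι → ℕ}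
    {D : Matrix ι ι (MvPolynomial (Fin (c + 1)) A)} {e : ι → M} (h : IsCurvedRes f deg D e)
    {J J' : Finset ι} (hcard : J.card = J'.card) (hJ : RowsIndep (redMat B D) J)
    (hJ' : ColsGen (redMat B D) J')
    (hpar : ∀ ε, (Finset.univ.filter fun b => deg b % 2 = ε % 2).card = J.card) :
    ∃ (Q : Type) (_ : CommRing Q) (_ : IsLocalRing Q) (_ : IsNoetherianRing Q) (_ : Algebra Q B)
      (_ : Module Q M) (_ : IsScalarTower Q B M) (g : Fin c → Q),
      (∀ i, g i ∈ maximalIdeal Q) ∧ RegularInit g ∧ Function.Surjective (algebraMap Q B) ∧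
      RingHom.ker (algebraMap Q B) = Ideal.span (Set.range g) ∧ ∃ m, ProjDimLE Q M m := by
  obtain ⟨l, hl0, hlJ⟩ := exists_line hcard hJ hJ'
  have hres : Function.Surjective ((residue B).comp (algebraMap A B)) := by
    rw [RingHom.coe_comp]
    exact residue_surjective.comp hsurj
  choose L hL using fun j => hres (l j)
  have hloc : IsLocalHom (algebraMap A B) := hsurj.isLocalHom
  have hunit : IsUnit (L (Fin.last c)) := by
    have h1 : IsUnit (algebraMap A B (L (Fin.last c))) := by
      rw [← residue_ne_zero_iff_isUnit]
      have := hL (Fin.last c)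
      simp only [RingHom.comp_apply] at this
      rwa [this]
    exact isUnit_of_map_unit _ _ h1
  let x : A := ∑ j, L j * f j
  have hxm : x ∈ maximalIdeal A := Ideal.sum_mem _ fun j _ => Ideal.mul_mem_left _ _ (hfm j)
  have hxs : x - L (Fin.last c) * f (Fin.last c) ∈ initIdeal f c := by
    simp only [x]
    rw [Fin.sum_univ_castSucc, add_sub_cancel_right]
    exact Ideal.sum_mem _ fun j _ => Ideal.mul_mem_left _ _ (mem_initIdeal f (by simp))
  have hcons : RegularInit (Fin.cons x (fun i : Fin c => f i.castSucc) : Fin (c + 1) → A) :=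
    (hf.snoc hunit hxs).cons_of_snoc (fun i => hfm _) hxm
  have hx0 : algebraMap A B x = 0 := by
    rw [← RingHom.mem_ker, hker]
    exact Ideal.sum_mem _ fun j _ => Ideal.mul_mem_left _ _ (Ideal.subset_span ⟨j, rfl⟩)
  let I : Ideal A := Ideal.span {x}
  let Q : Type := A ⧸ I
  have hIm : I ≤ maximalIdeal A := (Ideal.span_singleton_le_iff_mem _).mpr hxm
  have hnt : Nontrivial Q := Ideal.Quotient.nontrivial_iff.mpr
    (ne_top_of_le_ne_top (maximalIdeal.isMaximal A).ne_top hIm)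
  have hQl : IsLocalRing Q := IsLocalRing.of_surjective' (Ideal.Quotient.mk I) Ideal.Quotient.mk_surjective
  let φ : Q →+* B := Ideal.Quotient.lift I (algebraMap A B) (fun a ha => by
    obtain ⟨r, rfl⟩ := Ideal.mem_span_singleton'.mp ha
    rw [map_mul, hx0, mul_zero])
  let _ : Algebra Q B := φ.toAlgebra
  let _ : Module Q M := Module.compHom M φ
  have hφ : ∀ a : A, φ (Ideal.Quotient.mk I a) = algebraMap A B a := fun a => rfl
  have t1 : IsScalarTower Q B M := ⟨fun q b m => by
    change (φ q * b) • m = φ q • b • m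
    rw [mul_smul]⟩
  have t2 : IsScalarTower A Q M := ⟨fun a q m => by
    change φ (a • q) • m = a • φ q • m
    rw [Algebra.smul_def, map_mul, mul_smul]
    exact algebraMap_smul B a _⟩
  have hQsurj : Function.Surjective (algebraMap Q B) := fun b => by
    obtain ⟨a, rfl⟩ := hsurj b
    exact ⟨Ideal.Quotient.mk I a, rfl⟩
  have : Module.Finite Q B := Module.Finite.of_surjective (Algebra.linearMap Q B) hQsurj
  have : Module.Finite Q M := Module.Finite.trans B M
  have hlocQ : IsLocalHom (algebraMap Q B) := hQsurj.isLocalHom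
  refine ⟨Q, inferInstance, hQl, inferInstance, inferInstance, inferInstance, t1,
    fun i => Ideal.Quotient.mk I (f i.castSucc), ?_, hcons.quotient_of_cons, hQsurj, ?_, ?_⟩
  · intro i
    have : IsLocalHom (Ideal.Quotient.mk I) := Ideal.Quotient.mk_surjective.isLocalHom
    exact map_nonunit (Ideal.Quotient.mk I) _ (hfm i.castSucc)
  · apply le_antisymm
    · intro q hq
      obtain ⟨a, rfl⟩ := Ideal.Quotient.mk_surjective q
      have ha : a ∈ Ideal.span (Set.range f) := by
        rw [← hker]; exact hq
      have hle : Ideal.span (Set.range f) ≤ (Ideal.span (Set.range fun i : Fin c =>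
          Ideal.Quotient.mk I (f i.castSucc))).comap (Ideal.Quotient.mk I) := by
        rw [Ideal.span_le]
        rintro _ ⟨i, rfl⟩
        have hcast : ∀ i : Fin c, f i.castSucc ∈ (Ideal.span (Set.range fun i : Fin c =>
          Ideal.Quotient.mk I (f i.castSucc))).comap (Ideal.Quotient.mk I) := fun i =>
            Ideal.subset_span ⟨i, rfl⟩
        induction i using Fin.lastCases with
        | cast i => exact hcast i
        | last =>
          have h1 : initIdeal f c ≤ (Ideal.span (Set.range fun i : Fin c =>
              Ideal.Quotient.mk I (f i.castSucc))).comap (Ideal.Quotient.mk I) := by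
            rw [initIdeal, Ideal.span_le]
            rintro _ ⟨i, hi, rfl⟩
            exact hcast ⟨i, hi⟩
          have h2 := h1 hxs
          rw [Ideal.mem_comap, map_sub, Ideal.Quotient.eq_zero_iff_mem.mpr
            (Ideal.mem_span_singleton_self x), zero_sub, neg_mem_iff, map_mul] at h2
          exact (Ideal.unit_mul_mem_iff_mem _ (hunit.map (Ideal.Quotient.mk I))).mp h2
      exact hle ha
    · rw [Ideal.span_le]
      rintro _ ⟨i, rfl⟩
      change algebraMap A B (f i.castSucc) = 0
      rw [← RingHom.mem_ker, hker]
      exact Ideal.subset_span ⟨_, rfl⟩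
  · have hcur := h.restrictLine L
    refine hcur.projDimLE_of_parity (Q := Q) (J := J) ?_ Ideal.Quotient.mk_surjective ?_ ?_ hpar
    · intro i a ha
      have := hcons 0 a
      simp only [Fin.cons_zero, Fin.val_zero, initIdeal_zero] at this
      rw [Fin.val_eq_zero i, initIdeal_zero] at ha ⊢
      exact this ha
    · change RingHom.ker (Ideal.Quotient.mk I) = _
      rw [Ideal.mk_ker, Set.range_const]
    · refine RowsIndep.of_map (φ := MvPolynomial.map (ResidueField.map (algebraMap Q B)))
        (MvPolynomial.map_injective _ (RingHom.injective _)) ?_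
      convert hlJ using 1
      ext1 a b
      simp only [redMat, Matrix.map_apply]
      have hcomp : (ResidueField.map (algebraMap Q B)).comp ((residue Q).comp (algebraMap A Q)) =
          (residue B).comp (algebraMap A B) := RingHom.ext fun _ => rfl
      rw [MvPolynomial.map_map, map_lineMap, hcomp, funext hL]

lemma limsup_eq_of_eventually_zero {β β' : ℕ → ℕ} (h : ∀ n, β (n + 1) = 0)
    (h' : ∀ n, β' (n + 1) = 0) (N : ℕ) :
    limsup (fun i : ℕ => (β i : ENNReal) / (i : ENNReal) ^ N) atTop =
      limsup (fun i : ℕ => (β' i : ENNReal) / (i : ENNReal) ^ N) atTop := by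
  refine limsup_congr ?_
  filter_upwards [eventually_ge_atTop 1] with i hi
  obtain ⟨n, rfl⟩ := Nat.exists_eq_add_of_le' hi
  rw [h, h']

lemma IsCurvedRes.betti_eq_zero {A B M ι : Type} [CommRing A] [CommRing B] [IsLocalRing B]
    [Algebra A B] [AddCommGroup M] [Module A M] [Module B M] [IsScalarTower A B M] [Fintype ι]
    [DecidableEq ι] {f : Fin 0 → A} {deg : ι → ℕ} {D : Matrix ι ι (MvPolynomial (Fin 0) A)}
    {e : ι → M} (h : IsCurvedRes f deg D e) (hdeg : ∀ b, deg b ≤ 0) (hf : RegularInit f)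
    (hsurj : Function.Surjective (algebraMap A B))
    (hker : RingHom.ker (algebraMap A B) = Ideal.span (Set.range f)) {β : ℕ → ℕ}
    (hβ : IsMinRes B M β) (n : ℕ) : β (n + 1) = 0 := by
  have h1 := h.betti_add_rank hf hsurj hker hβ n
  have h2 : shCount deg 0 Finset.univ (n + 1) = 0 := by
    have : IsEmpty {p : ShIdx deg 0 (n + 1) // p.1.1 ∈ Finset.univ} := ⟨fun p => by
      have h3 := p.1.2
      have h4 := hdeg p.1.1.1
      have h5 : p.1.1.2.degree = 0 := by rw [Finsupp.degree_eq_zero_iff]; exact Subsingleton.elim _ _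
      omega⟩
    exact Nat.card_of_isEmpty
  omega

theorem limsup_betti_eq_of_completeIntersection {B M : Type} [CommRing B] [IsLocalRing B]
    [AddCommGroup M] [Module B M] [Module.Finite B M] [Infinite (ResidueField B)]
    {rs : List B} (hrs : ∀ x ∈ rs, x ∈ maximalIdeal B)
    (hreg : RingTheory.Sequence.IsRegular M rs) (hdim : ringKrullDim B ≤ rs.length)
    {β β' : ℕ → ℕ} (hβ : IsMinRes B M β) (hβ' : IsMinRes B (Module.Dual B M) β') (N : ℕ) (c : ℕ) :
    ∀ (A : Type) [CommRing A] [IsLocalRing A] [IsNoetherianRing A] [Algebra A B] [Module A M]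
      [IsScalarTower A B M] (f : Fin c → A) (_ : ∀ i, f i ∈ maximalIdeal A) (_ : RegularInit f)
      (_ : Function.Surjective (algebraMap A B))
      (_ : RingHom.ker (algebraMap A B) = Ideal.span (Set.range f)) (_ : ∃ m, ProjDimLE A M m),
      limsup (fun i : ℕ => (β i : ENNReal) / (i : ENNReal) ^ N) atTop =
        limsup (fun i : ℕ => (β' i : ENNReal) / (i : ENNReal) ^ N) atTop := by
  classical
  induction c with
  | zero =>
    intro A _ _ _ _ _ _ f hfm hf hsurj hker ⟨m, hm⟩
    have : Module.Finite A B := Module.Finite.of_surjective (Algebra.linearMap A B) hsurj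
    have : Module.Finite A M := Module.Finite.trans B M
    obtain ⟨ι, _, deg, d, e, hdeg, hres⟩ := exists_isGradedRes A 0 M
      (projDimLE_of_regular_sequence hsurj f hfm hker rs hrs hreg hdim hm)
    obtain ⟨D, hD⟩ := exists_isCurvedRes (f := f) (fun j => j.elim0) hres
    obtain ⟨e', hD'⟩ := hD.exists_dual hf hsurj hker hdeg
    exact limsup_eq_of_eventually_zero (hD.betti_eq_zero hdeg hf hsurj hker hβ)
      (hD'.betti_eq_zero (fun b => by simp) hf hsurj hker hβ') N
  | succ c ih =>
    intro A _ _ _ _ _ _ f hfm hf hsurj hker ⟨m, hm⟩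
    have : Module.Finite A B := Module.Finite.of_surjective (Algebra.linearMap A B) hsurj
    have : Module.Finite A M := Module.Finite.trans B M
    obtain ⟨ι, _, deg, d, e, hdeg, hres⟩ := exists_isGradedRes A (c + 1) M
      (projDimLE_of_regular_sequence hsurj f hfm hker rs hrs hreg hdim hm)
    have hkill : ∀ j (x : M), f j • x = 0 := fun j x => by
      have h0 : algebraMap A B (f j) = 0 := by
        rw [← RingHom.mem_ker, hker]; exact Ideal.subset_span ⟨j, rfl⟩
      rw [← algebraMap_smul B, h0, zero_smul]
    obtain ⟨D, hD⟩ := exists_isCurvedRes hkill hres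
    obtain ⟨e', hD'⟩ := hD.exists_dual hf hsurj hker hdeg
    obtain ⟨J, J', hcard, h1, h2, h3, h4⟩ := exists_rank_sets (redMat B D)
    by_cases hpar : ∀ ε, (Finset.univ.filter fun b => deg b % 2 = ε % 2).card = J.card
    · obtain ⟨Q, _, _, _, _, _, _, g, hgm, hg, hQs, hQk, hQ⟩ :=
        exists_hypersurface hfm hf hsurj hker hD hcard h1 h2 hpar
      exact ih Q g hgm hg hQs hQk hQ
    · exact hD.limsup_eq hdeg hD' hf hsurj hker hβ hβ' hcard h1 h2 h3 h4 hpar N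

end Induction

/-- If the maximal ideal of `S` is minimal over the extension of the maximal ideal of `R`, then
the dimension of `S` is at most that of `R`. -/
lemma ringKrullDim_le_of_mem_minimalPrimes_map {R S : Type} [CommRing R] [IsLocalRing R]
    [IsNoetherianRing R] [CommRing S] [IsLocalRing S] [IsNoetherianRing S] [Algebra R S]
    (h : maximalIdeal S ∈ ((maximalIdeal R).map (algebraMap R S)).minimalPrimes) :
    ringKrullDim S ≤ ringKrullDim R := by
  classical
  obtain ⟨s, hs, hc⟩ := (maximalIdeal R).exists_finset_card_eq_height_of_isNoetherianRing
  have key : maximalIdeal S ∈ (Ideal.span (s.image (algebraMap R S) : Set S)).minimalPrimes := by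
    rw [Finset.coe_image, ← Ideal.map_span]
    refine ⟨⟨inferInstance, (Ideal.map_mono hs.1.2).trans h.1.2⟩, fun Q ⟨hQ, hJ⟩ _ => ?_⟩
    refine h.2 ⟨hQ, ?_⟩ (le_maximalIdeal hQ.ne_top)
    rw [Ideal.map_le_iff_le_comap] at hJ ⊢
    have := Ideal.IsPrime.comap (algebraMap R S) (K := Q)
    exact hs.2 ⟨this, hJ⟩ (le_maximalIdeal this.ne_top)
  rw [← IsLocalRing.maximalIdeal_height_eq_ringKrullDim,
    ← IsLocalRing.maximalIdeal_height_eq_ringKrullDim, ← hc]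
  refine WithBot.coe_le_coe.mpr ((Ideal.height_le_card_of_mem_minimalPrimes_span_finset key).trans ?_)
  exact_mod_cast Finset.card_image_le

section BaseChange

variable {R M S : Type} [CommRing R] [AddCommGroup M] [Module R M] [CommRing S] [Algebra R S]

lemma Fintype.linearCombination_baseChange {G : Type} [Fintype G] [DecidableEq G] (e : G → M) :
    Fintype.linearCombination S (fun i => (1 : S) ⊗ₜ[R] e i) =
      (Fintype.linearCombination R e).baseChange S ∘ₗ
        ((TensorProduct.piScalarRight R S S G).symm : (G → S) →ₗ[S] S ⊗[R] (G → R)) := by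
  refine LinearMap.pi_ext' fun i => LinearMap.ext_ring ?_
  simp [TensorProduct.piScalarRight_symm_single, Fintype.linearCombination_apply_single]

lemma Matrix.mulVecLin_baseChange {G H : Type} [Fintype G] [Fintype H] [DecidableEq G]
    [DecidableEq H] (d : Matrix G H R) :
    (TensorProduct.piScalarRight R S S G).toLinearMap ∘ₗ d.mulVecLin.baseChange S ∘ₗ
        ((TensorProduct.piScalarRight R S S H).symm : (H → S) →ₗ[S] S ⊗[R] (H → R)) =
     (d.map (algebraMap R S)).mulVecLin := by
  refine LinearMap.pi_ext' fun i => LinearMap.ext_ring ?_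
  ext j
  simp [TensorProduct.piScalarRight_symm_single, Algebra.smul_def]

theorem IsMatrixRes.baseChange [Module.Flat R S] {G : ℕ → Type} [∀ n, Fintype (G n)]
    {d : ∀ n, Matrix (G n) (G (n + 1)) R} {e : G 0 → M} (h : IsMatrixRes d e) :
    IsMatrixRes (R := S) (fun n => (d n).map (algebraMap R S)) (fun i => (1 : S) ⊗ₜ[R] e i) := by
  classical
  have hd : ∀ n v, ((d n).map (algebraMap R S)).mulVec v = TensorProduct.piScalarRight R S S (G n)
      ((d n).mulVecLin.baseChange S ((TensorProduct.piScalarRight R S S (G (n + 1))).symm v)) :=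
    fun n v => (LinearMap.congr_fun (Matrix.mulVecLin_baseChange (S := S) (d n)) v).symm
  have he : ∀ v, Fintype.linearCombination S (fun i => (1 : S) ⊗ₜ[R] e i) v =
      (Fintype.linearCombination R e).baseChange S
        ((TensorProduct.piScalarRight R S S (G 0)).symm v) :=
    fun v => LinearMap.congr_fun (Fintype.linearCombination_baseChange (S := S) e) v
  have h0 : Function.Exact ((d 0).mulVecLin.baseChange S)
      ((Fintype.linearCombination R e).baseChange S) :=
    Module.Flat.lTensor_exact S (fun v => ⟨h.aug_exact v, by rintro ⟨u, rfl⟩; exact h.aug u⟩)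
  have hn : ∀ n, Function.Exact ((d (n + 1)).mulVecLin.baseChange S)
      ((d n).mulVecLin.baseChange S) := fun n =>
    Module.Flat.lTensor_exact S (fun v => ⟨h.exact n v, by rintro ⟨u, rfl⟩; exact h.sq n u⟩)
  refine ⟨fun m => ?_, fun v => ?_, fun v hv => ?_, fun n v => ?_, fun n v hv => ?_⟩
  · obtain ⟨x, hx⟩ := LinearMap.lTensor_surjective S
      (g := Fintype.linearCombination R e) h.surj m
    refine ⟨TensorProduct.piScalarRight R S S (G 0) x, ?_⟩
    rw [he, LinearEquiv.symm_apply_apply]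
    exact hx
  · rw [he, hd, LinearEquiv.symm_apply_apply]
    exact h0.apply_apply_eq_zero _
  · rw [he] at hv
    obtain ⟨u, hu⟩ := (h0 _).mp hv
    refine ⟨TensorProduct.piScalarRight R S S (G 1) u, ?_⟩
    rw [hd, LinearEquiv.symm_apply_apply, hu, LinearEquiv.apply_symm_apply]
  · rw [hd, hd, LinearEquiv.symm_apply_apply, (hn n).apply_apply_eq_zero, map_zero]
  · rw [hd, LinearEquiv.map_eq_zero_iff] at hv
    obtain ⟨u, hu⟩ := (hn n _).mp hv
    refine ⟨TensorProduct.piScalarRight R S S (G (n + 2)) u, ?_⟩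
    rw [hd, LinearEquiv.symm_apply_apply, hu, LinearEquiv.apply_symm_apply]

theorem IsMatrixRes.of_linearEquiv {M' : Type} [AddCommGroup M'] [Module R M'] {G : ℕ → Type}
    [∀ n, Fintype (G n)] {d : ∀ n, Matrix (G n) (G (n + 1)) R} {e : G 0 → M} (h : IsMatrixRes d e)
    (φ : M ≃ₗ[R] M') : IsMatrixRes d (φ ∘ e) := by
  have hφ : ∀ v, Fintype.linearCombination R (φ ∘ e) v = φ (Fintype.linearCombination R e v) := by
    intro v
    simp [Fintype.linearCombination_apply]
  refine ⟨fun m => ?_, fun v => by rw [hφ, h.aug, map_zero],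
    fun v hv => h.aug_exact v (by simpa [hφ] using hv), h.sq, h.exact⟩
  obtain ⟨v, hv⟩ := h.surj (φ.symm m)
  exact ⟨v, by rw [hφ, hv, φ.apply_symm_apply]⟩

end BaseChange

theorem IsMinRes.baseChange {R M S N : Type} [CommRing R] [IsLocalRing R] [AddCommGroup M]
    [Module R M] [CommRing S] [IsLocalRing S] [Algebra R S] [Module.Flat R S]
    [IsLocalHom (algebraMap R S)] [AddCommGroup N] [Module S N] {β : ℕ → ℕ}
    (h : IsMinRes R M β) (φ : S ⊗[R] M ≃ₗ[S] N) : IsMinRes S N β := by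
  obtain ⟨d, e, hde, hm⟩ := h
  exact ⟨_, _, hde.baseChange.of_linearEquiv φ,
    fun n i j => (((local_hom_TFAE (algebraMap R S)).out 0 3).mp ‹_› :
      maximalIdeal R ≤ (maximalIdeal S).comap (algebraMap R S)) (hm n i j)⟩

/-- Duals of finitely presented modules commute with flat base change. -/
theorem exists_dual_baseChange_linearEquiv (R M S : Type) [CommRing R] [AddCommGroup M]
    [Module R M] [CommRing S] [Algebra R S] [Module.Flat R S] [Module.FinitePresentation R M] :
    Nonempty (S ⊗[R] Module.Dual R M ≃ₗ[S] Module.Dual S (S ⊗[R] M)) := by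
  have h := Module.FinitePresentation.isBaseChange_map R M R S
  exact ⟨h.equiv.trans (LinearEquiv.congrRight (TensorProduct.AlgebraTensorModule.rid R S S))⟩

lemma ker_algebraMap_tensorProduct {A S B : Type} [CommRing A] [CommRing S] [CommRing B]
    [Algebra A S] [Algebra A B] (hsurj : Function.Surjective (algebraMap A B)) :
    RingHom.ker (algebraMap S (S ⊗[A] B)) =
      (RingHom.ker (algebraMap A B)).map (algebraMap A S) := by
  have h := Algebra.TensorProduct.lTensor_ker (R := A) (A := S) (Algebra.ofId A B) hsurj
  apply le_antisymm
  · intro x hx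
    have hx' : x ⊗ₜ[A] (1 : A) ∈ RingHom.ker (Algebra.TensorProduct.map (AlgHom.id A S)
        (Algebra.ofId A B)) := by
      rw [RingHom.mem_ker] at hx ⊢
      simpa using hx
    rw [h] at hx'
    have h2 := Ideal.mem_map_of_mem (Algebra.TensorProduct.rid A A S) hx'
    rw [Algebra.TensorProduct.rid_tmul, one_smul] at h2
    refine SetLike.le_def.mp ?_ h2
    rw [Ideal.map_le_iff_le_comap, Ideal.map_le_iff_le_comap]
    intro a ha
    rw [Ideal.mem_comap, Ideal.mem_comap]
    have : Algebra.TensorProduct.rid A A S (Algebra.TensorProduct.includeRight a) =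
        algebraMap A S a := by
      simp [Algebra.smul_def]
    rw [this]
    exact Ideal.mem_map_of_mem _ ha
  · rw [Ideal.map_le_iff_le_comap]
    intro a ha
    rw [RingHom.mem_ker] at ha
    rw [Ideal.mem_comap, RingHom.mem_ker, ← IsScalarTower.algebraMap_apply A S,
      Algebra.TensorProduct.algebraMap_apply', ha, tmul_zero]

lemma surjective_algebraMap_tensorProduct {A S B : Type} [CommRing A] [CommRing S] [CommRing B]
    [Algebra A S] [Algebra A B] (hsurj : Function.Surjective (algebraMap A B)) :
    Function.Surjective (algebraMap S (S ⊗[A] B)) := by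
  intro x
  induction x with
  | zero => exact ⟨0, map_zero _⟩
  | add x y hx hy =>
    obtain ⟨a, rfl⟩ := hx
    obtain ⟨b, rfl⟩ := hy
    exact ⟨a + b, map_add _ _ _⟩
  | tmul s b =>
    obtain ⟨a, rfl⟩ := hsurj b
    refine ⟨a • s, ?_⟩
    rw [Algebra.TensorProduct.algebraMap_apply, Algebra.algebraMap_self_apply, smul_tmul,
      Algebra.algebraMap_eq_smul_one]

theorem exists_localization_polynomial {A : Type} [CommRing A] [IsNoetherianRing A] (p : Ideal A)
    [p.IsPrime] : ∃ (S : Type) (_ : CommRing S) (_ : IsLocalRing S) (_ : IsNoetherianRing S)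
      (_ : Algebra A S) (_ : Module.Flat A S), p.map (algebraMap A S) = maximalIdeal S ∧
      (∀ a, a ∉ p → IsUnit (algebraMap A S a)) ∧
      ∃ x : ℕ → S, ∀ i j, i ≠ j → IsUnit (x i - x j) := by
  have hP : (p.map (Polynomial.C : A →+* Polynomial A)).IsPrime := Ideal.isPrime_map_C_of_isPrime
  let P := p.map (Polynomial.C : A →+* Polynomial A)
  have hfl : Module.Flat A (Localization.AtPrime P) :=
    Module.Flat.trans A (Polynomial A) (Localization.AtPrime P)
  have hu : ∀ g : Polynomial A, g ∉ P → IsUnit (algebraMap _ (Localization.AtPrime P) g) :=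
    fun g hg => IsLocalization.map_units (Localization.AtPrime P) (⟨g, hg⟩ : P.primeCompl)
  refine ⟨Localization.AtPrime P, inferInstance, inferInstance,
    IsLocalization.isNoetherianRing P.primeCompl _ inferInstance, inferInstance, hfl, ?_, ?_,
    fun i => algebraMap _ _ ((Polynomial.X : Polynomial A) ^ i), ?_⟩
  · rw [IsScalarTower.algebraMap_eq A (Polynomial A), ← Ideal.map_map]
    exact Localization.AtPrime.map_eq_maximalIdeal
  · intro a ha
    rw [IsScalarTower.algebraMap_apply A (Polynomial A)]
    refine hu _ fun h => ha ?_
    simpa using Ideal.mem_map_C_iff.mp h 0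
  · intro i j hij
    rw [← map_sub]
    refine hu _ fun h => ?_
    have := Ideal.mem_map_C_iff.mp h i
    rw [Polynomial.coeff_sub, Polynomial.coeff_X_pow_self, Polynomial.coeff_X_pow, if_neg hij,
      sub_zero] at this
    exact ‹p.IsPrime›.ne_top ((Ideal.eq_top_iff_one _).mpr this)

/-- A presentation `A → B` of a local complete intersection type together with a proper ideal `I`
of `B` can be extended flatly to one with infinite residue field in which `I` extends to an ideal
primary to the maximal ideal. -/
theorem exists_flat_extension {A B : Type} [CommRing A] [IsNoetherianRing A]
    [CommRing B] [Algebra A B] (hsurj : Function.Surjective (algebraMap A B)) {c : ℕ}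
    {f : Fin c → A} (hker : RingHom.ker (algebraMap A B) = Ideal.span (Set.range f))
    (I : Ideal B) (hI : I ≠ ⊤) :
    ∃ (A₁ B₁ : Type) (_ : CommRing A₁) (_ : CommRing B₁) (_ : IsLocalRing A₁)
      (_ : IsNoetherianRing A₁) (_ : IsLocalRing B₁) (_ : Algebra A A₁) (_ : Algebra A₁ B₁)
      (_ : Algebra B B₁) (_ : Algebra A B₁) (_ : IsScalarTower A A₁ B₁)
      (_ : IsScalarTower A B B₁) (_ : Algebra.IsPushout A A₁ B B₁) (_ : Module.Flat A A₁)
      (_ : Module.Flat B B₁) (_ : Infinite (ResidueField B₁)),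
      Function.Surjective (algebraMap A₁ B₁) ∧
      RingHom.ker (algebraMap A₁ B₁) = Ideal.span (Set.range fun i => algebraMap A A₁ (f i)) ∧
      (∀ i, algebraMap A A₁ (f i) ∈ maximalIdeal A₁) ∧
      maximalIdeal B₁ ∈ (I.map (algebraMap B B₁)).minimalPrimes := by
  obtain ⟨q, hq⟩ := Ideal.nonempty_minimalPrimes hI
  have hqp : q.IsPrime := hq.1.1
  let p := q.comap (algebraMap A B)
  have hpp : p.IsPrime := Ideal.IsPrime.comap _
  obtain ⟨S, _, _, _, _, _, hpS, hu, x, hx⟩ := exists_localization_polynomial p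
  let _ : Algebra B (S ⊗[A] B) := Algebra.TensorProduct.rightAlgebra
  have hs := surjective_algebraMap_tensorProduct (S := S) hsurj
  have hf : ∀ i, algebraMap A S (f i) ∈ maximalIdeal S := by
    intro i
    rw [← hpS]
    refine Ideal.mem_map_of_mem _ ?_
    have : f i ∈ RingHom.ker (algebraMap A B) := hker ▸ Ideal.subset_span ⟨i, rfl⟩
    rw [RingHom.mem_ker] at this
    rw [Ideal.mem_comap, this]
    exact q.zero_mem
  have hk : RingHom.ker (algebraMap S (S ⊗[A] B)) =
      Ideal.span (Set.range fun i => algebraMap A S (f i)) := by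
    rw [ker_algebraMap_tensorProduct hsurj, hker, Ideal.map_span, ← Set.range_comp]
    rfl
  have hnt : Nontrivial (S ⊗[A] B) := by
    refine nontrivial_of_ne 0 1 fun h01 => ?_
    have : (1 : S) ∈ RingHom.ker (algebraMap S (S ⊗[A] B)) := by
      rw [RingHom.mem_ker, map_one, h01]
    rw [hk] at this
    refine (maximalIdeal.isMaximal S).ne_top ((Ideal.eq_top_iff_one _).mpr
      (Ideal.span_le.mpr ?_ this))
    rintro _ ⟨i, rfl⟩
    exact hf i
  have hloc : IsLocalRing (S ⊗[A] B) := IsLocalRing.of_surjective' _ hs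
  have hlh : IsLocalHom (algebraMap S (S ⊗[A] B)) := hs.isLocalHom
  have hflat : Module.Flat B (S ⊗[A] B) := by
    have : Algebra.IsPushout A B S (S ⊗[A] B) := inferInstance
    exact Module.Flat.isBaseChange A B S (S ⊗[A] B) this.out
  have hcomm : ∀ a, algebraMap B (S ⊗[A] B) (algebraMap A B a) =
      algebraMap S (S ⊗[A] B) (algebraMap A S a) := by
    intro a
    rw [← IsScalarTower.algebraMap_apply, ← IsScalarTower.algebraMap_apply]
  refine ⟨S, S ⊗[A] B, inferInstance, inferInstance, inferInstance, inferInstance, hloc,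
    inferInstance, inferInstance, inferInstance, inferInstance, inferInstance, inferInstance,
    inferInstance, inferInstance, hflat, ?_, hs, hk, hf, ⟨inferInstance, ?_⟩, ?_⟩
  · refine Infinite.of_injective (fun n => residue _ (algebraMap S (S ⊗[A] B) (x n))) ?_
    intro i j hij
    by_contra hne
    have h1 := ((hx i j hne).map (algebraMap S (S ⊗[A] B))).map (residue (S ⊗[A] B))
    rw [map_sub, map_sub, sub_eq_zero.mpr hij] at h1
    exact not_isUnit_zero h1
  · rw [Ideal.map_le_iff_le_comap]
    intro b hb
    obtain ⟨a, rfl⟩ := hsurj b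
    rw [Ideal.mem_comap, hcomm]
    refine (((local_hom_TFAE (algebraMap S (S ⊗[A] B))).out 0 3).mp hlh :
      maximalIdeal S ≤ (maximalIdeal (S ⊗[A] B)).comap (algebraMap S (S ⊗[A] B))) ?_
    rw [← hpS]
    exact Ideal.mem_map_of_mem _ (hq.1.2 hb)
  · rintro Q ⟨hQ, hIQ⟩ _
    rw [Ideal.map_le_iff_le_comap] at hIQ
    have hle : q ≤ Q.comap (algebraMap B (S ⊗[A] B)) := by
      refine hq.2 ⟨hQ.comap _, hIQ⟩ fun b hb => ?_
      obtain ⟨a, rfl⟩ := hsurj b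
      by_contra hna
      rw [Ideal.mem_comap, hcomm] at hb
      exact hQ.ne_top (Ideal.eq_top_of_isUnit_mem _ hb ((hu a hna).map _))
    have hle2 : maximalIdeal S ≤ Q.comap (algebraMap S (S ⊗[A] B)) := by
      rw [← hpS, Ideal.map_le_iff_le_comap]
      intro a ha
      rw [Ideal.mem_comap, Ideal.mem_comap, ← hcomm]
      exact hle ha
    intro y hy
    obtain ⟨z, rfl⟩ := hs y
    exact hle2 fun hz => hy (hz.map _)

lemma RegularInit.of_flat {A S : Type} [CommRing A] [CommRing S] [Algebra A S] [Module.Flat A S]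
    {c : ℕ} {f : Fin c → A} (h : RegularInit f) : RegularInit fun i => algebraMap A S (f i) := by
  rw [regularInit_iff] at h ⊢
  have := h.of_flat (S := S)
  rwa [List.map_ofFn] at this

/-- A finite free resolution of `N` over `A` bounds the projective dimension of the extension
of `N` along a pushout of a flat extension of `A`. -/
lemma IsMatrixRes.projDimLE_pushout {A S B B₁ N N₁ : Type} [CommRing A] [CommRing S] [CommRing B]
    [CommRing B₁] [Algebra A S] [Algebra A B] [Algebra S B₁] [Algebra B B₁] [Algebra A B₁]
    [IsScalarTower A S B₁] [IsScalarTower A B B₁] [Algebra.IsPushout A S B B₁] [Module.Flat A S]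
    [AddCommGroup N] [Module A N] [Module B N] [IsScalarTower A B N] [AddCommGroup N₁]
    [Module S N₁] [Module B₁ N₁] [IsScalarTower S B₁ N₁] (φ : B₁ ⊗[B] N ≃ₗ[B₁] N₁)
    {G : ℕ → Type} [∀ n, Fintype (G n)] {d : ∀ n, Matrix (G n) (G (n + 1)) A} {e : G 0 → N}
    (h : IsMatrixRes d e) {m : ℕ} (hm : IsEmpty (G m)) : ProjDimLE S N₁ m :=
  ((h.baseChange (S := S)).projDimLE m hm).of_linearEquiv
    ((Algebra.IsPushout.cancelBaseChange A S B B₁ N).symm.trans (φ.restrictScalars S))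

theorem limsup_betti_eq_of_flat_completeIntersection {A B B' M M' : Type} [CommRing B]
    [IsNoetherianRing B] [IsLocalRing B] [AddCommGroup M] [Module B M] [Module.Finite B M]
    {rs : List B} (hrs : ∀ x ∈ rs, x ∈ maximalIdeal B)
    (hreg : RingTheory.Sequence.IsRegular M rs) (hdim : ringKrullDim B ≤ rs.length)
    {β β' : ℕ → ℕ} (hβ : IsMinRes B M β) (hβ' : IsMinRes B (Module.Dual B M) β')
    [CommRing A] [IsNoetherianRing A] [CommRing B'] [IsLocalRing B'] [Algebra B B']
    [Module.Flat B B'] [IsLocalHom (algebraMap B B')] [Algebra A B']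
    (hsurj : Function.Surjective (algebraMap A B')) {c : ℕ} {f : Fin c → A}
    (hf : RegularInit f) (hker : RingHom.ker (algebraMap A B') = Ideal.span (Set.range f))
    [AddCommGroup M'] {_ : Module A M'} [Module B' M'] (φ : B' ⊗[B] M ≃ₗ[B'] M')
    (hM' : ∀ (a : A) (x : M'), a • x = algebraMap A B' a • x) {G : ℕ → Type}
    [∀ n, Fintype (G n)] {d : ∀ n, Matrix (G n) (G (n + 1)) A} {e : G 0 → M'}
    (h : IsMatrixRes d e) {m : ℕ} (hm : IsEmpty (G m)) (N : ℕ) :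
    limsup (fun i : ℕ => (β i : ENNReal) / (i : ENNReal) ^ N) atTop
      = limsup (fun i : ℕ => (β' i : ENNReal) / (i : ENNReal) ^ N) atTop := by
  have : IsScalarTower A B' M' := IsScalarTower.of_algebraMap_smul fun a x => (hM' a x).symm
  have hI : (maximalIdeal B).map (algebraMap B B') ≠ ⊤ := fun htop =>
    (maximalIdeal.isMaximal B').ne_top (top_le_iff.mp (htop ▸
      (((local_hom_TFAE (algebraMap B B')).out 0 2).mp ‹_› :
        (maximalIdeal B).map (algebraMap B B') ≤ maximalIdeal B')))
  obtain ⟨A₁, B₁, _, _, _, _, _, _, _, _, _, _, _, _, _, _, _, hs₁, hk₁, hf₁, hmin⟩ :=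
    exists_flat_extension hsurj hker _ hI
  let _ : Algebra B B₁ := ((algebraMap B' B₁).comp (algebraMap B B')).toAlgebra
  have : IsScalarTower B B' B₁ := IsScalarTower.of_algebraMap_eq fun _ => rfl
  have : Module.Flat B B₁ := Module.Flat.trans B B' B₁
  rw [Ideal.map_map, ← IsScalarTower.algebraMap_eq] at hmin
  have hle : maximalIdeal B ≤ (maximalIdeal B₁).comap (algebraMap B B₁) :=
    Ideal.map_le_iff_le_comap.mp hmin.1.2
  have : IsLocalHom (algebraMap B B₁) := ((local_hom_TFAE (algebraMap B B₁)).out 0 3).mpr hle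
  have : Module.FaithfullyFlat B B₁ := Module.FaithfullyFlat.of_flat_of_isLocalHom
  have : IsNoetherianRing B₁ := isNoetherianRing_of_surjective _ _ _ hs₁
  have : Module.FinitePresentation B M := Module.finitePresentation_of_finite B M
  obtain ⟨δ⟩ := exists_dual_baseChange_linearEquiv B M B₁
  refine limsup_betti_eq_of_completeIntersection (B := B₁) (M := B₁ ⊗[B] M)
    (rs := rs.map (algebraMap B B₁)) ?_
    (hreg.of_faithfullyFlat_of_isBaseChange (TensorProduct.isBaseChange B M B₁)) ?_
    (hβ.baseChange (LinearEquiv.refl _ _)) (hβ'.baseChange δ) N c A₁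
    (fun i => algebraMap A A₁ (f i)) hf₁ hf.of_flat hs₁ hk₁ ⟨m, h.projDimLE_pushout
      ((TensorProduct.AlgebraTensorModule.congr (LinearEquiv.refl B₁ B₁) φ.symm).trans
        (TensorProduct.AlgebraTensorModule.cancelBaseChange B B' B₁ B₁ M)) hm⟩
  · intro x hx
    obtain ⟨y, hy, rfl⟩ := List.mem_map.mp hx
    exact hle (hrs y hy)
  · rw [List.length_map]
    exact (ringKrullDim_le_of_mem_minimalPrimes_map hmin).trans hdim

lemma IsMinimalFreeResolutionBetti.isMinRes {B M : Type} [CommRing B] [IsLocalRing B]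
    [AddCommGroup M] [Module B M] {β : ℕ → ℕ} (h : IsMinimalFreeResolutionBetti B M β) :
    IsMinRes B M β := by
  obtain ⟨d, ε, hε, h0, hd, hm⟩ := h
  refine ⟨_, _, isMatrixRes_of_linearMaps d ε hε h0 hd, fun n i j => ?_⟩
  rw [LinearMap.toMatrix'_apply]
  exact coord_mem_of_mem_smul_top (hm n ⟨_, rfl⟩) i

/-- Let `B` be a Noetherian local ring and `M` a finitely generated
`B`-module which is maximal Cohen–Macaulay and of finite CI-dimension, with dual
`M^∨ = Hom_B(M, B)`. Then for every `n`, `limsup β i / iⁿ = limsup β' i / iⁿ` in `[0,∞]`,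
where `β`, `β'` are the Betti numbers of minimal free resolutions of `M` and `M^∨`;
in particular the complexities and Betti degrees of `M` and `M^∨` coincide. -/
theorem stmt_9
    (B : Type) [CommRing B] [IsNoetherianRing B] [IsLocalRing B]
    (M : Type) [AddCommGroup M] [Module B M] [Module.Finite B M]
    (hMCM : ∃ rs : List B, (∀ x ∈ rs, x ∈ maximalIdeal B) ∧
      RingTheory.Sequence.IsRegular M rs ∧ (rs.length : WithBot ℕ∞) = ringKrullDim B)
    (hCI : Nonempty (FiniteCIDimWitness B M))
    (β β' : ℕ → ℕ)
    (hβ : IsMinimalFreeResolutionBetti B M β)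
    (hβ' : IsMinimalFreeResolutionBetti B (Module.Dual B M) β')
    (n : ℕ) :
    limsup (fun i : ℕ => (β i : ENNReal) / (i : ENNReal) ^ n) atTop
      = limsup (fun i : ℕ => (β' i : ENNReal) / (i : ENNReal) ^ n) atTop := by
  obtain ⟨rs, hrs, hreg, hdim⟩ := hMCM
  obtain ⟨W⟩ := hCI
  obtain ⟨A, B', _, _, π, hsurj, c, f, _, hfreg, hker, hcompat, βA, ⟨d, ε, hε, h0, hd⟩, m, hm⟩ := W
  let _ : Algebra A B' := π.toAlgebra
  have hem : IsEmpty (Fin (βA (m + 1))) := by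
    rw [hm (m + 1) m.lt_succ_self]
    infer_instance
  exact limsup_betti_eq_of_flat_completeIntersection hrs hreg hdim.ge hβ.isMinRes hβ'.isMinRes
    hsurj ((regularInit_iff f).mpr hfreg.toIsWeaklyRegular) hker (LinearEquiv.refl _ _) hcompat
    (isMatrixRes_of_linearMaps d ε hε h0 hd) hem n
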